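/- arXiv:1504.01810 — 16 statements merged into one kernel-verified Lean document; each statement's English description precedes it below -/
import Mathlib

section
/- For every even integer k with 0 ≤ k ≤ 2(n−1), the vector v_k ∈ ℝ^{2n+1} with components (v_k)_j = (n·sin ℓ)^{−1/2}·cos(j·l_k·π/(2n)) for j = −n,…,n satisfies the generalised eigenproblem (𝓛 − λ_k·B)·v_k = 0. -/
open Real

/-- For every even integer `k` with `0 ≤ k ≤ 2(n−1)`, the vector
`v_k ∈ ℝ^{2n+1}` with components `(v_k)_j = (n sin ℓ)^{-1/2} cos(j l_k π / (2n))`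
satisfies the generalised eigenproblem `(𝓛 − λ_k B) v_k = 0`. -/
theorem stmt_0 (n : ℕ) (hn : 2 ≤ n) (ℓ : ℝ) (hℓ0 : 0 < ℓ) (hℓπ : ℓ < π)
    (B L : ℤ → ℤ → ℝ)
    (hB : ∀ i j : ℤ, B i j = if i = j ∧ |i| ≤ (n : ℤ) - 1 then 1 else 0)
    (hLmid : ∀ i j : ℤ, |i| ≤ (n : ℤ) - 1 →
      L i j = if j = i then -2 else if j = i - 1 ∨ j = i + 1 then 1 else 0)
    (hLtop : ∀ j : ℤ, L (n : ℤ) j =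
      if j = (n : ℤ) then -1 else if j = 0 then Real.cos ℓ else 0)
    (hLbot : ∀ j : ℤ, L (-(n : ℤ)) j =
      if j = -(n : ℤ) then -1 else if j = 0 then Real.cos ℓ else 0)
    (k : ℕ) (hk : k ≤ 2 * (n - 1)) (hke : Even k)
    (lk : ℝ) (hlk : lk = (k : ℝ) + 1 + (-1 : ℝ) ^ (k / 2) * (2 * ℓ / π - 1))
    (lam : ℝ) (hlam : lam = -2 * (1 - Real.cos (π * lk / (2 * n))))
    (v : ℤ → ℝ)
    (hv : ∀ j : ℤ, v j = ((n : ℝ) * Real.sin ℓ) ^ (-(1/2) : ℝ) *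
      Real.cos ((j : ℝ) * lk * π / (2 * n))) :
    ∀ i : ℤ, |i| ≤ (n : ℤ) →
      ∑ j ∈ Finset.Icc (-(n : ℤ)) (n : ℤ), (L i j - lam * B i j) * v j = 0 := by
  have hn0 : (n : ℝ) ≠ 0 := by
    have : n ≠ 0 := by omega
    exact_mod_cast this
  have hcos : Real.cos (lk * π / 2) = Real.cos ℓ := by
    obtain ⟨m, hm⟩ := hke
    have hk2 : k / 2 = m := by omega
    have hpi : π ≠ 0 := Real.pi_ne_zero
    rw [hk2] at hlk
    have hkr : (k : ℝ) = m + m := by exact_mod_cast hm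
    rcases Nat.even_or_odd m with he | ho
    · rw [he.neg_one_pow] at hlk
      obtain ⟨r, hr⟩ := he
      have hmr : (m : ℝ) = r + r := by exact_mod_cast hr
      have : lk * π / 2 = ℓ + (r : ℕ) * (2 * π) := by
        rw [hlk, hkr, hmr]; field_simp; ring
      rw [this, Real.cos_add_nat_mul_two_pi]
    · rw [ho.neg_one_pow] at hlk
      obtain ⟨r, hr⟩ := ho
      have hmr : (m : ℝ) = 2 * r + 1 := by exact_mod_cast hr
      have : lk * π / 2 = ((r + 1 : ℕ) : ℝ) * (2 * π) - ℓ := by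
        push_cast
        rw [hlk, hkr, hmr]; field_simp; ring
      rw [this, Real.cos_nat_mul_two_pi_sub]
  have hv0 : v 0 = ((n : ℝ) * Real.sin ℓ) ^ (-(1/2) : ℝ) := by
    rw [hv]; simp
  have hvn : v n = v 0 * Real.cos ℓ := by
    rw [hv0, hv, ← hcos]
    congr 2
    push_cast
    field_simp
  have hvn' : v (-n) = v 0 * Real.cos ℓ := by
    rw [hv0, hv, ← hcos, ← Real.cos_neg]
    congr 2
    push_cast
    field_simp
  intro i hi
  rw [abs_le] at hi
  by_cases hmid : |i| ≤ (n : ℤ) - 1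
  · have hi2 := abs_le.mp hmid
    have key : ∀ j ∈ Finset.Icc (-(n : ℤ)) (n : ℤ), (L i j - lam * B i j) * v j =
        (if j = i then (-2 - lam) * v i else 0) + (if j = i - 1 then v (i - 1) else 0)
          + (if j = i + 1 then v (i + 1) else 0) := by
      intro j _
      rw [hLmid i j hmid, hB]
      by_cases h1 : j = i
      · subst h1
        have : ¬ (j = j - 1) := by omega
        simp [hmid, this]
      · have h1' : ¬ i = j := fun h => h1 h.symm
        by_cases h2 : j = i - 1
        · subst h2
          have : ¬ (i - 1 = i + 1) := by omega
          simp [this, h1']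
        · by_cases h3 : j = i + 1
          · subst h3
            have : ¬ (i + 1 = i - 1) := by omega
            simp [this]
          · simp [h1, h1', h2, h3]
    rw [Finset.sum_congr rfl key, Finset.sum_add_distrib, Finset.sum_add_distrib,
      Finset.sum_ite_eq', Finset.sum_ite_eq', Finset.sum_ite_eq',
      if_pos (Finset.mem_Icc.mpr ⟨by omega, by omega⟩),
      if_pos (Finset.mem_Icc.mpr ⟨by omega, by omega⟩),
      if_pos (Finset.mem_Icc.mpr ⟨by omega, by omega⟩)]
    rw [hlam, hv, hv, hv]
    have e1 : ((i - 1 : ℤ) : ℝ) * lk * π / (2 * n)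
        = (i : ℝ) * lk * π / (2 * n) - π * lk / (2 * n) := by push_cast; ring
    have e2 : ((i + 1 : ℤ) : ℝ) * lk * π / (2 * n)
        = (i : ℝ) * lk * π / (2 * n) + π * lk / (2 * n) := by push_cast; ring
    rw [e1, e2, Real.cos_sub, Real.cos_add]
    ring
  · have hBi : ∀ j, B i j = 0 := by intro j; rw [hB]; simp [hmid]
    have gen : ∀ a : ℤ, a ≠ 0 → -(n : ℤ) ≤ a → a ≤ n → v a = v 0 * Real.cos ℓ →
        (∀ j : ℤ, L a j = if j = a then -1 else if j = 0 then Real.cos ℓ else 0) →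
        (∀ j, B a j = 0) →
        ∑ j ∈ Finset.Icc (-(n : ℤ)) (n : ℤ), (L a j - lam * B a j) * v j = 0 := by
      intro a ha h1 h2 hva hL hBa
      have key : ∀ j ∈ Finset.Icc (-(n : ℤ)) (n : ℤ), (L a j - lam * B a j) * v j =
          (if j = a then - v a else 0) + (if j = 0 then Real.cos ℓ * v 0 else 0) := by
        intro j _
        rw [hL, hBa]
        by_cases h1 : j = a
        · subst h1; simp [ha]
        · by_cases h2 : j = 0
          · subst h2; simp [h1]
          · simp [h1, h2]
      rw [Finset.sum_congr rfl key, Finset.sum_add_distrib,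
        Finset.sum_ite_eq', Finset.sum_ite_eq',
        if_pos (Finset.mem_Icc.mpr ⟨by omega, by omega⟩),
        if_pos (Finset.mem_Icc.mpr ⟨by omega, by omega⟩), hva]
      ring
    have hcase : i = n ∨ i = -n := by
      rw [abs_le] at hmid
      omega
    rcases hcase with h | h
    · subst h
      exact gen _ (by omega) (by omega) (by omega) hvn hLtop hBi
    · subst h
      exact gen _ (by omega) (by omega) (by omega) hvn' hLbot hBi
end

section
/- For every odd integer k with 0 ≤ k ≤ 2(n−1), the vector v_k ∈ ℝ^{2n+1} with components (v_k)_j = n^{−1/2}·sin(j·l_k·π/(2n)) for j = −n,…,n satisfies the generalised eigenproblem (𝓛 − λ_k·B)·v_k = 0. -/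
open Real

/-- For every odd integer `k` with `0 ≤ k ≤ 2(n−1)`, the vector
`v_k ∈ ℝ^{2n+1}` with components `(v_k)_j = n^{-1/2} sin(j l_k π / (2n))`
satisfies the generalised eigenproblem `(𝓛 − λ_k B) v_k = 0`. -/
theorem stmt_1 (n : ℕ) (hn : 2 ≤ n) (ℓ : ℝ) (hℓ0 : 0 < ℓ) (hℓπ : ℓ < π)
    (B L : ℤ → ℤ → ℝ)
    (hB : ∀ i j : ℤ, B i j = if i = j ∧ |i| ≤ (n : ℤ) - 1 then 1 else 0)
    (hLmid : ∀ i j : ℤ, |i| ≤ (n : ℤ) - 1 →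
      L i j = if j = i then -2 else if j = i - 1 ∨ j = i + 1 then 1 else 0)
    (hLtop : ∀ j : ℤ, L (n : ℤ) j =
      if j = (n : ℤ) then -1 else if j = 0 then Real.cos ℓ else 0)
    (hLbot : ∀ j : ℤ, L (-(n : ℤ)) j =
      if j = -(n : ℤ) then -1 else if j = 0 then Real.cos ℓ else 0)
    (k : ℕ) (hk : k ≤ 2 * (n - 1)) (hko : Odd k)
    (lk : ℝ) (hlk : lk = (k : ℝ) + 1)
    (lam : ℝ) (hlam : lam = -2 * (1 - Real.cos (π * lk / (2 * n))))
    (v : ℤ → ℝ)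
    (hv : ∀ j : ℤ, v j = (n : ℝ) ^ (-(1/2) : ℝ) *
      Real.sin ((j : ℝ) * lk * π / (2 * n))) :
    ∀ i : ℤ, |i| ≤ (n : ℤ) →
      ∑ j ∈ Finset.Icc (-(n : ℤ)) (n : ℤ), (L i j - lam * B i j) * v j = 0 := by
  intro i hi
  have hn0 : (n : ℝ) ≠ 0 := by
    have : n ≠ 0 := by omega
    exact_mod_cast this
  have hi' := abs_le.mp hi
  by_cases hmid : |i| ≤ (n : ℤ) - 1
  · have hm := abs_le.mp hmid
    have key : ∀ j : ℤ, (L i j - lam * B i j) * v j =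
        (if j = i then (-2 - lam) * v i else 0) + (if j = i - 1 then v (i - 1) else 0)
          + (if j = i + 1 then v (i + 1) else 0) := by
      intro j
      rw [hLmid i j hmid, hB]
      by_cases h1 : j = i
      · subst h1
        simp [hmid]
        intro h
        omega
      · have h1' : ¬ i = j := fun h => h1 h.symm
        by_cases h2 : j = i - 1
        · subst h2
          have h3 : ¬ (i - 1 = i + 1) := by omega
          simp [h3, h1']
        · by_cases h3 : j = i + 1
          · subst h3
            have h3 : ¬ (i + 1 = i - 1) := by omega
            simp [h3]
          · simp [h1, h1', h2, h3]
    rw [Finset.sum_congr rfl (fun j _ => key j), Finset.sum_add_distrib, Finset.sum_add_distrib,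
      Finset.sum_ite_eq', Finset.sum_ite_eq', Finset.sum_ite_eq',
      if_pos (Finset.mem_Icc.mpr (by omega)), if_pos (Finset.mem_Icc.mpr (by omega)),
      if_pos (Finset.mem_Icc.mpr (by omega)), hv, hv, hv, hlam]
    have e1 : (((i - 1 : ℤ) : ℝ)) * lk * π / (2 * n)
        = (i : ℝ) * lk * π / (2 * n) - π * lk / (2 * n) := by
      push_cast; ring
    have e2 : (((i + 1 : ℤ) : ℝ)) * lk * π / (2 * n)
        = (i : ℝ) * lk * π / (2 * n) + π * lk / (2 * n) := by
      push_cast; ring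
    rw [e1, e2, Real.sin_sub, Real.sin_add]
    ring
  · obtain ⟨m, hm⟩ := hko
    have hv0 : v 0 = 0 := by simp [hv]
    have hlk' : lk = 2 * ((m : ℝ) + 1) := by rw [hlk, hm]; push_cast; ring
    have hvn : v n = 0 := by
      rw [hv, hlk']
      have : ((n : ℤ) : ℝ) * (2 * ((m : ℝ) + 1)) * π / (2 * n) = ((m + 1 : ℕ) : ℝ) * π := by
        push_cast; field_simp
      rw [this, Real.sin_nat_mul_pi, mul_zero]
    have hvn' : v (-n) = 0 := by
      have : v (-n) = - v n := by
        rw [hv, hv]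
        have : ((-(n : ℤ) : ℤ) : ℝ) * lk * π / (2 * n)
            = -(((n : ℤ) : ℝ) * lk * π / (2 * n)) := by push_cast; ring
        rw [this, Real.sin_neg]; ring
      rw [this, hvn, neg_zero]
    apply Finset.sum_eq_zero
    intro j _
    have hB0 : B i j = 0 := by rw [hB, if_neg (fun h => hmid h.2)]
    have hcase : i = n ∨ i = -n := by
      rcases abs_cases i with h | h <;> omega
    rw [hB0]
    rcases hcase with h | h
    · subst h
      rw [hLtop]
      split_ifs with h1 h2
      · rw [h1, hvn, mul_zero]
      · rw [h2, hv0, mul_zero]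
      · simp
    · subst h
      rw [hLbot]
      split_ifs with h1 h2
      · rw [h1, hvn', mul_zero]
      · rw [h2, hv0, mul_zero]
      · simp
end

section
/- For every even integer k with 0 ≤ k ≤ 2(n−1), the vector z_k ∈ ℝ^{2n+1} with components (z_k)_j = (n·sin ℓ)^{−1/2}·sin(ℓ − (−1)^{k/2}·|j|·l_k·π/(2n)) for |j| ≤ n−1 and (z_k)_{n} = (z_k)_{n−1}, (z_k)_{−n} = (z_k)_{−(n−1)}, satisfies the adjoint generalised eigenproblem z_k^T·(𝓛 − λ_k·B) = 0. -/
open Real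

/-- For every even integer `k` with `0 ≤ k ≤ 2(n−1)`, the vector
`z_k ∈ ℝ^{2n+1}` with components `(z_k)_j = (n sin ℓ)^{-1/2} sin(ℓ − (−1)^{k/2}|j| l_k π/(2n))`
for `|j| ≤ n−1`, and `(z_k)_{±n} = (z_k)_{±(n−1)}`, satisfies the adjoint
generalised eigenproblem `z_k^T (𝓛 − λ_k B) = 0`. -/
theorem stmt_2 (n : ℕ) (hn : 2 ≤ n) (ℓ : ℝ) (hℓ0 : 0 < ℓ) (hℓπ : ℓ < π)
    (B L : ℤ → ℤ → ℝ)
    (hB : ∀ i j : ℤ, B i j = if i = j ∧ |i| ≤ (n : ℤ) - 1 then 1 else 0)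
    (hLmid : ∀ i j : ℤ, |i| ≤ (n : ℤ) - 1 →
      L i j = if j = i then -2 else if j = i - 1 ∨ j = i + 1 then 1 else 0)
    (hLtop : ∀ j : ℤ, L (n : ℤ) j =
      if j = (n : ℤ) then -1 else if j = 0 then Real.cos ℓ else 0)
    (hLbot : ∀ j : ℤ, L (-(n : ℤ)) j =
      if j = -(n : ℤ) then -1 else if j = 0 then Real.cos ℓ else 0)
    (k : ℕ) (hk : k ≤ 2 * (n - 1)) (hke : Even k)
    (lk : ℝ) (hlk : lk = (k : ℝ) + 1 + (-1 : ℝ) ^ (k / 2) * (2 * ℓ / π - 1))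
    (lam : ℝ) (hlam : lam = -2 * (1 - Real.cos (π * lk / (2 * n))))
    (z : ℤ → ℝ)
    (hz : ∀ j : ℤ, |j| ≤ (n : ℤ) - 1 →
      z j = ((n : ℝ) * Real.sin ℓ) ^ (-(1/2) : ℝ) *
        Real.sin (ℓ - (-1 : ℝ) ^ (k / 2) * (|j| : ℤ) * lk * π / (2 * n)))
    (hzn : z (n : ℤ) = z ((n : ℤ) - 1))
    (hzmn : z (-(n : ℤ)) = z (-((n : ℤ) - 1))) :
    ∀ j : ℤ, |j| ≤ (n : ℤ) →
      ∑ i ∈ Finset.Icc (-(n : ℤ)) (n : ℤ), z i * (L i j - lam * B i j) = 0 := by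
  set C : ℝ := ((n : ℝ) * Real.sin ℓ) ^ (-(1/2) : ℝ) with hC
  obtain ⟨m, rfl⟩ := hke
  have hm : (m + m) / 2 = m := by omega
  rw [hm] at hlk hz
  set s : ℝ := (-1 : ℝ) ^ m with hs
  set θ : ℝ := π * lk / (2 * n) with hθ
  have hn0 : (n : ℝ) ≠ 0 := by
    have : 0 < n := by omega
    positivity
  have hπ := Real.pi_ne_zero
  -- the phase at `n` is a multiple of `2π`
  have hphase : ∃ q : ℤ, ℓ - s * (n * θ) = q * (2 * π) := by
    have h1 : n * θ = π * lk / 2 := by rw [hθ]; field_simp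
    have h2 : π * lk / 2 = m * π + π / 2 + s * (ℓ - π / 2) := by
      rw [hlk]; push_cast; field_simp; ring
    rw [h1, h2]
    rcases Nat.even_or_odd m with h | h
    · have : s = 1 := by rw [hs]; exact h.neg_one_pow
      obtain ⟨a, rfl⟩ := h
      refine ⟨-a, ?_⟩
      rw [this]; push_cast; ring
    · have : s = -1 := by rw [hs]; exact h.neg_one_pow
      obtain ⟨a, rfl⟩ := h
      refine ⟨a + 1, ?_⟩
      rw [this]; push_cast; ring
  have hs2 : s = 1 ∨ s = -1 := neg_one_pow_eq_or ℝ m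
  have hcoss : Real.cos (s * θ) = Real.cos θ := by
    rcases hs2 with h | h <;> rw [h] <;> simp
  obtain ⟨q, hq⟩ := hphase
  clear_value C s θ
  obtain ⟨f, hf⟩ : ∃ f : ℤ → ℝ, ∀ i, f i = C * Real.sin (ℓ - s * (i * θ)) := ⟨_, fun _ => rfl⟩
  have hfn : f n = 0 := by
    rw [hf, Int.cast_natCast, hq]
    have : Real.sin (q * (2 * π)) = 0 := by
      have := Real.sin_int_mul_pi (q * 2)
      push_cast at this
      rw [← this]; ring_nf
    rw [this, mul_zero]
  have hfn1 : f (n - 1) = C * Real.sin (s * θ) := by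
    rw [hf]
    have : ℓ - s * (((n - 1 : ℤ) : ℝ) * θ) = s * θ + q * (2 * π) := by
      rw [← hq]; push_cast; ring
    rw [this, Real.sin_add_int_mul_two_pi]
  have hrec : ∀ i, f (i - 1) + f (i + 1) = 2 * Real.cos θ * f i := by
    intro i
    rw [hf, hf, hf]
    have e1 : ℓ - s * (((i - 1 : ℤ) : ℝ) * θ) = (ℓ - s * (i * θ)) + s * θ := by push_cast; ring
    have e2 : ℓ - s * (((i + 1 : ℤ) : ℝ) * θ) = (ℓ - s * (i * θ)) - s * θ := by push_cast; ring
    rw [e1, e2, Real.sin_add _ (s * θ), Real.sin_sub _ (s * θ), hcoss]; ring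
  have hf1 : f 1 = C * (Real.sin ℓ * Real.cos θ - Real.cos ℓ * Real.sin (s * θ)) := by
    rw [hf, ← hcoss, ← Real.sin_sub]; simp
  have hf0 : f 0 = C * Real.sin ℓ := by rw [hf]; simp
  have hzf : ∀ i : ℤ, |i| ≤ (n : ℤ) - 1 → z i = f |i| := by
    intro i hi
    rw [hz i hi, hf, hθ]
    congr 2
    ring
  have hzn' : z n = f (n - 1) := by
    rw [hzn, hzf _ (by rw [abs_of_nonneg] <;> omega), abs_of_nonneg (by omega)]
  have hzmn' : z (-n) = f (n - 1) := by
    rw [hzmn, hzf _ (by rw [abs_neg, abs_of_nonneg] <;> omega), abs_neg, abs_of_nonneg (by omega)]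
  intro j hj
  have hIcc : Finset.Icc (-(n : ℤ)) n =
      insert (-(n : ℤ)) (insert (n : ℤ) (Finset.Icc (-((n : ℤ) - 1)) (n - 1))) := by
    ext i; simp only [Finset.mem_Icc, Finset.mem_insert]; omega
  have hBn : B n j = 0 := by
    rw [hB, if_neg]; rintro ⟨-, h⟩; rw [abs_of_nonneg (by omega)] at h; omega
  have hBmn : B (-n) j = 0 := by
    rw [hB, if_neg]; rintro ⟨-, h⟩; rw [abs_neg, abs_of_nonneg (by omega)] at h; omega
  rw [hIcc, Finset.sum_insert (by simp only [Finset.mem_Icc, Finset.mem_insert]; omega),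
    Finset.sum_insert (by simp only [Finset.mem_Icc]; omega)]
  have hmid : ∑ i ∈ Finset.Icc (-((n : ℤ) - 1)) (n - 1), z i * (L i j - lam * B i j) =
      ∑ i ∈ Finset.Icc (-((n : ℤ) - 1)) (n - 1),
        ((if i = j then f |i| * (-2 - lam) else 0) + (if i = j + 1 then f |i| else 0)
          + (if i = j - 1 then f |i| else 0)) := by
    refine Finset.sum_congr rfl fun i hi => ?_
    have hi' : |i| ≤ (n : ℤ) - 1 := abs_le.2 (Finset.mem_Icc.1 hi)
    rw [hzf i hi', hLmid i j hi', hB]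
    by_cases h1 : i = j
    · subst h1
      rw [if_pos rfl, if_pos ⟨rfl, hi'⟩, if_pos rfl, if_neg (by omega), if_neg (by omega)]; ring
    · have hne : ¬ (i = j ∧ |i| ≤ (n : ℤ) - 1) := fun h => h1 h.1
      rw [if_neg (fun h : j = i => h1 h.symm), if_neg hne, if_neg h1]
      by_cases h2 : i = j + 1
      · have h3 : j = i - 1 ∨ j = i + 1 := by omega
        rw [if_pos h3, if_pos h2, if_neg (by omega)]; ring
      · by_cases h3 : i = j - 1
        · have h4 : j = i - 1 ∨ j = i + 1 := by omega
          rw [if_pos h4, if_neg h2, if_pos h3]; ring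
        · have h4 : ¬ (j = i - 1 ∨ j = i + 1) := by omega
          rw [if_neg h4, if_neg h2, if_neg h3]; ring
  rw [hmid, Finset.sum_add_distrib, Finset.sum_add_distrib, Finset.sum_ite_eq',
    Finset.sum_ite_eq', Finset.sum_ite_eq', hLtop, hLbot, hBn, hBmn, hzn', hzmn']
  have hlam' : -2 - lam = -(2 * Real.cos θ) := by rw [hlam]; ring
  rw [hlam']
  have hw : ∀ i : ℤ, |i| ≤ n →
      (if i ∈ Finset.Icc (-((n : ℤ) - 1)) (n - 1) then f |i| else 0) = f |i| := by
    intro i hi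
    split_ifs with h
    · rfl
    · have : |i| = n := by
        rw [Finset.mem_Icc, ← abs_le] at h; omega
      rw [this, hfn]
  have hw0 : ∀ i : ℤ, (n : ℤ) ≤ |i| →
      (if i ∈ Finset.Icc (-((n : ℤ) - 1)) (n - 1) then f |i| else 0) = 0 := by
    intro i hi
    rw [if_neg]
    rw [Finset.mem_Icc, ← abs_le]; omega
  have hwj : (if j ∈ Finset.Icc (-((n : ℤ) - 1)) (n - 1) then f |j| * -(2 * Real.cos θ) else 0)
      = f |j| * -(2 * Real.cos θ) := by
    rw [← ite_zero_mul, hw j hj]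
  rw [hwj]
  have hj' := abs_le.1 hj
  rcases lt_trichotomy j 0 with h | h | h
  · have a0 : |j| = -j := abs_of_neg h
    have a1 : |j + 1| = -j - 1 := by rw [abs_of_nonpos (by omega)]; ring
    have a2 : |j - 1| = -j + 1 := by rw [abs_of_neg (by omega)]; ring
    rw [hw (j + 1) (by omega), a0, a1]
    have hr := hrec (-j)
    by_cases hjn : j = -n
    · rw [hw0 (j - 1) (by omega), if_pos hjn, if_neg (by omega), if_neg (by omega)]
      subst hjn
      rw [neg_neg, hfn]; ring
    · rw [hw (j - 1) (by omega), if_neg hjn, if_neg (by omega : ¬ j = 0), if_neg (by omega), a2]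
      linarith
  · subst h
    rw [hw _ (by simp; omega), hw _ (by simp; omega), if_neg (by omega : ¬ (0 : ℤ) = -n),
      if_neg (by omega : ¬ (0 : ℤ) = n), if_pos rfl, hfn1]
    simp only [zero_add, zero_sub, abs_neg, abs_one, abs_zero, hf0, hf1]
    ring
  · have a0 : |j| = j := abs_of_pos h
    have a1 : |j - 1| = j - 1 := abs_of_nonneg (by omega)
    have a2 : |j + 1| = j + 1 := abs_of_pos (by omega)
    rw [hw (j - 1) (by omega), a0, a1]
    have hr := hrec j
    by_cases hjn : j = n
    · rw [hw0 (j + 1) (by omega), if_pos hjn, if_neg (by omega), if_neg (by omega)]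
      subst hjn
      rw [hfn]; ring
    · rw [hw (j + 1) (by omega), if_neg hjn, if_neg (by omega : ¬ j = 0), if_neg (by omega), a2]
      linarith
end

section
/- For every odd integer k with 0 ≤ k ≤ 2(n−1), the vector z_k ∈ ℝ^{2n+1} with components (z_k)_j = n^{−1/2}·sin(j·l_k·π/(2n)) for |j| ≤ n−1 and (z_k)_{n} = (z_k)_{n−1}, (z_k)_{−n} = (z_k)_{−(n−1)}, satisfies the adjoint generalised eigenproblem z_k^T·(𝓛 − λ_k·B) = 0. -/
open Real

/-- For every odd integer `k` with `0 ≤ k ≤ 2(n−1)`, the vector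
`z_k ∈ ℝ^{2n+1}` with components `(z_k)_j = n^{-1/2} sin(j l_k π/(2n))` for `|j| ≤ n−1`,
and `(z_k)_{±n} = (z_k)_{±(n−1)}`, satisfies the adjoint generalised eigenproblem
`z_k^T (𝓛 − λ_k B) = 0`. -/
theorem stmt_3 (n : ℕ) (hn : 2 ≤ n) (ℓ : ℝ) (hℓ0 : 0 < ℓ) (hℓπ : ℓ < π)
    (B L : ℤ → ℤ → ℝ)
    (hB : ∀ i j : ℤ, B i j = if i = j ∧ |i| ≤ (n : ℤ) - 1 then 1 else 0)
    (hLmid : ∀ i j : ℤ, |i| ≤ (n : ℤ) - 1 →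
      L i j = if j = i then -2 else if j = i - 1 ∨ j = i + 1 then 1 else 0)
    (hLtop : ∀ j : ℤ, L (n : ℤ) j =
      if j = (n : ℤ) then -1 else if j = 0 then Real.cos ℓ else 0)
    (hLbot : ∀ j : ℤ, L (-(n : ℤ)) j =
      if j = -(n : ℤ) then -1 else if j = 0 then Real.cos ℓ else 0)
    (k : ℕ) (hk : k ≤ 2 * (n - 1)) (hko : Odd k)
    (lk : ℝ) (hlk : lk = (k : ℝ) + 1)
    (lam : ℝ) (hlam : lam = -2 * (1 - Real.cos (π * lk / (2 * n))))
    (z : ℤ → ℝ)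
    (hz : ∀ j : ℤ, |j| ≤ (n : ℤ) - 1 →
      z j = (n : ℝ) ^ (-(1/2) : ℝ) * Real.sin ((j : ℝ) * lk * π / (2 * n)))
    (hzn : z (n : ℤ) = z ((n : ℤ) - 1))
    (hzmn : z (-(n : ℤ)) = z (-((n : ℤ) - 1))) :
    ∀ j : ℤ, |j| ≤ (n : ℤ) →
      ∑ i ∈ Finset.Icc (-(n : ℤ)) (n : ℤ), z i * (L i j - lam * B i j) = 0 := by
  intro j hj
  have hn0 : (n : ℝ) ≠ 0 := by positivity
  obtain ⟨m, hm⟩ := hko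
  obtain ⟨c, hc⟩ : ∃ c : ℝ, c = (n : ℝ) ^ (-(1/2) : ℝ) := ⟨_, rfl⟩
  obtain ⟨t, ht⟩ : ∃ t : ℝ, t = π * lk / (2 * n) := ⟨_, rfl⟩
  obtain ⟨s, hs⟩ : ∃ s : ℤ → ℝ, ∀ i, s i = c * Real.sin ((i : ℝ) * t) := ⟨_, fun _ => rfl⟩
  have hzs : ∀ i : ℤ, |i| ≤ (n : ℤ) - 1 → z i = s i := by
    intro i hi
    rw [hz i hi, hs, hc, ht]
    congr 2
    ring
  have hnt : (n : ℝ) * t = ((m + 1 : ℕ) : ℝ) * π := by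
    rw [ht, hlk, hm]
    push_cast
    field_simp
    ring
  have hodd : ∀ i : ℤ, s (-i) = - s i := by
    intro i
    rw [hs, hs]
    push_cast
    rw [neg_mul, Real.sin_neg]
    ring
  have hsn : s n = 0 := by
    rw [hs]
    push_cast
    rw [hnt, Real.sin_nat_mul_pi, mul_zero]
  have hsmn : s (-(n : ℤ)) = 0 := by rw [hodd, hsn, neg_zero]
  have hrec : ∀ i : ℤ, s i * (-2 - lam) + s (i + 1) + s (i - 1) = 0 := by
    intro i
    rw [hs, hs, hs, hlam, ← ht]
    push_cast
    rw [add_mul, sub_mul, one_mul, Real.sin_add, Real.sin_sub]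
    ring
  have hzn' : z n = s (n - 1) := by
    rw [hzn, hzs _ (by rw [abs_le]; omega)]
  have hzmn' : z (-(n : ℤ)) = - s (n - 1) := by
    rw [hzmn, hzs _ (by rw [abs_le]; omega), hodd]
  have hterm : ∀ i ∈ Finset.Icc (-(n : ℤ)) (n : ℤ), z i * (L i j - lam * B i j) =
      (if i = j then s j * (-2 - lam) else 0) + (if i = j + 1 then s (j + 1) else 0)
      + (if i = j - 1 then s (j - 1) else 0)
      + (if i = (n : ℤ) then s (n - 1) * L n j else 0)
      + (if i = -(n : ℤ) then - s (n - 1) * L (-(n : ℤ)) j else 0) := by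
    intro i hi
    rw [Finset.mem_Icc] at hi
    have hD : ∀ i : ℤ, s i * ((if j = i then -2 else if j = i - 1 ∨ j = i + 1 then 1 else 0)
        - lam * (if i = j then 1 else 0)) =
      (if i = j then s j * (-2 - lam) else 0) + (if i = j + 1 then s (j + 1) else 0)
      + (if i = j - 1 then s (j - 1) else 0) := by
      intro i
      by_cases h1 : i = j
      · subst h1
        simp
        intro h
        omega
      · by_cases h2 : i = j + 1
        · subst h2
          have : ¬ (j + 1 = j - 1) := by omega
          simp [this]
        · by_cases h3 : i = j - 1
          · subst h3
            have : ¬ (j - 1 = j + 1) := by omega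
            simp [this]
            intro h
            omega
          · have h4 : ¬ (j = i) := by omega
            have h5 : ¬ (j = i - 1 ∨ j = i + 1) := by omega
            simp [h1, h2, h3, h4, h5]
    rw [← hD i]
    by_cases h1 : i = n
    · subst h1
      have h2 : ¬ ((n : ℤ) = -(n : ℤ)) := by omega
      rw [hB, if_neg (by rw [abs_le]; omega), if_neg h2, if_pos rfl, hsn, hzn']
      ring
    · by_cases h2 : i = -(n : ℤ)
      · subst h2
        rw [hB, if_neg (by rw [abs_le]; omega), if_neg h1, if_pos rfl, hsmn, hzmn']
        ring
      · have h3 : |i| ≤ (n : ℤ) - 1 := by rw [abs_le]; omega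
        rw [hzs i h3, hLmid i j h3, hB, if_neg h1, if_neg h2]
        simp only [h3, and_true, add_zero]
  rw [abs_le] at hj
  rw [Finset.sum_congr rfl hterm]
  simp only [Finset.sum_add_distrib, Finset.sum_ite_eq', Finset.mem_Icc]
  rw [if_pos hj, if_pos (show -(n : ℤ) ≤ n ∧ (n : ℤ) ≤ n by omega),
    if_pos (show -(n : ℤ) ≤ -n ∧ -(n : ℤ) ≤ n by omega), hLtop, hLbot]
  by_cases h1 : j = n
  · subst h1
    rw [if_neg (by omega), if_pos (by omega), if_pos rfl, if_neg (by omega), if_neg (by omega), hsn]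
    ring
  · by_cases h2 : j = -(n : ℤ)
    · subst h2
      have h3 : s (-(n : ℤ) + 1) = - s (n - 1) := by
        rw [← hodd]
        congr 1
        ring
      rw [if_pos (by omega), if_neg (by omega), if_neg (by omega), if_neg (by omega), if_pos rfl,
        hsmn, h3]
      ring
    · rw [if_pos (by omega), if_pos (by omega), if_neg h1, if_neg h2]
      linear_combination hrec j
end

section
/- The right and left eigenvectors are biorthonormal with respect to B: for all k, k' with 0 ≤ k, k' ≤ 2(n−1) one has z_k^T·B·v_{k'} = δ_{k k'}, where δ denotes the Kronecker delta. -/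
open Real

lemma aux_sin (N : ℕ) (hN : 0 < N) (d : ℤ) (hd : ¬ (N : ℤ) ∣ d) (x : ℝ) :
    ∑ j ∈ Finset.range N, Real.sin (x + 2 * π * d * j / N) = 0 := by
  have hN' : (N : ℝ) ≠ 0 := by positivity
  have hs : Real.sin (π * d / N) ≠ 0 := by
    intro h
    obtain ⟨c, hc⟩ := Real.sin_eq_zero_iff.1 h
    apply hd
    refine ⟨c, ?_⟩
    field_simp at hc
    have : (N : ℝ) * c = d := by linarith
    exact_mod_cast this.symm
  have key : ∀ M : ℕ, (∑ j ∈ Finset.range M, Real.sin (x + 2 * π * d * j / N)) * (2 * Real.sin (π * d / N))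
      = Real.cos (x - π * d / N) - Real.cos (x + 2 * π * d * M / N - π * d / N) := by
    intro M
    induction M with
    | zero => simp
    | succ M ih =>
      rw [Finset.sum_range_succ, add_mul, ih]
      have e : x + 2 * π * d * ((M + 1 : ℕ) : ℝ) / N - π * d / N
          = (x + 2 * π * d * M / N) + π * d / N := by
        push_cast; ring
      rw [e, Real.cos_add (x + 2 * π * d * M / N), Real.cos_sub (x + 2 * π * d * M / N)]
      ring
  have h := key N
  have e : x + 2 * π * d * N / N - π * d / N = (x - π * d / N) + d * (2 * π) := by
    field_simp; ring
  rw [e, Real.cos_add_int_mul_two_pi, sub_self] at h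
  rcases mul_eq_zero.1 h with h | h
  · exact h
  · exact absurd h (by simpa using hs)

lemma aux_cos (N : ℕ) (hN : 0 < N) (d : ℤ) (hd : ¬ (N : ℤ) ∣ d) (x : ℝ) :
    ∑ j ∈ Finset.range N, Real.cos (x + 2 * π * d * j / N) = 0 := by
  rw [← aux_sin N hN d hd (x + π / 2)]
  refine Finset.sum_congr rfl fun j _ => ?_
  rw [← Real.sin_add_pi_div_two]
  congr 1; ring

lemma aux_shift (m : ℕ) (f : ℤ → ℝ) :
    ∑ i ∈ Finset.Icc (-(m : ℤ)) m, f i = ∑ t ∈ Finset.range (2 * m + 1), f (t - m) := by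
  refine Finset.sum_bij' (fun i _ => (i + m).toNat) (fun t _ => (t : ℤ) - m) ?_ ?_ ?_ ?_ ?_
  · intro i hi; simp only [Finset.mem_Icc, Finset.mem_range] at *; omega
  · intro i hi; simp only [Finset.mem_Icc, Finset.mem_range] at *; omega
  · intro i hi; simp only [Finset.mem_Icc] at *; omega
  · intro i hi; simp
  · intro i hi; simp only [Finset.mem_Icc] at *; congr 1; omega

lemma aux_symm (m : ℕ) (f : ℤ → ℝ) :
    ∑ i ∈ Finset.Icc (-(m : ℤ)) m, f i
      = f 0 + ∑ t ∈ Finset.range m, (f (t + 1) + f (-(t + 1))) := by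
  induction m with
  | zero => simp
  | succ m ih =>
    rw [Finset.sum_range_succ, ← add_assoc, ← ih]
    have e : Finset.Icc (-((m + 1 : ℕ) : ℤ)) ((m + 1 : ℕ) : ℤ)
        = insert ((m : ℤ) + 1) (insert (-((m : ℤ) + 1)) (Finset.Icc (-(m : ℤ)) m)) := by
      ext i; simp only [Finset.mem_Icc, Finset.mem_insert]; push_cast; omega
    rw [e, Finset.sum_insert, Finset.sum_insert]
    · ring
    · simp
    · simp only [Finset.mem_Icc, Finset.mem_insert]; omega

/-- collapse of the double sum -/
lemma aux_double (m : ℕ) (B : ℤ → ℤ → ℝ)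
    (hB : ∀ i j : ℤ, B i j = if i = j ∧ |i| ≤ (m : ℤ) then 1 else 0) (z v : ℤ → ℝ) :
    ∑ i ∈ Finset.Icc (-((m + 1 : ℕ) : ℤ)) ((m + 1 : ℕ) : ℤ),
      ∑ j ∈ Finset.Icc (-((m + 1 : ℕ) : ℤ)) ((m + 1 : ℕ) : ℤ), z i * B i j * v j
      = ∑ i ∈ Finset.Icc (-(m : ℤ)) m, z i * v i := by
  have hsub : Finset.Icc (-(m : ℤ)) m ⊆ Finset.Icc (-((m + 1 : ℕ) : ℤ)) ((m + 1 : ℕ) : ℤ) := by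
    intro i; simp only [Finset.mem_Icc]; push_cast; omega
  rw [← Finset.sum_subset hsub (f := fun i => ∑ j ∈ Finset.Icc (-((m + 1 : ℕ) : ℤ)) ((m + 1 : ℕ) : ℤ), z i * B i j * v j)]
  · refine Finset.sum_congr rfl fun i hi => ?_
    rw [Finset.sum_eq_single i]
    · rw [hB, if_pos ⟨rfl, abs_le.2 (Finset.mem_Icc.1 hi)⟩, mul_one]
    · intro j _ hj
      rw [hB, if_neg (fun h => hj h.1.symm)]; ring
    · intro h; exact absurd (hsub hi) h
  · intro i _ hi
    refine Finset.sum_eq_zero fun j _ => ?_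
    rw [hB, if_neg (fun h => hi (Finset.mem_Icc.2 (abs_le.1 h.2)))]; ring

lemma aux_odd (m : ℕ) (a b : ℤ) (ha : 1 ≤ a) (ha' : a ≤ m) (hb : 1 ≤ b) (hb' : b ≤ m) :
    ∑ i ∈ Finset.Icc (-(m : ℤ)) m, Real.sin (i * a * π / (m + 1)) * Real.sin (i * b * π / (m + 1))
      = if a = b then (m + 1 : ℝ) else 0 := by
  have hm : (m + 1 : ℝ) ≠ 0 := by positivity
  rw [aux_shift m (fun i => Real.sin (i * a * π / (m + 1)) * Real.sin (i * b * π / (m + 1)))]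
  have h0 : ∑ t ∈ Finset.range (2 * m + 1),
      Real.sin (((t - m : ℤ) : ℝ) * a * π / (m + 1)) * Real.sin (((t - m : ℤ) : ℝ) * b * π / (m + 1))
      = ∑ t ∈ Finset.range (2 * m + 2),
      Real.sin (((t - (m + 1) : ℤ) : ℝ) * a * π / (m + 1)) * Real.sin (((t - (m + 1) : ℤ) : ℝ) * b * π / (m + 1)) := by
    rw [Finset.sum_range_succ' _ (2 * m + 1)]
    have hz : Real.sin (((((0 : ℕ) : ℤ) - (m + 1) : ℤ) : ℝ) * a * π / (m + 1)) = 0 := by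
      have : ((((0 : ℕ) : ℤ) - (m + 1) : ℤ) : ℝ) * a * π / (m + 1) = ((-a : ℤ) : ℝ) * π := by
        push_cast; field_simp; ring
      rw [this, Real.sin_int_mul_pi]
    rw [hz, zero_mul, add_zero]
    refine Finset.sum_congr rfl fun t _ => ?_
    have : (t : ℤ) - m = ((t + 1 : ℕ) : ℤ) - (m + 1) := by push_cast; ring
    rw [this]
  rw [h0]
  have h1 : ∀ t : ℕ, Real.sin (((t - (m + 1) : ℤ) : ℝ) * a * π / (m + 1)) * Real.sin (((t - (m + 1) : ℤ) : ℝ) * b * π / (m + 1))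
      = (Real.cos (-((a - b : ℤ) : ℝ) * π + 2 * π * ((a - b : ℤ) : ℝ) * t / ((2 * m + 2 : ℕ) : ℝ))
        - Real.cos (-((a + b : ℤ) : ℝ) * π + 2 * π * ((a + b : ℤ) : ℝ) * t / ((2 * m + 2 : ℕ) : ℝ))) / 2 := by
    intro t
    have e1 : -((a - b : ℤ) : ℝ) * π + 2 * π * ((a - b : ℤ) : ℝ) * t / ((2 * m + 2 : ℕ) : ℝ)
      = ((t - (m + 1) : ℤ) : ℝ) * a * π / (m + 1) - ((t - (m + 1) : ℤ) : ℝ) * b * π / (m + 1) := by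
      push_cast
      rw [show (2 * m + 2 : ℝ) = 2 * (m + 1) by ring]; field_simp; ring
    have e2 : -((a + b : ℤ) : ℝ) * π + 2 * π * ((a + b : ℤ) : ℝ) * t / ((2 * m + 2 : ℕ) : ℝ)
      = ((t - (m + 1) : ℤ) : ℝ) * a * π / (m + 1) + ((t - (m + 1) : ℤ) : ℝ) * b * π / (m + 1) := by
      push_cast
      rw [show (2 * m + 2 : ℝ) = 2 * (m + 1) by ring]; field_simp; ring
    rw [e1, e2, Real.cos_sub, Real.cos_add]; ring
  rw [Finset.sum_congr rfl fun t _ => h1 t, ← Finset.sum_div, Finset.sum_sub_distrib,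
    aux_cos (2 * m + 2) (by omega) (a + b)]
  · split_ifs with hab
    · subst hab
      simp
      ring
    · rw [aux_cos (2 * m + 2) (by omega) (a - b)]
      · simp
      · intro h
        apply hab
        have := Int.eq_zero_of_abs_lt_dvd h (by rw [abs_lt]; push_cast; omega)
        omega
  · intro h
    have := Int.le_of_dvd (by omega) h
    push_cast at this; omega

lemma aux_even (m : ℕ) (ℓ : ℝ) (p q : ℤ) (hpq : |p - q| ≤ m) :
    ∑ i ∈ Finset.Icc (-(m : ℤ)) m,
      Real.sin (ℓ - (|i| : ℤ) * ((ℓ + p * (2 * π)) / (m + 1))) * Real.cos (i * ((ℓ + q * (2 * π)) / (m + 1)))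
      = if p = q then (m + 1) * Real.sin ℓ else 0 := by
  have hm : (m + 1 : ℝ) ≠ 0 := by positivity
  rw [aux_symm m (fun i => Real.sin (ℓ - (|i| : ℤ) * ((ℓ + p * (2 * π)) / (m + 1))) * Real.cos (i * ((ℓ + q * (2 * π)) / (m + 1))))]
  set S : ℕ → ℝ := fun t => Real.sin (ℓ - (t + 1) * ((2 * ℓ + (p + q) * (2 * π)) / (m + 1))) with hS
  have h1 : ∀ t : ℕ, Real.sin (ℓ - (|(t + 1 : ℤ)| : ℤ) * ((ℓ + p * (2 * π)) / (m + 1))) * Real.cos (((t + 1 : ℤ) : ℝ) * ((ℓ + q * (2 * π)) / (m + 1)))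
     + Real.sin (ℓ - (|(-(t + 1) : ℤ)| : ℤ) * ((ℓ + p * (2 * π)) / (m + 1))) * Real.cos (((-(t + 1) : ℤ) : ℝ) * ((ℓ + q * (2 * π)) / (m + 1)))
     = Real.sin (ℓ + 2 * π * ((q - p : ℤ) : ℝ) * ((t + 1 : ℕ) : ℝ) / ((m + 1 : ℕ) : ℝ)) + S t := by
    intro t
    have ha : |(t + 1 : ℤ)| = t + 1 := abs_of_nonneg (by positivity)
    rw [abs_neg, ha, Int.cast_neg, neg_mul, Real.cos_neg]
    have e1 : ℓ + 2 * π * ((q - p : ℤ) : ℝ) * ((t + 1 : ℕ) : ℝ) / ((m + 1 : ℕ) : ℝ)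
      = (ℓ - ((t + 1 : ℤ) : ℝ) * ((ℓ + p * (2 * π)) / (m + 1))) + ((t + 1 : ℤ) : ℝ) * ((ℓ + q * (2 * π)) / (m + 1)) := by
      push_cast; field_simp; ring
    have e2 : ℓ - (t + 1) * ((2 * ℓ + (p + q) * (2 * π)) / (m + 1))
      = (ℓ - ((t + 1 : ℤ) : ℝ) * ((ℓ + p * (2 * π)) / (m + 1))) - ((t + 1 : ℤ) : ℝ) * ((ℓ + q * (2 * π)) / (m + 1)) := by
      push_cast; field_simp; ring
    simp only [hS]
    rw [e1, e2]
    generalize ℓ - ((t + 1 : ℤ) : ℝ) * ((ℓ + p * (2 * π)) / (m + 1)) = x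
    generalize ((t + 1 : ℤ) : ℝ) * ((ℓ + q * (2 * π)) / (m + 1)) = y
    rw [Real.sin_sub, Real.sin_add]
    ring
  have h2 : ∑ t ∈ Finset.range m, S t = 0 := by
    have : ∑ t ∈ Finset.range m, S t = ∑ t ∈ Finset.range m, -S t := by
      rw [← Finset.sum_range_reflect]
      refine Finset.sum_congr rfl fun t ht => ?_
      have ht' := Finset.mem_range.1 ht
      obtain ⟨r, rfl⟩ : ∃ r, m = t + 1 + r := ⟨m - (t + 1), by omega⟩
      have hr : t + 1 + r - 1 - t = r := by omega
      rw [hr]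
      simp only [hS]
      rw [← Real.sin_neg, ← Real.sin_add_int_mul_two_pi _ (p + q)]
      have h3 : (t + 1 + r + 1 : ℝ) ≠ 0 := by positivity
      congr 1
      push_cast
      field_simp; ring
    rw [Finset.sum_neg_distrib] at this
    linarith
  rw [Finset.sum_congr rfl fun t _ => h1 t, Finset.sum_add_distrib, h2, add_zero]
  have h4 := Finset.sum_range_succ' (fun t : ℕ => Real.sin (ℓ + 2 * π * ((q - p : ℤ) : ℝ) * (t : ℝ) / ((m + 1 : ℕ) : ℝ))) m
  have h5 : Real.sin (ℓ - ((|(0:ℤ)| : ℤ) : ℝ) * ((ℓ + p * (2 * π)) / (m + 1))) * Real.cos (((0 : ℤ) : ℝ) * ((ℓ + q * (2 * π)) / (m + 1)))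
     = Real.sin (ℓ + 2 * π * ((q - p : ℤ) : ℝ) * ((0 : ℕ) : ℝ) / ((m + 1 : ℕ) : ℝ)) := by simp
  rw [h5, add_comm, ← h4]
  split_ifs with h
  · subst h; simp
  · apply aux_sin _ (by omega)
    intro hd
    apply h
    have := Int.eq_zero_of_abs_lt_dvd hd (by rw [abs_le] at hpq; rw [abs_lt]; push_cast; omega)
    omega

lemma aux_parity (m : ℕ) (f : ℤ → ℝ) (hf : ∀ i : ℤ, |i| ≤ m → f (-i) = - f i) :
    ∑ i ∈ Finset.Icc (-(m : ℤ)) m, f i = 0 := by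
  rw [aux_symm]
  have h0 := hf 0 (by simp)
  have : f 0 = 0 := by simp at h0; linarith
  rw [this, zero_add]
  refine Finset.sum_eq_zero fun t ht => ?_
  rw [hf (t + 1) (by have := Finset.mem_range.1 ht; rw [abs_le]; omega)]; ring

lemma aux_rpow (x : ℝ) (hx : 0 < x) : x ^ (-(1/2) : ℝ) * x ^ (-(1/2) : ℝ) = x⁻¹ := by
  rw [← Real.rpow_add hx]; norm_num [Real.rpow_neg_one]

/-- the integer attached to an even index -/
lemma aux_index (k : ℕ) (hk : Even k) (ℓ : ℝ) : ∃ (s : ℝ) (p : ℤ), (s = 1 ∨ s = -1) ∧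
    (-1 : ℝ) ^ (k / 2) = s ∧
    s * ((k : ℝ) + 1 + (-1 : ℝ) ^ (k / 2) * (2 * ℓ / π - 1)) * π / 2 = ℓ + p * (2 * π) ∧
    (4 * p = k ∨ 4 * p = -(k + 2 : ℤ)) := by
  have hpi := Real.pi_ne_zero
  obtain ⟨r, rfl⟩ := hk
  have hr : (r + r) / 2 = r := by omega
  rw [hr]
  rcases Nat.even_or_odd r with h | h
  · refine ⟨1, ((r / 2 : ℕ) : ℤ), Or.inl rfl, h.neg_one_pow, ?_, ?_⟩
    · rw [h.neg_one_pow]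
      obtain ⟨u, rfl⟩ := h
      have : (u + u) / 2 = u := by omega
      rw [this]; push_cast; field_simp; ring
    · obtain ⟨u, rfl⟩ := h
      left; omega
  · refine ⟨-1, -(((r + 1) / 2 : ℕ) : ℤ), Or.inr rfl, h.neg_one_pow, ?_, ?_⟩
    · rw [h.neg_one_pow]
      obtain ⟨u, rfl⟩ := h
      have : (2 * u + 1 + 1) / 2 = u + 1 := by omega
      rw [this]; push_cast; field_simp; ring
    · obtain ⟨u, rfl⟩ := h
      right; omega

/-- The right and left eigenvectors are biorthonormal with respect to `B`:
for all `0 ≤ k, k' ≤ 2(n−1)`, `z_k^T B v_{k'} = δ_{k k'}`. -/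
theorem stmt_4 (n : ℕ) (hn : 2 ≤ n) (ℓ : ℝ) (hℓ0 : 0 < ℓ) (hℓπ : ℓ < π)
    (B : ℤ → ℤ → ℝ)
    (hB : ∀ i j : ℤ, B i j = if i = j ∧ |i| ≤ (n : ℤ) - 1 then 1 else 0)
    (lk : ℕ → ℝ)
    (hlk : ∀ k : ℕ, lk k = if Even k then
        (k : ℝ) + 1 + (-1 : ℝ) ^ (k / 2) * (2 * ℓ / π - 1) else (k : ℝ) + 1)
    (v z : ℕ → ℤ → ℝ)
    (hveven : ∀ k : ℕ, Even k → ∀ j : ℤ,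
      v k j = ((n : ℝ) * Real.sin ℓ) ^ (-(1/2) : ℝ) *
        Real.cos ((j : ℝ) * lk k * π / (2 * n)))
    (hvodd : ∀ k : ℕ, Odd k → ∀ j : ℤ,
      v k j = (n : ℝ) ^ (-(1/2) : ℝ) * Real.sin ((j : ℝ) * lk k * π / (2 * n)))
    (hzeven : ∀ k : ℕ, Even k → ∀ j : ℤ, |j| ≤ (n : ℤ) - 1 →
      z k j = ((n : ℝ) * Real.sin ℓ) ^ (-(1/2) : ℝ) *
        Real.sin (ℓ - (-1 : ℝ) ^ (k / 2) * (|j| : ℤ) * lk k * π / (2 * n)))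
    (hzodd : ∀ k : ℕ, Odd k → ∀ j : ℤ, |j| ≤ (n : ℤ) - 1 →
      z k j = (n : ℝ) ^ (-(1/2) : ℝ) * Real.sin ((j : ℝ) * lk k * π / (2 * n)))
    (hzn : ∀ k : ℕ, z k (n : ℤ) = z k ((n : ℤ) - 1))
    (hzmn : ∀ k : ℕ, z k (-(n : ℤ)) = z k (-((n : ℤ) - 1))) :
    ∀ k k' : ℕ, k ≤ 2 * (n - 1) → k' ≤ 2 * (n - 1) →
      ∑ i ∈ Finset.Icc (-(n : ℤ)) (n : ℤ), ∑ j ∈ Finset.Icc (-(n : ℤ)) (n : ℤ),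
        z k i * B i j * v k' j = if k = k' then 1 else 0 := by
  intro k k' hk hk'
  obtain ⟨m, rfl⟩ : ∃ m, n = m + 1 := ⟨n - 1, by omega⟩
  have hm : (m + 1 : ℝ) ≠ 0 := by positivity
  have hm0 : (0 : ℝ) < ((m + 1 : ℕ) : ℝ) := by positivity
  have hsin : 0 < Real.sin ℓ := Real.sin_pos_of_pos_of_lt_pi hℓ0 hℓπ
  have ecast : ((m + 1 : ℕ) : ℤ) - 1 = m := by push_cast; ring
  simp only [ecast] at hB hzeven hzodd
  have hk2 : k ≤ 2 * m := by omega
  have hk2' : k' ≤ 2 * m := by omega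
  rw [aux_double m B hB (z k) (v k')]
  have hmem : ∀ i ∈ Finset.Icc (-(m : ℤ)) m, |i| ≤ (m : ℤ) :=
    fun i hi => abs_le.2 (Finset.mem_Icc.1 hi)
  rcases Nat.even_or_odd k with he | ho <;> rcases Nat.even_or_odd k' with he' | ho'
  · obtain ⟨s, p, hs, hs1, hp, hp4⟩ := aux_index k he ℓ
    obtain ⟨s', q, hs', hs1', hq, hq4⟩ := aux_index k' he' ℓ
    have hlk1 := hlk k
    have hlk2 := hlk k'
    rw [if_pos he] at hlk1
    rw [if_pos he'] at hlk2
    rw [← hlk1] at hp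
    rw [← hlk2] at hq
    have hterm : ∀ i ∈ Finset.Icc (-(m : ℤ)) m, z k i * v k' i
        = (((m + 1 : ℕ) : ℝ) * Real.sin ℓ)⁻¹ *
        (Real.sin (ℓ - (|i| : ℤ) * ((ℓ + p * (2 * π)) / (m + 1))) * Real.cos (i * ((ℓ + q * (2 * π)) / (m + 1)))) := by
      intro i hi
      rw [hzeven k he i (hmem i hi), hveven k' he', ← aux_rpow _ (mul_pos hm0 hsin), hs1, ← hp, ← hq]
      have e1 : s * (|i| : ℤ) * lk k * π / (2 * ((m + 1 : ℕ) : ℝ)) = (|i| : ℤ) * (s * lk k * π / 2 / (m + 1)) := by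
        push_cast; field_simp
      have e2 : Real.cos (i * lk k' * π / (2 * ((m + 1 : ℕ) : ℝ))) = Real.cos (i * (s' * lk k' * π / 2 / (m + 1))) := by
        rcases hs' with h | h
        · rw [h]; congr 1; push_cast; field_simp
        · rw [h, ← Real.cos_neg]; congr 1; push_cast; field_simp
      rw [e1, e2]; ring
    rw [Finset.sum_congr rfl hterm, ← Finset.mul_sum, aux_even m ℓ p q (by rw [abs_le]; omega)]
    obtain ⟨r, rfl⟩ := he
    obtain ⟨r', rfl⟩ := he'
    have hiff : p = q ↔ r + r = r' + r' := by
      constructor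
      · intro h; omega
      · intro h
        have hrr : r = r' := by omega
        subst hrr
        omega
    simp only [hiff]
    split_ifs
    · push_cast; field_simp
    · simp
  · rw [aux_parity, if_neg]
    · rintro rfl; exact (Nat.not_even_iff_odd.2 ho') he
    · intro i hi
      rw [hzeven k he i hi, hzeven k he (-i) (by rwa [abs_neg]), hvodd k' ho', hvodd k' ho', abs_neg,
        Int.cast_neg, neg_mul, neg_mul, neg_div, Real.sin_neg]
      ring
  · rw [aux_parity, if_neg]
    · rintro rfl; exact (Nat.not_even_iff_odd.2 ho) he'
    · intro i hi
      rw [hzodd k ho i hi, hzodd k ho (-i) (by rwa [abs_neg]), hveven k' he', hveven k' he',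
        Int.cast_neg, neg_mul, neg_mul, neg_div, Real.sin_neg, neg_mul, neg_mul, neg_div, Real.cos_neg]
      ring
  · have hlk1 := hlk k
    have hlk2 := hlk k'
    rw [if_neg (Nat.not_even_iff_odd.2 ho)] at hlk1
    rw [if_neg (Nat.not_even_iff_odd.2 ho')] at hlk2
    obtain ⟨a, rfl⟩ := ho
    obtain ⟨b, rfl⟩ := ho'
    have hterm : ∀ i ∈ Finset.Icc (-(m : ℤ)) m, z (2 * a + 1) i * v (2 * b + 1) i
        = (((m + 1 : ℕ) : ℝ))⁻¹ *
        (Real.sin (i * ((a + 1 : ℤ) : ℝ) * π / (m + 1)) * Real.sin (i * ((b + 1 : ℤ) : ℝ) * π / (m + 1))) := by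
      intro i hi
      rw [hzodd _ ⟨a, rfl⟩ i (hmem i hi), hvodd _ ⟨b, rfl⟩, ← aux_rpow _ hm0, hlk1, hlk2]
      have e1 : ∀ c : ℕ, (i : ℝ) * (((2 * c + 1 : ℕ) : ℝ) + 1) * π / (2 * ((m + 1 : ℕ) : ℝ))
          = i * ((c + 1 : ℤ) : ℝ) * π / (m + 1) := by
        intro c; push_cast; field_simp; ring
      rw [e1, e1]; ring
    rw [Finset.sum_congr rfl hterm, ← Finset.mul_sum,
      aux_odd m (a + 1) (b + 1) (by omega) (by omega) (by omega) (by omega)]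
    have hiff : ((a : ℤ) + 1 = b + 1) ↔ 2 * a + 1 = 2 * b + 1 := by omega
    simp only [hiff]
    split_ifs
    · push_cast; field_simp
    · simp
end

section
/- The 2n−1 eigenvalues λ_0, λ_1, …, λ_{2(n−1)} are pairwise distinct; that is, for all 0 ≤ k < k' ≤ 2(n−1) one has λ_k ≠ λ_{k'}. -/
open Real

/-- The `2n−1` eigenvalues `λ_0, …, λ_{2(n−1)}` are pairwise distinct. -/
theorem stmt_5 (n : ℕ) (hn : 2 ≤ n) (ℓ : ℝ) (hℓ0 : 0 < ℓ) (hℓπ : ℓ < π)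
    (lk : ℕ → ℝ)
    (hlk : ∀ k : ℕ, lk k = if Even k then
        (k : ℝ) + 1 + (-1 : ℝ) ^ (k / 2) * (2 * ℓ / π - 1) else (k : ℝ) + 1)
    (lam : ℕ → ℝ)
    (hlam : ∀ k : ℕ, lam k = -2 * (1 - Real.cos (π * lk k / (2 * n)))) :
    ∀ k k' : ℕ, k < k' → k' ≤ 2 * (n - 1) → lam k ≠ lam k' := by
  have hpi := Real.pi_pos
  have hs1 : 2 * ℓ / π - 1 < 1 := by
    have : 2 * ℓ / π < 2 := by rw [div_lt_iff₀ hpi]; linarith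
    linarith
  have hs0 : -1 < 2 * ℓ / π - 1 := by
    have : 0 < 2 * ℓ / π := by positivity
    linarith
  have heven : ∀ k : ℕ, Even k → (k : ℝ) < lk k ∧ lk k < k + 2 := by
    intro k hk
    rw [hlk, if_pos hk]
    rcases neg_one_pow_eq_or ℝ (k / 2) with h | h <;> rw [h] <;> constructor <;> linarith
  have hodd : ∀ k : ℕ, ¬ Even k → lk k = k + 1 := by
    intro k hk
    rw [hlk, if_neg hk]
  have hpos : ∀ k : ℕ, 0 < lk k := by
    intro k
    have h0 : (0 : ℝ) ≤ k := Nat.cast_nonneg k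
    by_cases hk : Even k
    · linarith [(heven k hk).1]
    · linarith [hodd k hk]
  intro k k' hkk hk'
  have hub : lk k' < 2 * n := by
    have h2 : (k' : ℝ) + 2 ≤ 2 * n := by
      have : k' + 2 ≤ 2 * n := by omega
      exact_mod_cast this
    by_cases hk : Even k'
    · linarith [(heven k' hk).2]
    · linarith [hodd k' hk]
  have h1 : (k : ℝ) + 1 ≤ k' := by exact_mod_cast hkk
  have hlt : lk k < lk k' := by
    by_cases hk : Even k <;> by_cases hq : Even k'
    · have h2 : (k : ℝ) + 2 ≤ k' := by
        have : k + 2 ≤ k' := by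
          rw [Nat.even_iff] at hk hq
          omega
        exact_mod_cast this
      linarith [(heven k hk).2, (heven k' hq).1]
    · linarith [(heven k hk).2, hodd k' hq]
    · linarith [hodd k hk, (heven k' hq).1]
    · linarith [hodd k hk, hodd k' hq]
  have hn0 : (0 : ℝ) < 2 * n := by
    have : 0 < 2 * n := by omega
    exact_mod_cast this
  have hcos : Real.cos (π * lk k' / (2 * n)) < Real.cos (π * lk k / (2 * n)) := by
    apply Real.cos_lt_cos_of_nonneg_of_le_pi
    · have := hpos k
      positivity
    · rw [div_le_iff₀ hn0]
      exact mul_le_mul_of_nonneg_left hub.le hpi.le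
    · exact div_lt_div_of_pos_right (mul_lt_mul_of_pos_left hlt hpi) hn0
  rw [hlam, hlam]
  intro h
  linarith
end

section
/- For every even integer k with 0 ≤ k ≤ 2(n−a−1), the vector v_k ∈ ℝ^{2n+1} with components (v_k)_j = [(n−a)·sin ℓ]^{−1/2}·cos(j·l_k·π/(2(n−a))) for j = −n,…,n satisfies the generalised eigenproblem (𝓛 − λ_k·B)·v_k = 0. -/
open Real

theorem aux_sin_s7 (a : ℕ) (θ : ℝ) :
    ∑ m ∈ Finset.Icc (-(a : ℤ)) a, Real.sin ((m : ℝ) * θ) = 0 := by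
  have h : ∑ m ∈ Finset.Icc (-(a : ℤ)) a, Real.sin ((m : ℝ) * θ)
      = ∑ m ∈ Finset.Icc (-(a : ℤ)) a, -Real.sin ((m : ℝ) * θ) := by
    refine Finset.sum_nbij' (fun m => -m) (fun m => -m) ?_ ?_ ?_ ?_ ?_
    · intro m hm; simp only [Finset.mem_Icc] at hm ⊢; omega
    · intro m hm; simp only [Finset.mem_Icc] at hm ⊢; omega
    · intro m _; simp
    · intro m _; simp
    · intro m _; simp
  rw [Finset.sum_neg_distrib] at h
  linarith

theorem aux_shift_s7 (n a : ℕ) (θ : ℝ) :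
    ∑ j ∈ Finset.Icc ((n : ℤ) - 2 * a) n, Real.cos ((j : ℝ) * θ)
      = Real.cos (((n : ℝ) - a) * θ) * ∑ m ∈ Finset.Icc (-(a : ℤ)) a, Real.cos ((m : ℝ) * θ) := by
  have h : ∑ j ∈ Finset.Icc ((n : ℤ) - 2 * a) n, Real.cos ((j : ℝ) * θ)
      = ∑ m ∈ Finset.Icc (-(a : ℤ)) a, (Real.cos (((n : ℝ) - a) * θ) * Real.cos ((m : ℝ) * θ)
        - Real.sin (((n : ℝ) - a) * θ) * Real.sin ((m : ℝ) * θ)) := by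
    refine Finset.sum_nbij' (fun m => m - (n - a)) (fun m => m + (n - a)) ?_ ?_ ?_ ?_ ?_
    · intro m hm; simp only [Finset.mem_Icc] at hm ⊢; omega
    · intro m hm; simp only [Finset.mem_Icc] at hm ⊢; omega
    · intro m _; simp
    · intro m _; simp
    · intro m _
      rw [← Real.cos_add]; congr 1; push_cast; ring
  rw [h, Finset.sum_sub_distrib, ← Finset.mul_sum, ← Finset.mul_sum, aux_sin_s7]
  ring

theorem aux_cos_s7 (m : ℕ) (ℓ : ℝ) :
    Real.cos ((((m + m : ℕ) : ℝ) + 1 + (-1 : ℝ) ^ m * (2 * ℓ / π - 1)) * (π / 2)) = Real.cos ℓ := by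
  have hp := Real.pi_ne_zero
  rcases Nat.even_or_odd m with h | h
  · rw [h.neg_one_pow]
    obtain ⟨r, rfl⟩ := h
    rw [← Real.cos_add_nat_mul_two_pi ℓ r]
    congr 1; push_cast; field_simp; ring
  · rw [h.neg_one_pow]
    obtain ⟨r, rfl⟩ := h
    rw [← Real.cos_nat_mul_two_pi_sub ℓ (r + 1)]
    congr 1; push_cast; field_simp; ring

theorem aux_top (n a : ℕ) (han : a < n) (θ ℓ c : ℝ)
    (hc : Real.cos (((n : ℝ) - a) * θ) = Real.cos ℓ) :
    ∑ j ∈ Finset.Icc (-(n : ℤ)) (n : ℤ),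
      ((if (n : ℤ) - 2 * a ≤ j ∧ j ≤ (n : ℤ) then (-1 : ℝ) else 0) +
      (if |j| ≤ (a : ℤ) then Real.cos ℓ else 0)) * (c * Real.cos ((j : ℝ) * θ)) = 0 := by
  have h1 : ∑ j ∈ Finset.Icc (-(n : ℤ)) (n : ℤ),
      (if (n : ℤ) - 2 * a ≤ j ∧ j ≤ (n : ℤ) then Real.cos ((j : ℝ) * θ) else 0)
      = ∑ j ∈ Finset.Icc ((n : ℤ) - 2 * a) n, Real.cos ((j : ℝ) * θ) := by
    rw [← Finset.sum_filter]
    congr 1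
    ext j; simp only [Finset.mem_filter, Finset.mem_Icc]; omega
  have h2 : ∑ j ∈ Finset.Icc (-(n : ℤ)) (n : ℤ),
      (if |j| ≤ (a : ℤ) then Real.cos ((j : ℝ) * θ) else 0)
      = ∑ j ∈ Finset.Icc (-(a : ℤ)) a, Real.cos ((j : ℝ) * θ) := by
    rw [← Finset.sum_filter]
    congr 1
    ext j; simp only [Finset.mem_filter, Finset.mem_Icc, abs_le]; omega
  rw [aux_shift_s7, hc, ← h2] at h1
  have h3 : ∀ j : ℤ, ((if (n : ℤ) - 2 * a ≤ j ∧ j ≤ (n : ℤ) then (-1 : ℝ) else 0) +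
      (if |j| ≤ (a : ℤ) then Real.cos ℓ else 0)) * (c * Real.cos ((j : ℝ) * θ))
      = c * (Real.cos ℓ * (if |j| ≤ (a : ℤ) then Real.cos ((j : ℝ) * θ) else 0) -
        (if (n : ℤ) - 2 * a ≤ j ∧ j ≤ (n : ℤ) then Real.cos ((j : ℝ) * θ) else 0)) := by
    intro j; split_ifs <;> ring
  simp only [h3]
  rw [← Finset.mul_sum, Finset.sum_sub_distrib, ← Finset.mul_sum, h1]
  ring

/-- For every even `k` with `0 ≤ k ≤ 2(n−a−1)`, the vector with components
`(v_k)_j = [(n−a) sin ℓ]^{-1/2} cos(j l_k π/(2(n−a)))` satisfies `(𝓛 − λ_k B) v_k = 0`. -/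
theorem stmt_7 (n a : ℕ) (ha : 1 ≤ a) (han : a < n) (ℓ : ℝ) (hℓ0 : 0 < ℓ) (hℓπ : ℓ < π)
    (B L : ℤ → ℤ → ℝ)
    (hB : ∀ i j : ℤ, B i j = if i = j ∧ |i| ≤ (n : ℤ) - 1 then 1 else 0)
    (hLmid : ∀ i j : ℤ, |i| ≤ (n : ℤ) - 1 →
      L i j = if j = i then -2 else if j = i - 1 ∨ j = i + 1 then 1 else 0)
    (hLtop : ∀ j : ℤ, L (n : ℤ) j =
      (if (n : ℤ) - 2 * a ≤ j ∧ j ≤ (n : ℤ) then (-1 : ℝ) else 0) +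
      (if |j| ≤ (a : ℤ) then Real.cos ℓ else 0))
    (hLbot : ∀ j : ℤ, L (-(n : ℤ)) j =
      (if (n : ℤ) - 2 * a ≤ -j ∧ -j ≤ (n : ℤ) then (-1 : ℝ) else 0) +
      (if |j| ≤ (a : ℤ) then Real.cos ℓ else 0))
    (k : ℕ) (hk : k ≤ 2 * (n - a - 1)) (hke : Even k)
    (lk : ℝ) (hlk : lk = (k : ℝ) + 1 + (-1 : ℝ) ^ (k / 2) * (2 * ℓ / π - 1))
    (lam : ℝ) (hlam : lam = -2 * (1 - Real.cos (π * lk / (2 * ((n : ℝ) - a)))))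
    (v : ℤ → ℝ)
    (hv : ∀ j : ℤ, v j = (((n : ℝ) - a) * Real.sin ℓ) ^ (-(1/2) : ℝ) *
      Real.cos ((j : ℝ) * lk * π / (2 * ((n : ℝ) - a)))) :
    ∀ i : ℤ, |i| ≤ (n : ℤ) →
      ∑ j ∈ Finset.Icc (-(n : ℤ)) (n : ℤ), (L i j - lam * B i j) * v j = 0 := by
  intro i hi
  have hna : (n : ℝ) - a ≠ 0 := by
    have : (a : ℝ) < n := by exact_mod_cast han
    linarith
  obtain ⟨θ, hθ⟩ : ∃ θ : ℝ, θ = lk * π / (2 * ((n : ℝ) - a)) := ⟨_, rfl⟩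
  obtain ⟨c, hcdef⟩ : ∃ c : ℝ, c = (((n : ℝ) - a) * Real.sin ℓ) ^ (-(1/2) : ℝ) := ⟨_, rfl⟩
  have hv' : ∀ j : ℤ, v j = c * Real.cos ((j : ℝ) * θ) := by
    intro j; rw [hv, hcdef, hθ]; congr 2; ring
  have hl : lam = -2 * (1 - Real.cos θ) := by
    rw [hlam, hθ]; congr 4; ring
  have hc : Real.cos (((n : ℝ) - a) * θ) = Real.cos ℓ := by
    obtain ⟨m, rfl⟩ := hke
    rw [← aux_cos_s7 m ℓ, hθ, hlk]
    have : (m + m) / 2 = m := by omega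
    rw [this]
    congr 1; field_simp
  have htop := aux_top n a han θ ℓ c hc
  by_cases him : |i| ≤ (n : ℤ) - 1
  · have hb := abs_le.mp him
    have e : ∀ j ∈ Finset.Icc (-(n : ℤ)) (n : ℤ), (L i j - lam * B i j) * v j
        = (if j = i then (-2 - lam) * v i else 0) + (if j = i - 1 then v (i - 1) else 0)
          + (if j = i + 1 then v (i + 1) else 0) := by
      intro j _
      rw [hLmid i j him, hB]
      by_cases h0 : j = i
      · subst h0
        have h3 : ¬ (j = j - 1) := by omega
        simp [him, h3]
      · by_cases h1 : j = i - 1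
        · subst h1
          have : ¬ (i - 1 = i + 1) := by omega
          have h3 : ¬ (i = i - 1) := by omega
          simp [this, h3]
        · by_cases h2 : j = i + 1
          · subst h2
            have : ¬ (i + 1 = i - 1) := by omega
            simp [this]
          · have : ¬ (i = j) := fun h => h0 h.symm
            simp [h0, h1, h2, this]
    rw [Finset.sum_congr rfl e, Finset.sum_add_distrib, Finset.sum_add_distrib,
      Finset.sum_ite_eq', Finset.sum_ite_eq', Finset.sum_ite_eq',
      if_pos (by rw [Finset.mem_Icc]; omega), if_pos (by rw [Finset.mem_Icc]; omega),
      if_pos (by rw [Finset.mem_Icc]; omega), hv', hv', hv', hl]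
    push_cast
    rw [sub_mul (i : ℝ), add_mul (i : ℝ), one_mul, Real.cos_sub, Real.cos_add]
    ring
  · have hB0 : ∀ j, B i j = 0 := by
      intro j; rw [hB, if_neg (fun h => him h.2)]
    simp only [hB0, mul_zero, sub_zero]
    have hcase : i = n ∨ i = -(n : ℤ) := by
      rw [abs_le] at hi him; omega
    rcases hcase with h | h
    · subst h
      simp only [hLtop, hv']
      exact htop
    · subst h
      simp only [hLbot, hv']
      refine Eq.trans ?_ htop
      refine Finset.sum_nbij' (fun m => -m) (fun m => -m) ?_ ?_ ?_ ?_ ?_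
      · intro m hm; simp only [Finset.mem_Icc] at hm ⊢; omega
      · intro m hm; simp only [Finset.mem_Icc] at hm ⊢; omega
      · intro m _; simp
      · intro m _; simp
      · intro m _; simp
end

section
/- For every odd integer k with 0 ≤ k ≤ 2(n−a−1), the vector v_k ∈ ℝ^{2n+1} with components (v_k)_j = (n−a)^{−1/2}·sin(j·l_k·π/(2(n−a))) for j = −n,…,n satisfies the generalised eigenproblem (𝓛 − λ_k·B)·v_k = 0. -/
open Real

/-- A function antisymmetric about the midpoint of `[p,q]` sums to zero on it. -/
theorem sum_antisymm (f : ℤ → ℝ) (p q : ℤ) (h : ∀ j, f (p + q - j) = - f j) :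
    ∑ j ∈ Finset.Icc p q, f j = 0 := by
  have e : ∑ j ∈ Finset.Icc p q, f j = ∑ j ∈ Finset.Icc p q, f (p + q - j) := by
    refine Finset.sum_nbij' (fun j => p + q - j) (fun j => p + q - j) ?_ ?_ ?_ ?_ ?_
    · intro j hj; simp only [Finset.mem_Icc] at *; omega
    · intro j hj; simp only [Finset.mem_Icc] at *; omega
    · intro j _; ring
    · intro j _; ring
    · intro j _; congr 1; ring
  simp only [h, Finset.sum_neg_distrib] at e
  linarith

/-- Restricting a sum with an indicator to a subinterval. -/
theorem sum_restrict (n : ℤ) (p q : ℤ) (hp : -n ≤ p) (hq : q ≤ n) (c : ℝ) (v : ℤ → ℝ)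
    (P : ℤ → Prop) [DecidablePred P] (hP : ∀ j, P j ↔ p ≤ j ∧ j ≤ q)
    (h : ∀ j, v (p + q - j) = - v j) :
    ∑ j ∈ Finset.Icc (-n) n, (if P j then c else 0) * v j = 0 := by
  have e : ∑ j ∈ Finset.Icc (-n) n, (if P j then c else 0) * v j
      = ∑ j ∈ Finset.Icc p q, c * v j := by
    symm
    have e2 : ∑ j ∈ Finset.Icc p q, c * v j
        = ∑ j ∈ Finset.Icc p q, (if P j then c else 0) * v j := by
      refine Finset.sum_congr rfl fun j hj => ?_
      rw [if_pos ((hP j).2 (Finset.mem_Icc.1 hj))]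
    rw [e2]
    refine Finset.sum_subset (Finset.Icc_subset_Icc hp hq) fun j _ hj => ?_
    rw [if_neg (fun h => hj (Finset.mem_Icc.2 ((hP j).1 h)))]
    ring
  rw [e, ← Finset.mul_sum, sum_antisymm v p q h, mul_zero]

/-- For every odd `k` with `0 ≤ k ≤ 2(n−a−1)`, the vector with components
`(v_k)_j = (n−a)^{-1/2} sin(j l_k π/(2(n−a)))` satisfies `(𝓛 − λ_k B) v_k = 0`. -/
theorem stmt_8 (n a : ℕ) (ha : 1 ≤ a) (han : a < n) (ℓ : ℝ) (hℓ0 : 0 < ℓ) (hℓπ : ℓ < π)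
    (B L : ℤ → ℤ → ℝ)
    (hB : ∀ i j : ℤ, B i j = if i = j ∧ |i| ≤ (n : ℤ) - 1 then 1 else 0)
    (hLmid : ∀ i j : ℤ, |i| ≤ (n : ℤ) - 1 →
      L i j = if j = i then -2 else if j = i - 1 ∨ j = i + 1 then 1 else 0)
    (hLtop : ∀ j : ℤ, L (n : ℤ) j =
      (if (n : ℤ) - 2 * a ≤ j ∧ j ≤ (n : ℤ) then (-1 : ℝ) else 0) +
      (if |j| ≤ (a : ℤ) then Real.cos ℓ else 0))
    (hLbot : ∀ j : ℤ, L (-(n : ℤ)) j =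
      (if (n : ℤ) - 2 * a ≤ -j ∧ -j ≤ (n : ℤ) then (-1 : ℝ) else 0) +
      (if |j| ≤ (a : ℤ) then Real.cos ℓ else 0))
    (k : ℕ) (hk : k ≤ 2 * (n - a - 1)) (hko : Odd k)
    (lk : ℝ) (hlk : lk = (k : ℝ) + 1)
    (lam : ℝ) (hlam : lam = -2 * (1 - Real.cos (π * lk / (2 * ((n : ℝ) - a)))))
    (v : ℤ → ℝ)
    (hv : ∀ j : ℤ, v j = ((n : ℝ) - a) ^ (-(1/2) : ℝ) *
      Real.sin ((j : ℝ) * lk * π / (2 * ((n : ℝ) - a)))) :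
    ∀ i : ℤ, |i| ≤ (n : ℤ) →
      ∑ j ∈ Finset.Icc (-(n : ℤ)) (n : ℤ), (L i j - lam * B i j) * v j = 0 := by
  have hna : ((n : ℝ) - a) ≠ 0 := by
    have : (a : ℝ) < n := by exact_mod_cast han
    linarith
  obtain ⟨m, hm⟩ := hko
  have hodd : ∀ j : ℤ, v (-j) = - v j := by
    intro j
    rw [hv, hv, ← mul_neg, ← Real.sin_neg]
    congr 2
    push_cast
    ring
  have hper : ∀ j : ℤ, v (2 * ((n : ℤ) - a) - j) = - v j := by
    intro j
    rw [hv, hv, ← mul_neg, ← Real.sin_neg]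
    congr 1
    rw [← Real.sin_add_nat_mul_two_pi (-((j : ℝ) * lk * π / (2 * ((n : ℝ) - a)))) (m + 1)]
    congr 1
    rw [hlk, hm]
    push_cast
    field_simp
    ring
  have hper2 : ∀ j : ℤ, v (-(2 * ((n : ℤ) - a)) - j) = - v j := by
    intro j
    have h1 := hper (-j)
    rw [hodd j] at h1
    rw [← neg_neg (v (-(2 * ((n : ℤ) - a)) - j)), ← hodd]
    rw [show -(-(2 * ((n : ℤ) - a)) - j) = 2 * ((n : ℤ) - a) - (-j) by ring, h1]
    ring
  have hcen : ∑ j ∈ Finset.Icc (-(n : ℤ)) (n : ℤ),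
      (if |j| ≤ (a : ℤ) then Real.cos ℓ else 0) * v j = 0 := by
    refine sum_restrict n (-a) a (by omega) (by omega) _ v _ (fun j => abs_le) ?_
    intro j
    rw [← hodd]
    congr 1
    ring
  intro i hi
  by_cases hmid : |i| ≤ (n : ℤ) - 1
  · have hi' := abs_le.1 hmid
    have e : ∀ j ∈ Finset.Icc (-(n : ℤ)) (n : ℤ), (L i j - lam * B i j) * v j =
        (if j = i then (-2 - lam) * v j else 0) + (if j = i - 1 then v j else 0)
          + (if j = i + 1 then v j else 0) := by
      intro j _
      rw [hLmid i j hmid, hB]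
      by_cases h1 : j = i
      · subst h1
        have h5 : ¬ (j = j - 1) := by omega
        simp [hmid, h5]
      · by_cases h2 : j = i - 1
        · subst h2
          have h3 : ¬ (i - 1 = i + 1) := by omega
          have h5 : ¬ (i = i - 1) := by omega
          simp [h3, h5]
        · by_cases h3 : j = i + 1
          · subst h3
            have h4 : ¬ (i + 1 = i - 1) := by omega
            simp [h4]
          · simp [h1, h2, h3, Ne.symm h1]
    rw [Finset.sum_congr rfl e, Finset.sum_add_distrib, Finset.sum_add_distrib,
      Finset.sum_ite_eq', Finset.sum_ite_eq', Finset.sum_ite_eq',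
      if_pos (Finset.mem_Icc.2 (by omega)), if_pos (Finset.mem_Icc.2 (by omega)),
      if_pos (Finset.mem_Icc.2 (by omega)), hv, hv, hv, hlam]
    set t := π * lk / (2 * ((n : ℝ) - a)) with ht
    rw [show ((i : ℤ) : ℝ) * lk * π / (2 * ((n : ℝ) - a)) = i * t by rw [ht]; ring,
      show ((i - 1 : ℤ) : ℝ) * lk * π / (2 * ((n : ℝ) - a)) = i * t - t by
        rw [ht]; push_cast; ring,
      show ((i + 1 : ℤ) : ℝ) * lk * π / (2 * ((n : ℝ) - a)) = i * t + t by
        rw [ht]; push_cast; ring, Real.sin_add, Real.sin_sub]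
    ring
  · have hB0 : ∀ j, B i j = 0 := fun j => by rw [hB, if_neg (fun h => hmid h.2)]
    have hcase : i = n ∨ i = -(n : ℤ) := by
      have h1 : |i| = n := by omega
      exact (abs_eq (by omega)).1 h1
    simp only [hB0, mul_zero, sub_zero]
    rcases hcase with rfl | rfl
    · simp only [hLtop, add_mul, Finset.sum_add_distrib, hcen, add_zero]
      refine sum_restrict n (n - 2 * a) n (by omega) le_rfl _ v _ (fun j => Iff.rfl) ?_
      intro j
      rw [← hper]
      congr 1
      ring
    · simp only [hLbot, add_mul, Finset.sum_add_distrib, hcen, add_zero]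
      refine sum_restrict n (-n) (-n + 2 * a) le_rfl (by omega) _ v _
        (fun j => by omega) ?_
      intro j
      rw [← hper2]
      congr 1
      ring
end

section
/- For every k = m + 2(n−a−1) with m ∈ {1, …, 2a}, the vector v_k ∈ ℝ^{2n+1} with components (v_k)_j = (2a+1)^{−1/2}·cos(j·l_k·π/(2a+1)) if k is even and (v_k)_j = (2a+1)^{−1/2}·sin(j·l_k·π/(2a+1)) if k is odd, for j = −n,…,n, satisfies the generalised eigenproblem (𝓛 − λ_k·B)·v_k = 0. -/
open Real

theorem window_sum_zero (v : ℤ → ℝ) (c : ℝ) (hc : c ≠ 1) (a : ℕ)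
    (hrec : ∀ j, v (j - 1) + v (j + 1) = 2 * c * v j)
    (hper : ∀ j, v (j + (2 * a + 1)) = v j) (s t : ℤ) (hst : t = s + 2 * a) :
    ∑ j ∈ Finset.Icc s t, v j = 0 := by
  have key : ∀ s : ℤ, ∑ r ∈ Finset.range (2 * a + 1), v (s + 1 + r)
      = ∑ r ∈ Finset.range (2 * a + 1), v (s + r) := by
    intro s
    rw [Finset.sum_range_succ, Finset.sum_range_succ']
    congr 1
    · apply Finset.sum_congr rfl
      intro r _
      congr 1
      push_cast
      ring
    · rw [← hper (s + ((0 : ℕ) : ℤ))]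
      congr 1
      push_cast
      ring
  have e : ∑ j ∈ Finset.Icc s t, v j = ∑ r ∈ Finset.range (2 * a + 1), v (s + r) := by
    refine Finset.sum_nbij' (fun j => (j - s).toNat) (fun r => s + (r : ℤ)) ?_ ?_ ?_ ?_ ?_
    · intro j hj
      simp only [Finset.mem_Icc, Finset.mem_range] at *
      omega
    · intro j hj
      simp only [Finset.mem_Icc, Finset.mem_range] at *
      omega
    · intro j hj
      simp only [Finset.mem_Icc] at *
      omega
    · intro j hj
      simp
    · intro j hj
      simp only [Finset.mem_Icc] at *
      congr 1
      omega
  rw [e]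
  have h1 := key s
  have h2 := key (s - 1)
  have h3 : ∑ r ∈ Finset.range (2 * a + 1), v (s - 1 + r)
      + ∑ r ∈ Finset.range (2 * a + 1), v (s + 1 + r)
      = 2 * c * ∑ r ∈ Finset.range (2 * a + 1), v (s + r) := by
    rw [← Finset.sum_add_distrib, Finset.mul_sum]
    apply Finset.sum_congr rfl
    intro r _
    rw [← hrec]
    congr 2 <;> ring
  rw [sub_add_cancel] at h2
  have h4 : (1 - c) * ∑ r ∈ Finset.range (2 * a + 1), v (s + r) = 0 := by linarith
  rcases mul_eq_zero.1 h4 with h | h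
  · exact absurd (by linarith) hc
  · exact h

/-- For every `k = m + 2(n−a−1)` with `m ∈ {1,…,2a}`, the vector with
components `(v_k)_j = (2a+1)^{-1/2} cos(j l_k π/(2a+1))` for even `k` and
`(v_k)_j = (2a+1)^{-1/2} sin(j l_k π/(2a+1))` for odd `k` satisfies
`(𝓛 − λ_k B) v_k = 0`, where `l_k = 2⌈m/2⌉` and `λ_k = −2[1 − cos(π l_k/(2a+1))]`. -/
theorem stmt_9 (n a : ℕ) (ha : 1 ≤ a) (han : a < n) (ℓ : ℝ) (hℓ0 : 0 < ℓ) (hℓπ : ℓ < π)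
    (B L : ℤ → ℤ → ℝ)
    (hB : ∀ i j : ℤ, B i j = if i = j ∧ |i| ≤ (n : ℤ) - 1 then 1 else 0)
    (hLmid : ∀ i j : ℤ, |i| ≤ (n : ℤ) - 1 →
      L i j = if j = i then -2 else if j = i - 1 ∨ j = i + 1 then 1 else 0)
    (hLtop : ∀ j : ℤ, L (n : ℤ) j =
      (if (n : ℤ) - 2 * a ≤ j ∧ j ≤ (n : ℤ) then (-1 : ℝ) else 0) +
      (if |j| ≤ (a : ℤ) then Real.cos ℓ else 0))
    (hLbot : ∀ j : ℤ, L (-(n : ℤ)) j =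
      (if (n : ℤ) - 2 * a ≤ -j ∧ -j ≤ (n : ℤ) then (-1 : ℝ) else 0) +
      (if |j| ≤ (a : ℤ) then Real.cos ℓ else 0))
    (m : ℕ) (hm1 : 1 ≤ m) (hm2 : m ≤ 2 * a)
    (k : ℕ) (hkm : k = m + 2 * (n - a - 1))
    (lk : ℝ) (hlk : lk = 2 * (⌈(m : ℝ) / 2⌉ : ℤ))
    (lam : ℝ) (hlam : lam = -2 * (1 - Real.cos (π * lk / (2 * (a : ℝ) + 1))))
    (v : ℤ → ℝ)
    (hv : ∀ j : ℤ, v j =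
      if Even k then (2 * (a : ℝ) + 1) ^ (-(1/2) : ℝ) *
        Real.cos ((j : ℝ) * lk * π / (2 * (a : ℝ) + 1))
      else (2 * (a : ℝ) + 1) ^ (-(1/2) : ℝ) *
        Real.sin ((j : ℝ) * lk * π / (2 * (a : ℝ) + 1))) :
    ∀ i : ℤ, |i| ≤ (n : ℤ) →
      ∑ j ∈ Finset.Icc (-(n : ℤ)) (n : ℤ), (L i j - lam * B i j) * v j = 0 := by
  have hN : (0 : ℝ) < 2 * (a : ℝ) + 1 := by positivity
  obtain ⟨p, hp⟩ : ∃ p : ℤ, p = ⌈(m : ℝ) / 2⌉ := ⟨_, rfl⟩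
  rw [← hp] at hlk
  have hp1 : 1 ≤ p := by
    rw [hp, Int.one_le_ceil_iff]
    have : (1 : ℝ) ≤ m := by exact_mod_cast hm1
    linarith
  have hp2 : p ≤ a := by
    rw [hp, Int.ceil_le]
    have : (m : ℝ) ≤ 2 * a := by exact_mod_cast hm2
    push_cast
    linarith
  have hp1' : (1 : ℝ) ≤ p := by exact_mod_cast hp1
  have hp2' : (p : ℝ) ≤ a := by exact_mod_cast hp2
  obtain ⟨θ, hθ⟩ : ∃ θ : ℝ, θ = π * lk / (2 * (a : ℝ) + 1) := ⟨_, rfl⟩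
  have hθN : θ * (2 * (a : ℝ) + 1) = p * (2 * π) := by
    rw [hθ, hlk]
    field_simp
  have hθ0 : 0 < θ := by
    rw [hθ, hlk]
    have := Real.pi_pos
    positivity
  have hθ1 : θ < 2 * π := by
    have := Real.pi_pos
    rw [hθ, hlk, div_lt_iff₀ hN]
    nlinarith
  have hc : Real.cos θ ≠ 1 := by
    intro h
    have := (Real.cos_eq_one_iff_of_lt_of_lt (by linarith) hθ1).1 h
    linarith
  rw [← hθ] at hlam
  have hv' : ∀ j : ℤ, v j = if Even k then (2 * (a : ℝ) + 1) ^ (-(1/2) : ℝ) * Real.cos (j * θ)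
      else (2 * (a : ℝ) + 1) ^ (-(1/2) : ℝ) * Real.sin (j * θ) := by
    intro j
    have : (j : ℝ) * lk * π / (2 * (a : ℝ) + 1) = j * θ := by rw [hθ]; ring
    rw [hv, this]
  have hrec : ∀ j, v (j - 1) + v (j + 1) = 2 * Real.cos θ * v j := by
    intro j
    simp only [hv']
    push_cast
    rw [sub_mul, add_mul, one_mul]
    split_ifs
    · rw [Real.cos_sub, Real.cos_add]; ring
    · rw [Real.sin_sub, Real.sin_add]; ring
  have hper : ∀ j, v (j + (2 * a + 1)) = v j := by
    intro j
    simp only [hv']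
    push_cast
    have : ((j : ℝ) + (2 * a + 1)) * θ = j * θ + p * (2 * π) := by rw [← hθN]; ring
    rw [this, Real.cos_add_int_mul_two_pi, Real.sin_add_int_mul_two_pi]
  have hwin := window_sum_zero v (Real.cos θ) hc a hrec hper
  intro i hi
  by_cases hi' : |i| ≤ (n : ℤ) - 1
  · have hb := abs_le.1 hi'
    have : ∀ j ∈ Finset.Icc (-(n : ℤ)) (n : ℤ), (L i j - lam * B i j) * v j =
        (if j = i - 1 then v j else 0) + (if j = i + 1 then v j else 0)
          + (if j = i then (-2 - lam) * v j else 0) := by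
      intro j _
      rw [hLmid i j hi', hB]
      by_cases h1 : j = i
      · subst h1
        have : ¬ (j = j - 1) := by omega
        simp [hi', this]
      · by_cases h2 : j = i - 1
        · subst h2
          have : ¬ (i - 1 = i + 1) := by omega
          have h' : ¬ (i = i - 1) := by omega
          simp [this, h']
        · by_cases h3 : j = i + 1
          · subst h3
            have : ¬ (i + 1 = i - 1) := by omega
            simp [this]
          · have : ¬ i = j := fun h => h1 h.symm
            simp [h1, h2, h3, this]
    rw [Finset.sum_congr rfl this, Finset.sum_add_distrib, Finset.sum_add_distrib,
      Finset.sum_ite_eq', Finset.sum_ite_eq', Finset.sum_ite_eq',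
      if_pos (Finset.mem_Icc.2 (by omega)), if_pos (Finset.mem_Icc.2 (by omega)),
      if_pos (Finset.mem_Icc.2 (by omega)), hrec, hlam]
    ring
  · have hB0 : ∀ j, B i j = 0 := by
      intro j
      rw [hB, if_neg (fun h => hi' h.2)]
    have hmid : ∑ j ∈ Finset.Icc (-(n : ℤ)) (n : ℤ),
        (if |j| ≤ (a : ℤ) then Real.cos ℓ * v j else 0) = 0 := by
      rw [← Finset.sum_filter, ← Finset.mul_sum]
      have : (Finset.Icc (-(n : ℤ)) (n : ℤ)).filter (fun j => |j| ≤ (a : ℤ))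
          = Finset.Icc (-(a : ℤ)) a := by
        ext j
        simp only [Finset.mem_filter, Finset.mem_Icc, abs_le]
        omega
      rw [this, hwin _ _ (by ring), mul_zero]
    have hin : i = n ∨ i = -(n : ℤ) := by
      rcases abs_cases i with h | h <;> omega
    rcases hin with rfl | rfl
    · have h2 : ∑ j ∈ Finset.Icc (-(n : ℤ)) (n : ℤ),
          (if (n : ℤ) - 2 * a ≤ j ∧ j ≤ (n : ℤ) then -1 * v j else 0) = 0 := by
        rw [← Finset.sum_filter, ← Finset.mul_sum]
        have : (Finset.Icc (-(n : ℤ)) (n : ℤ)).filter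
            (fun j => (n : ℤ) - 2 * a ≤ j ∧ j ≤ (n : ℤ)) = Finset.Icc ((n : ℤ) - 2 * a) n := by
          ext j
          simp only [Finset.mem_filter, Finset.mem_Icc]
          omega
        rw [this, hwin _ _ (by ring), mul_zero]
      simp only [hB0, hLtop, mul_zero, sub_zero, add_mul, Finset.sum_add_distrib, ite_mul,
        zero_mul]
      rw [h2, hmid, add_zero]
    · have h2 : ∑ j ∈ Finset.Icc (-(n : ℤ)) (n : ℤ),
          (if (n : ℤ) - 2 * a ≤ -j ∧ -j ≤ (n : ℤ) then -1 * v j else 0) = 0 := by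
        rw [← Finset.sum_filter, ← Finset.mul_sum]
        have : (Finset.Icc (-(n : ℤ)) (n : ℤ)).filter
            (fun j => (n : ℤ) - 2 * a ≤ -j ∧ -j ≤ (n : ℤ))
            = Finset.Icc (-(n : ℤ)) (-(n : ℤ) + 2 * a) := by
          ext j
          simp only [Finset.mem_filter, Finset.mem_Icc]
          omega
        rw [this, hwin _ _ (by ring), mul_zero]
      simp only [hB0, hLbot, mul_zero, sub_zero, add_mul, Finset.sum_add_distrib, ite_mul,
        zero_mul]
      rw [h2, hmid, add_zero]
end

section
/- Let k be even with 0 ≤ k ≤ 2(n−a−1) and assume sin[(2a+1)·l_k·π/(4(n−a))] ≠ 0. For p = 0, …, a define w_p = (−1)^{⌈(k−1)/2⌉}·{2·sin[(2a+1)·l_k·π/(4(n−a))]}^{−1}·[cos(l_k·π/(4(n−a))) − cos((2p+1)·l_k·π/(4(n−a)))]·[(n−a)·sin ℓ]^{−1/2}, and write z'_j = [(n−a)·sin ℓ]^{−1/2}·sin(ℓ − (−1)^{k/2}·|j|·l_k·π/(2(n−a))). Define z ∈ ℝ^{2n+1} by: z_j = z'_j − 2·cos ℓ·w_{a−|j|}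 for 0 ≤ |j| ≤ a; z_j = z'_j for a < |j| ≤ n−2a; z_j = z'_j + w_{|j|−n+2a} for n−2a < |j| ≤ n−a; z_j = w_{n−|j|} for n−a < |j| ≤ n−1; and z_{n} = z_{n−1}, z_{−n} = z_{−(n−1)}. Then z^T·(𝓛 − λ_k·B) = 0. -/
open Real

/-- The purely algebraic core: the three-term recurrence for the half vector. -/
lemma core_rec (n a : ℤ) (ha : 1 ≤ a) (h3 : 3 * a ≤ n) (Zp W y : ℤ → ℝ) (D q : ℝ)
    (hW : ∀ p, W (p - 1) + W (p + 1) - D * W p = W 1) (hW0 : W 0 = 0)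
    (hZ : ∀ p, Zp (p - 1) + Zp (p + 1) - D * Zp p = 0) (hZe : Zp (n - a) = 0)
    (hZ1 : Zp (n - a - 1) = W (a + 1) - W (a - 1))
    (y1 : ∀ m, 0 ≤ m → m ≤ a → y m = Zp m - 2 * q * W (a - m))
    (y2 : ∀ m, a ≤ m → m ≤ n - 2 * a → y m = Zp m)
    (y3 : ∀ m, n - 2 * a ≤ m → m ≤ n - a → y m = Zp m + W (m - n + 2 * a))
    (y4 : ∀ m, n - a ≤ m → m ≤ n → y m = W (n - m)) (m : ℤ) (hm1 : 1 ≤ m) (hmn : m ≤ n - 1) :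
    y (m - 1) + y (m + 1) - D * y m =
      W 1 * ((if n - 2 * a ≤ m then 1 else 0) - 2 * q * (if m ≤ a then 1 else 0)) := by
  rcases lt_trichotomy m a with h | h | h
  · have e1 := hW (a - m)
    rw [if_neg (by omega), if_pos (by omega), y1 (m-1) (by omega) (by omega),
      y1 (m+1) (by omega) (by omega), y1 m (by omega) (by omega),
      show a - (m - 1) = a - m + 1 by ring, show a - (m + 1) = a - m - 1 by ring]
    linear_combination hZ m - 2 * q * e1
  · subst h
    rw [if_pos le_rfl, y1 (m-1) (by omega) (by omega), y1 m (by omega) (by omega),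
      show m - (m - 1) = 1 by ring, show m - m = 0 by ring, hW0]
    rcases lt_or_ge m (n - 2 * m) with h' | h'
    · rw [if_neg (by omega), y2 (m+1) (by omega) (by omega)]
      linear_combination hZ m
    · rw [if_pos h', y3 (m+1) (by omega) (by omega), show m + 1 - n + 2 * m = 1 by omega]
      linear_combination hZ m
  · rw [if_neg (show ¬ m ≤ a by omega)]
    rcases lt_trichotomy m (n - 2 * a) with h' | h' | h'
    · rw [if_neg (by omega), y2 (m+1) (by omega) (by omega), y2 m (by omega) (by omega),
        y2 (m-1) (by omega) (by omega)]
      linear_combination hZ m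
    · rw [if_pos (by omega), y3 (m+1) (by omega) (by omega), y2 m (by omega) (by omega),
        y2 (m-1) (by omega) (by omega), show m + 1 - n + 2 * a = 1 by omega]
      linear_combination hZ m
    · rw [if_pos (by omega)]
      rcases lt_trichotomy m (n - a) with h'' | h'' | h''
      · have e1 := hW (m - n + 2 * a)
        rw [y3 (m+1) (by omega) (by omega), y3 m (by omega) (by omega),
          y3 (m-1) (by omega) (by omega),
          show m + 1 - n + 2 * a = m - n + 2 * a + 1 by ring,
          show m - 1 - n + 2 * a = m - n + 2 * a - 1 by ring]
        linear_combination hZ m + e1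
      · have e1 := hW a
        rw [y4 (m+1) (by omega) (by omega), y4 m (by omega) (by omega),
          y3 (m-1) (by omega) (by omega),
          show n - (m + 1) = a - 1 by omega, show n - m = a by omega,
          show m - 1 - n + 2 * a = a - 1 by omega, show m - 1 = n - a - 1 by omega, hZ1]
        linear_combination e1
      · have e1 := hW (n - m)
        rw [y4 (m+1) (by omega) (by omega), y4 m (by omega) (by omega),
          y4 (m-1) (by omega) (by omega),
          show n - (m + 1) = n - m - 1 by ring, show n - (m - 1) = n - m + 1 by ring]
        linear_combination e1

lemma core_zero (a : ℤ) (ha : 1 ≤ a) (Zp W y : ℤ → ℝ) (D q : ℝ)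
    (hW : ∀ p, W (p - 1) + W (p + 1) - D * W p = W 1)
    (hZ0 : 2 * Zp 1 - D * Zp 0 = - 2 * q * (W (a + 1) - W (a - 1)))
    (y1 : ∀ m, 0 ≤ m → m ≤ a → y m = Zp m - 2 * q * W (a - m)) :
    2 * y 1 - D * y 0 = - 2 * q * W 1 := by
  rw [y1 1 (by omega) ha, y1 0 le_rfl (by omega), show a - 0 = a by ring]
  linear_combination hZ0 - 2 * q * hW a



/-- left eigenvector for even `k ≤ 2(n−a−1)` (with nonzero normalising
sine), built from `z'` and the boundary-layer vector `w`, satisfies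
`z^T (𝓛 − λ_k B) = 0`. -/
theorem stmt_10 (n a : ℕ) (ha : 1 ≤ a) (han : a < n) (h3a : 3 * a ≤ n)
    (ℓ : ℝ) (hℓ0 : 0 < ℓ) (hℓπ : ℓ < π)
    (B L : ℤ → ℤ → ℝ)
    (hB : ∀ i j : ℤ, B i j = if i = j ∧ |i| ≤ (n : ℤ) - 1 then 1 else 0)
    (hLmid : ∀ i j : ℤ, |i| ≤ (n : ℤ) - 1 →
      L i j = if j = i then -2 else if j = i - 1 ∨ j = i + 1 then 1 else 0)
    (hLtop : ∀ j : ℤ, L (n : ℤ) j =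
      (if (n : ℤ) - 2 * a ≤ j ∧ j ≤ (n : ℤ) then (-1 : ℝ) else 0) +
      (if |j| ≤ (a : ℤ) then Real.cos ℓ else 0))
    (hLbot : ∀ j : ℤ, L (-(n : ℤ)) j =
      (if (n : ℤ) - 2 * a ≤ -j ∧ -j ≤ (n : ℤ) then (-1 : ℝ) else 0) +
      (if |j| ≤ (a : ℤ) then Real.cos ℓ else 0))
    (k : ℕ) (hk : k ≤ 2 * (n - a - 1)) (hke : Even k)
    (lk : ℝ) (hlk : lk = (k : ℝ) + 1 + (-1 : ℝ) ^ (k / 2) * (2 * ℓ / π - 1))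
    (lam : ℝ) (hlam : lam = -2 * (1 - Real.cos (π * lk / (2 * ((n : ℝ) - a)))))
    (hsin : Real.sin ((2 * (a : ℝ) + 1) * lk * π / (4 * ((n : ℝ) - a))) ≠ 0)
    (w : ℤ → ℝ)
    (hw : ∀ p : ℤ, 0 ≤ p → p ≤ (a : ℤ) →
      w p = (-1 : ℝ) ^ (⌈((k : ℝ) - 1) / 2⌉ : ℤ) *
        (2 * Real.sin ((2 * (a : ℝ) + 1) * lk * π / (4 * ((n : ℝ) - a))))⁻¹ *
        (Real.cos (lk * π / (4 * ((n : ℝ) - a))) -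
          Real.cos ((2 * (p : ℝ) + 1) * lk * π / (4 * ((n : ℝ) - a)))) *
        (((n : ℝ) - a) * Real.sin ℓ) ^ (-(1/2) : ℝ))
    (z' : ℤ → ℝ)
    (hz' : ∀ j : ℤ, z' j = (((n : ℝ) - a) * Real.sin ℓ) ^ (-(1/2) : ℝ) *
      Real.sin (ℓ - (-1 : ℝ) ^ (k / 2) * (|j| : ℤ) * lk * π / (2 * ((n : ℝ) - a))))
    (z : ℤ → ℝ)
    (hz1 : ∀ j : ℤ, |j| ≤ (a : ℤ) → z j = z' j - 2 * Real.cos ℓ * w ((a : ℤ) - |j|))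
    (hz2 : ∀ j : ℤ, (a : ℤ) < |j| → |j| ≤ (n : ℤ) - 2 * a → z j = z' j)
    (hz3 : ∀ j : ℤ, (n : ℤ) - 2 * a < |j| → |j| ≤ (n : ℤ) - a →
      z j = z' j + w (|j| - n + 2 * a))
    (hz4 : ∀ j : ℤ, (n : ℤ) - a < |j| → |j| ≤ (n : ℤ) - 1 → z j = w ((n : ℤ) - |j|))
    (hzn : z (n : ℤ) = z ((n : ℤ) - 1))
    (hzmn : z (-(n : ℤ)) = z (-((n : ℤ) - 1))) :
    ∀ j : ℤ, |j| ≤ (n : ℤ) →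
      ∑ i ∈ Finset.Icc (-(n : ℤ)) (n : ℤ), z i * (L i j - lam * B i j) = 0 := by
  have hnR : (0:ℝ) < (n:ℝ) - a := by
    have : (a:ℝ) < n := by exact_mod_cast han
    linarith
  obtain ⟨r, hr⟩ := hke
  have hk2 : k / 2 = r := by omega
  have hceil : ⌈((k : ℝ) - 1) / 2⌉ = (r : ℤ) := by
    rw [Int.ceil_eq_iff, hr]
    push_cast
    constructor <;> linarith
  rw [hceil, zpow_natCast] at hw
  rw [hk2] at hz' hlk
  set s : ℝ := (-1 : ℝ) ^ r with hs
  have hs2 : s * s = 1 := by rw [hs, ← mul_pow]; norm_num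
  have hss : s = 1 ∨ s = -1 := by
    have : (s - 1) * (s + 1) = 0 := by linear_combination hs2
    rcases mul_eq_zero.mp this with h | h
    · left; linarith
    · right; linarith
  set C : ℝ := (((n : ℝ) - a) * Real.sin ℓ) ^ (-(1/2) : ℝ) with hC
  set θ : ℝ := lk * π / (4 * ((n : ℝ) - a)) with hθ
  have hθN : 2 * ((n:ℝ) - a) * θ = lk * π / 2 := by
    rw [hθ]; field_simp; ring
  have harg : (2 * (a : ℝ) + 1) * lk * π / (4 * ((n : ℝ) - a)) = (2 * a + 1) * θ := by
    rw [hθ]; ring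
  rw [harg] at hsin hw
  set D : ℝ := 2 * Real.cos (2 * θ) with hD
  have hlamD : lam = D - 2 := by
    rw [hlam, hD, show π * lk / (2 * ((n : ℝ) - a)) = 2 * θ by rw [hθ]; field_simp; ring]; ring
  set S : ℝ := Real.sin ((2 * a + 1) * θ) with hS
  obtain ⟨W, hWdef⟩ : ∃ W : ℤ → ℝ, ∀ p, W p =
      s * (2 * S)⁻¹ * (Real.cos θ - Real.cos ((2 * (p : ℝ) + 1) * θ)) * C := ⟨_, fun _ => rfl⟩
  obtain ⟨Zp, hZdef⟩ : ∃ Zp : ℤ → ℝ, ∀ p, Zp p = C * Real.sin (ℓ - s * (p * (2 * θ))) :=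
    ⟨_, fun _ => rfl⟩
  have hwW : ∀ p : ℤ, 0 ≤ p → p ≤ (a : ℤ) → w p = W p := by
    intro p h0 h1
    rw [hw p h0 h1, hWdef, show (2 * (p : ℝ) + 1) * lk * π / (4 * ((n : ℝ) - a))
      = (2 * (p : ℝ) + 1) * θ by rw [hθ]; ring]
  have hzZ : ∀ j, z' j = Zp |j| := by
    intro j
    rw [hz' j, hZdef, show s * (|j| : ℤ) * lk * π / (2 * ((n : ℝ) - a))
      = s * (((|j| : ℤ) : ℝ) * (2 * θ)) by rw [hθ]; field_simp; ring]
  have hW0 : W 0 = 0 := by rw [hWdef]; simp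
  have hWm : W (-1) = 0 := by
    rw [hWdef, show (2 * ((-1 : ℤ) : ℝ) + 1) * θ = -θ by push_cast; ring, Real.cos_neg]; simp
  have hWrec : ∀ p, W (p - 1) + W (p + 1) - D * W p = W 1 := by
    intro p
    have e1 : Real.cos ((2 * ((p - 1 : ℤ) : ℝ) + 1) * θ) + Real.cos ((2 * ((p + 1 : ℤ) : ℝ) + 1) * θ)
        = D * Real.cos ((2 * (p : ℝ) + 1) * θ) := by
      rw [show (2 * ((p - 1 : ℤ) : ℝ) + 1) * θ = (2 * (p : ℝ) + 1) * θ - 2 * θ by push_cast; ring,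
        show (2 * ((p + 1 : ℤ) : ℝ) + 1) * θ = (2 * (p : ℝ) + 1) * θ + 2 * θ by push_cast; ring,
        Real.cos_sub, Real.cos_add, hD]
      ring
    have e2 : Real.cos ((2 * ((1 : ℤ) : ℝ) + 1) * θ) = D * Real.cos θ - Real.cos θ := by
      rw [show (2 * ((1 : ℤ) : ℝ) + 1) * θ = 2 * θ + θ by push_cast; ring, hD]
      have : Real.cos (2 * θ - θ) = Real.cos θ := by congr 1; ring
      rw [Real.cos_sub] at this
      rw [Real.cos_add]
      linear_combination -this
    rw [hWdef, hWdef, hWdef, hWdef, e2]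
    linear_combination (- s * (2 * S)⁻¹ * C) * e1
  have hWe : W (a + 1) - W (a - 1) = s * C * Real.sin (2 * θ) := by
    rw [hWdef, hWdef,
      show (2 * (((a : ℤ) + 1 : ℤ) : ℝ) + 1) * θ = (2 * a + 1) * θ + 2 * θ by push_cast; ring,
      show (2 * (((a : ℤ) - 1 : ℤ) : ℝ) + 1) * θ = (2 * a + 1) * θ - 2 * θ by push_cast; ring,
      Real.cos_sub, Real.cos_add, ← hS]
    field_simp
    ring
  have hsinS : ∀ x, Real.sin (s * x) = s * Real.sin x := by
    intro x; rcases hss with h | h <;> rw [h] <;> simp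
  have hcosS : ∀ x, Real.cos (s * x) = Real.cos x := by
    intro x; rcases hss with h | h <;> rw [h] <;> simp
  have hZrec : ∀ p, Zp (p - 1) + Zp (p + 1) - D * Zp p = 0 := by
    intro p
    rw [hZdef, hZdef, hZdef,
      show ℓ - s * (((p - 1 : ℤ) : ℝ) * (2 * θ)) = (ℓ - s * (p * (2 * θ))) + s * (2 * θ) by
        push_cast; ring,
      show ℓ - s * (((p + 1 : ℤ) : ℝ) * (2 * θ)) = (ℓ - s * (p * (2 * θ))) - s * (2 * θ) by
        push_cast; ring]
    generalize ℓ - s * (p * (2 * θ)) = x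
    rw [Real.sin_add, Real.sin_sub, hcosS, hD]
    ring
  obtain ⟨t, ht⟩ : ∃ t : ℤ, ℓ - s * (2 * ((n:ℝ) - a) * θ) = t * (2 * π) := by
    have hπ := Real.pi_ne_zero
    have e0 : ℓ - s * (2 * ((n:ℝ) - a) * θ) = π / 2 * (1 - s * (2 * r + 1)) := by
      rw [hθN, hlk, hr]
      push_cast
      have : (r + r + 1 + s * (2 * ℓ / π - 1)) * π = (2 * r + 1) * π + s * (2 * ℓ - π) := by
        field_simp; ring
      rw [this]
      linear_combination (-(ℓ - π / 2)) * hs2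
    rw [e0]
    rcases Nat.even_or_odd r with h | h
    · have : s = 1 := by rw [hs]; exact h.neg_one_pow
      obtain ⟨m, hm⟩ := h
      refine ⟨-m, ?_⟩
      rw [this, hm]; push_cast; ring
    · have : s = -1 := by rw [hs]; exact h.neg_one_pow
      obtain ⟨m, hm⟩ := h
      refine ⟨m + 1, ?_⟩
      rw [this, hm]; push_cast; ring
  have hZe : Zp ((n:ℤ) - a) = 0 := by
    rw [hZdef, show ℓ - s * ((((n:ℤ) - a : ℤ) : ℝ) * (2 * θ)) = 0 + t * (2 * π) by
      rw [← ht]; push_cast; ring, Real.sin_add_int_mul_two_pi]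
    simp
  have hZ1 : Zp ((n:ℤ) - a - 1) = W (a + 1) - W (a - 1) := by
    rw [hWe, hZdef, show ℓ - s * ((((n:ℤ) - a - 1 : ℤ) : ℝ) * (2 * θ)) = s * (2 * θ) + t * (2 * π) by
      rw [← ht]; push_cast; ring, Real.sin_add_int_mul_two_pi, hsinS]
    ring
  have hZ0 : 2 * Zp 1 - D * Zp 0 = - 2 * Real.cos ℓ * (W (a + 1) - W (a - 1)) := by
    rw [hWe, hZdef, hZdef, show ℓ - s * (((1 : ℤ) : ℝ) * (2 * θ)) = ℓ - s * (2 * θ) by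
      push_cast; ring, show ℓ - s * (((0 : ℤ) : ℝ) * (2 * θ)) = ℓ by push_cast; ring,
      Real.sin_sub, hcosS, hsinS, hD]
    ring
  -- evenness and branch facts
  obtain ⟨Y, hY⟩ : ∃ Y : ℤ → ℝ, ∀ i, Y i = if |i| ≤ (n:ℤ) - 1 then z i else 0 :=
    ⟨_, fun _ => rfl⟩
  have b1 : ∀ j : ℤ, |j| ≤ (a:ℤ) → Y j = Zp |j| - 2 * Real.cos ℓ * W (a - |j|) := by
    intro j h
    have := abs_nonneg j
    rw [hY, if_pos (by omega), hz1 j h, hzZ, hwW _ (by omega) (by omega)]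
  have b2 : ∀ j : ℤ, (a:ℤ) ≤ |j| → |j| ≤ (n:ℤ) - 2 * a → Y j = Zp |j| := by
    intro j h h'
    rcases eq_or_lt_of_le h with h | h
    · rw [b1 j h.ge, ← h, sub_self, hW0]; ring
    · rw [hY, if_pos (by omega), hz2 j h h', hzZ]
  have b3 : ∀ j : ℤ, (n:ℤ) - 2 * a ≤ |j| → |j| ≤ (n:ℤ) - a →
      Y j = Zp |j| + W (|j| - n + 2 * a) := by
    intro j h h'
    rcases eq_or_lt_of_le h with h | h
    · rw [b2 j (by omega) h.ge, ← h, show (n:ℤ) - 2 * a - n + 2 * a = 0 by ring, hW0]; ring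
    · rw [hY, if_pos (by omega), hz3 j h h', hzZ, hwW _ (by omega) (by omega)]
  have b4 : ∀ j : ℤ, (n:ℤ) - a ≤ |j| → |j| ≤ (n:ℤ) → Y j = W (n - |j|) := by
    intro j h h'
    rcases eq_or_lt_of_le h with h | h
    · rw [b3 j (by omega) h.ge, ← h, hZe, show (n:ℤ) - a - n + 2 * a = a by ring,
        show (n:ℤ) - (n - a) = a by ring]; ring
    · rcases eq_or_lt_of_le h' with h' | h'
      · rw [hY, if_neg (by omega), h', sub_self, hW0]
      · rw [hY, if_pos (by omega), hz4 j h (by omega), hwW _ (by omega) (by omega)]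
  have b5 : ∀ j : ℤ, (n:ℤ) ≤ |j| → Y j = 0 := by
    intro j h
    rw [hY, if_neg (by omega)]
  have hYev : ∀ j, Y (-j) = Y j := by
    intro j
    have e := abs_neg j
    rcases le_or_gt |j| (a:ℤ) with h | h
    · rw [b1 j h, b1 (-j) (by omega), e]
    rcases le_or_gt |j| ((n:ℤ) - 2 * a) with h1 | h1
    · rw [b2 j h.le h1, b2 (-j) (by omega) (by omega), e]
    rcases le_or_gt |j| ((n:ℤ) - a) with h2 | h2
    · rw [b3 j h1.le h2, b3 (-j) (by omega) (by omega), e]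
    rcases le_or_gt |j| (n:ℤ) with h3 | h3
    · rw [b4 j h2.le h3, b4 (-j) (by omega) (by omega), e]
    · rw [b5 j h3.le, b5 (-j) (by omega)]
  have hYn1 : Y ((n:ℤ) - 1) = W 1 := by
    have e : |(n:ℤ) - 1| = n - 1 := abs_of_nonneg (by omega)
    rw [b4 _ (by omega) (by omega), e]; congr 1; ring
  have hzn' : z (n:ℤ) = W 1 := by
    have e : |(n:ℤ) - 1| = n - 1 := abs_of_nonneg (by omega)
    rw [hzn, ← hYn1, hY, if_pos (by omega)]
  have hzmn' : z (-(n:ℤ)) = W 1 := by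
    have e : |(n:ℤ) - 1| = n - 1 := abs_of_nonneg (by omega)
    rw [hzmn, ← hYn1, ← hYev, hY, if_pos (by rw [abs_neg]; omega)]
  have y1 : ∀ m : ℤ, 0 ≤ m → m ≤ a → Y m = Zp m - 2 * Real.cos ℓ * W (a - m) := by
    intro m h0 h
    have e := abs_of_nonneg h0
    rw [b1 m (by omega), e]
  have hmain : ∀ j : ℤ, 0 ≤ j → j ≤ n → Y (j - 1) + Y (j + 1) - D * Y j =
      W 1 * ((if (n:ℤ) - 2 * a ≤ j then 1 else 0) -
        2 * Real.cos ℓ * (if j ≤ a then 1 else 0)) := by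
    intro j h0 hn
    rcases eq_or_lt_of_le h0 with h | h
    · subst h
      have := core_zero a (by omega) Zp W Y D (Real.cos ℓ) hWrec hZ0 y1
      rw [if_neg (by omega), if_pos (by omega), show (0:ℤ) - 1 = -1 by ring, hYev,
        show (0:ℤ) + 1 = 1 by ring]
      linear_combination this
    rcases eq_or_lt_of_le hn with h' | h'
    · have e1 := abs_of_nonneg h0
      have e2 : |j + 1| = j + 1 := abs_of_nonneg (by omega)
      rw [if_pos (by omega), if_neg (by omega), b5 j (by omega), b5 (j+1) (by omega), h', hYn1]
      ring
    · refine core_rec n a (by omega) (by omega) Zp W Y D (Real.cos ℓ) hWrec hW0 hZrec hZe hZ1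
        y1 ?_ ?_ ?_ j (by omega) (by omega)
      · intro m h h'
        have e : |m| = m := abs_of_nonneg (by omega)
        rw [b2 m (by omega) (by omega), e]
      · intro m h h'
        have e : |m| = m := abs_of_nonneg (by omega)
        rw [b3 m (by omega) (by omega), e]
      · intro m h h'
        have e : |m| = m := abs_of_nonneg (by omega)
        rw [b4 m (by omega) (by omega), e]
  have hmain' : ∀ j : ℤ, |j| ≤ n → Y (j - 1) + Y (j + 1) - D * Y j =
      W 1 * ((if (n:ℤ) - 2 * a ≤ |j| then 1 else 0) -
        2 * Real.cos ℓ * (if |j| ≤ a then 1 else 0)) := by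
    intro j hj
    rcases abs_cases j with ⟨e, h⟩ | ⟨e, h⟩
    · rw [e] at hj ⊢
      exact hmain j h hj
    · rw [e] at hj ⊢
      rw [← hmain (-j) (by omega) hj, hYev j, ← hYev (j - 1), ← hYev (j + 1),
        show -(j - 1) = -j + 1 by ring, show -(j + 1) = -j - 1 by ring]
      ring
  intro j hj
  have hterm : ∀ i ∈ Finset.Icc (-(n : ℤ)) (n : ℤ), z i * (L i j - lam * B i j) =
      (if i = j - 1 then Y i else 0) + (if i = j + 1 then Y i else 0) +
      (if i = j then -(D * Y i) else 0) + (if i = n then W 1 * L n j else 0) +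
      (if i = -n then W 1 * L (-n) j else 0) := by
    intro i hi
    rw [Finset.mem_Icc] at hi
    by_cases h : |i| ≤ (n:ℤ) - 1
    · have h2 := abs_le.mp h
      rw [hLmid i j h, hB, hY, if_pos h, hlamD, if_neg (show ¬ i = (n:ℤ) by omega),
        if_neg (show ¬ i = -(n:ℤ) by omega)]
      by_cases c1 : i = j
      · rw [if_pos c1.symm, if_pos ⟨c1, h⟩, if_neg (by omega), if_neg (by omega), if_pos c1]; ring
      · rw [if_neg (Ne.symm c1), if_neg (show ¬ (i = j ∧ |i| ≤ (n:ℤ) - 1) from fun hh => c1 hh.1), if_neg c1]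
        by_cases c2 : i = j - 1
        · rw [if_pos (by omega), if_pos c2, if_neg (by omega)]; ring
        · by_cases c3 : i = j + 1
          · rw [if_pos (by omega), if_neg c2, if_pos c3]; ring
          · rw [if_neg (by omega), if_neg c2, if_neg c3]; ring
    · have hY0 : Y i = 0 := b5 i (by omega)
      have hB0 : B i j = 0 := by rw [hB, if_neg (fun hh => h hh.2)]
      rw [hY0, hB0]
      have : i = n ∨ i = -n := by
        by_contra hc
        apply h
        rw [abs_le]; omega
      rcases this with e | e
      · rw [if_pos e, if_neg (show ¬ i = -(n:ℤ) by omega), e, hzn']; simp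
      · rw [if_pos e, if_neg (show ¬ i = (n:ℤ) by omega), e, hzmn']; simp
  have hout : ∀ i : ℤ, (if i ∈ Finset.Icc (-(n : ℤ)) (n : ℤ) then Y i else 0) = Y i := by
    intro i
    split_ifs with h
    · rfl
    · refine (b5 i ?_).symm
      by_contra hc
      have := abs_le.mp (not_le.mp hc).le
      exact h (Finset.mem_Icc.mpr this)
  rw [Finset.sum_congr rfl hterm]
  simp only [Finset.sum_add_distrib, Finset.sum_ite_eq']
  rw [hout, hout, if_pos (Finset.mem_Icc.mpr (abs_le.mp hj)),
    if_pos (Finset.mem_Icc.mpr (by omega)), if_pos (Finset.mem_Icc.mpr (by omega)),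
    hLtop, hLbot]
  have hfin : (if (n : ℤ) - 2 * a ≤ j ∧ j ≤ (n : ℤ) then (-1 : ℝ) else 0) +
      (if (n : ℤ) - 2 * a ≤ -j ∧ -j ≤ (n : ℤ) then (-1 : ℝ) else 0) =
      - (if (n:ℤ) - 2 * a ≤ |j| then 1 else 0) := by
    rcases abs_cases j with ⟨e, h⟩ | ⟨e, h⟩
    · rw [e] at hj ⊢
      rw [if_neg (show ¬ ((n : ℤ) - 2 * a ≤ -j ∧ -j ≤ (n : ℤ)) by omega)]
      by_cases c : (n:ℤ) - 2 * a ≤ j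
      · rw [if_pos ⟨c, hj⟩, if_pos c]; ring
      · rw [if_neg (fun hh => c hh.1), if_neg c]; ring
    · rw [e] at hj ⊢
      rw [if_neg (show ¬ ((n : ℤ) - 2 * a ≤ j ∧ j ≤ (n : ℤ)) by omega)]
      by_cases c : (n:ℤ) - 2 * a ≤ -j
      · rw [if_pos ⟨c, hj⟩, if_pos c]; ring
      · rw [if_neg (fun hh => c hh.1), if_neg c]; ring
  have hq : (if |j| ≤ (a : ℤ) then Real.cos ℓ else 0) =
      Real.cos ℓ * (if |j| ≤ (a : ℤ) then 1 else 0) := by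
    split_ifs <;> ring
  rw [hq]
  linear_combination hmain' j hj + W 1 * hfin
end

section
/- Let k be odd with 0 ≤ k ≤ 2(n−a−1) and assume sin[(2a+1)·l_k·π/(4(n−a))] ≠ 0. For p = 0, …, a define w_p = (−1)^{⌈(k−1)/2⌉}·{2·sin[(2a+1)·l_k·π/(4(n−a))]}^{−1}·[cos(l_k·π/(4(n−a))) − cos((2p+1)·l_k·π/(4(n−a)))]·(n−a)^{−1/2}, and write z'_j = (n−a)^{−1/2}·sin(j·l_k·π/(2(n−a))). Define z ∈ ℝ^{2n+1} by: z_j = z'_j for 0 ≤ |j| ≤ n−2a; z_j = z'_j + sgn(j)·w_{|j|−n+2a} for n−2a < |j| ≤ n−a; z_j = sgn(j)·w_{n−|j|} for n−a < |j| ≤ n−1; and z_{n} = z_{n−1}, z_{−n} = z_{−(n−1)}. Then z^T·(𝓛 − λ_k·B) = 0. -/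
open Real

/-- left eigenvector for odd `k ≤ 2(n−a−1)` (with nonzero normalising
sine), built from `z'` and the boundary-layer vector `w`, satisfies
`z^T (𝓛 − λ_k B) = 0`. -/
theorem stmt_11 (n a : ℕ) (ha : 1 ≤ a) (han : a < n) (h3a : 3 * a ≤ n)
    (ℓ : ℝ) (hℓ0 : 0 < ℓ) (hℓπ : ℓ < π)
    (B L : ℤ → ℤ → ℝ)
    (hB : ∀ i j : ℤ, B i j = if i = j ∧ |i| ≤ (n : ℤ) - 1 then 1 else 0)
    (hLmid : ∀ i j : ℤ, |i| ≤ (n : ℤ) - 1 →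
      L i j = if j = i then -2 else if j = i - 1 ∨ j = i + 1 then 1 else 0)
    (hLtop : ∀ j : ℤ, L (n : ℤ) j =
      (if (n : ℤ) - 2 * a ≤ j ∧ j ≤ (n : ℤ) then (-1 : ℝ) else 0) +
      (if |j| ≤ (a : ℤ) then Real.cos ℓ else 0))
    (hLbot : ∀ j : ℤ, L (-(n : ℤ)) j =
      (if (n : ℤ) - 2 * a ≤ -j ∧ -j ≤ (n : ℤ) then (-1 : ℝ) else 0) +
      (if |j| ≤ (a : ℤ) then Real.cos ℓ else 0))
    (k : ℕ) (hk : k ≤ 2 * (n - a - 1)) (hko : Odd k)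
    (lk : ℝ) (hlk : lk = (k : ℝ) + 1)
    (lam : ℝ) (hlam : lam = -2 * (1 - Real.cos (π * lk / (2 * ((n : ℝ) - a)))))
    (hsin : Real.sin ((2 * (a : ℝ) + 1) * lk * π / (4 * ((n : ℝ) - a))) ≠ 0)
    (w : ℤ → ℝ)
    (hw : ∀ p : ℤ, 0 ≤ p → p ≤ (a : ℤ) →
      w p = (-1 : ℝ) ^ (⌈((k : ℝ) - 1) / 2⌉ : ℤ) *
        (2 * Real.sin ((2 * (a : ℝ) + 1) * lk * π / (4 * ((n : ℝ) - a))))⁻¹ *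
        (Real.cos (lk * π / (4 * ((n : ℝ) - a))) -
          Real.cos ((2 * (p : ℝ) + 1) * lk * π / (4 * ((n : ℝ) - a)))) *
        ((n : ℝ) - a) ^ (-(1/2) : ℝ))
    (z' : ℤ → ℝ)
    (hz' : ∀ j : ℤ, z' j = ((n : ℝ) - a) ^ (-(1/2) : ℝ) *
      Real.sin ((j : ℝ) * lk * π / (2 * ((n : ℝ) - a))))
    (z : ℤ → ℝ)
    (hz1 : ∀ j : ℤ, |j| ≤ (n : ℤ) - 2 * a → z j = z' j)
    (hz2 : ∀ j : ℤ, (n : ℤ) - 2 * a < |j| → |j| ≤ (n : ℤ) - a →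
      z j = z' j + (j.sign : ℝ) * w (|j| - n + 2 * a))
    (hz3 : ∀ j : ℤ, (n : ℤ) - a < |j| → |j| ≤ (n : ℤ) - 1 →
      z j = (j.sign : ℝ) * w ((n : ℤ) - |j|))
    (hzn : z (n : ℤ) = z ((n : ℤ) - 1))
    (hzmn : z (-(n : ℤ)) = z (-((n : ℤ) - 1))) :
    ∀ j : ℤ, |j| ≤ (n : ℤ) →
      ∑ i ∈ Finset.Icc (-(n : ℤ)) (n : ℤ), z i * (L i j - lam * B i j) = 0 := by
  obtain ⟨r, hr⟩ := hko
  have hm : (0:ℝ) < (n:ℝ) - a := by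
    have : (a:ℝ) < n := by exact_mod_cast han
    linarith
  have hceil : ⌈((k : ℝ) - 1) / 2⌉ = (r : ℤ) := by
    have : ((k : ℝ) - 1) / 2 = ((r : ℤ) : ℝ) := by rw [hr]; push_cast; ring
    rw [this, Int.ceil_intCast]
  obtain ⟨φ, hφ⟩ : ∃ φ, φ = lk * π / (4 * ((n : ℝ) - a)) := ⟨_, rfl⟩
  obtain ⟨c, hc⟩ : ∃ c, c = ((n : ℝ) - a) ^ (-(1/2) : ℝ) := ⟨_, rfl⟩
  obtain ⟨S, hS⟩ : ∃ S, S = Real.sin ((2 * (a : ℝ) + 1) * φ) := ⟨_, rfl⟩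
  have e1 : Real.sin ((2 * (a : ℝ) + 1) * lk * π / (4 * ((n : ℝ) - a))) = S := by
    rw [hS, hφ]; congr 1; ring
  rw [e1] at hsin
  obtain ⟨C, hC⟩ : ∃ C, C = (-1 : ℝ) ^ r * (2 * S)⁻¹ * c := ⟨_, rfl⟩
  obtain ⟨W, hW⟩ : ∃ W : ℤ → ℝ, ∀ p, W p = C * (Real.cos φ - Real.cos ((2 * (p:ℝ) + 1) * φ)) :=
    ⟨_, fun _ => rfl⟩
  have hwW : ∀ p : ℤ, 0 ≤ p → p ≤ (a : ℤ) → w p = W p := by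
    intro p h0 h1
    have e2 : (2 * (p : ℝ) + 1) * lk * π / (4 * ((n : ℝ) - a)) = (2 * (p:ℝ) + 1) * φ := by
      rw [hφ]; ring
    rw [hw p h0 h1, hW, e1, e2, hceil, ← hφ, ← hc, hC, zpow_natCast]; ring
  have hzs : ∀ j : ℤ, z' j = c * Real.sin (2 * (j:ℝ) * φ) := by
    intro j
    rw [hz', ← hc, hφ]
    congr 2
    field_simp
    ring
  have hlam' : 2 + lam = 2 * Real.cos (2 * φ) := by
    have e3 : π * lk / (2 * ((n : ℝ) - a)) = 2 * φ := by
      rw [hφ]; field_simp; ring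
    rw [hlam, e3]; ring
  have hmφ : 2 * ((n:ℝ) - a) * φ = ((r + 1 : ℕ) : ℝ) * π := by
    rw [hφ, hlk, hr]; push_cast; field_simp; ring
  have hzpm : z' ((n:ℤ) - a) = 0 := by
    rw [hzs]
    push_cast
    rw [hmφ, Real.sin_nat_mul_pi, mul_zero]
  have hzpm1 : z' ((n:ℤ) - a - 1) = c * (-1)^r * Real.sin (2 * φ) := by
    rw [hzs]
    push_cast
    have e4 : 2 * ((n:ℝ) - a - 1) * φ = ((r + 1 : ℕ) : ℝ) * π - 2 * φ := by rw [← hmφ]; ring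
    rw [e4, Real.sin_sub, Real.sin_nat_mul_pi, Real.cos_nat_mul_pi, pow_succ]; ring
  have hzpodd : ∀ j, z' (-j) = - z' j := by
    intro j
    rw [hzs, hzs, ← mul_neg, ← Real.sin_neg]; congr 2; push_cast; ring
  have recz : ∀ j, z' (j - 1) + z' (j + 1) = (2 + lam) * z' j := by
    intro j
    rw [hzs, hzs, hzs, hlam']
    push_cast
    have e5 : 2 * ((j:ℝ) - 1) * φ = 2 * j * φ - 2 * φ := by ring
    have e6 : 2 * ((j:ℝ) + 1) * φ = 2 * j * φ + 2 * φ := by ring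
    rw [e5, e6, Real.sin_sub, Real.sin_add]; ring
  have W0 : W 0 = 0 := by rw [hW]; simp
  have Wm1 : W (-1) = 0 := by
    rw [hW, ← Real.cos_neg φ]; push_cast; ring_nf
  have recW : ∀ p, W (p - 1) + W (p + 1) - (2 + lam) * W p = W 1 := by
    intro p
    simp only [hW]
    rw [hlam']
    push_cast
    have e5 : (2 * ((p:ℝ) - 1) + 1) * φ = (2 * p + 1) * φ - 2 * φ := by ring
    have e6 : (2 * ((p:ℝ) + 1) + 1) * φ = (2 * p + 1) * φ + 2 * φ := by ring
    have e7 : (2 * (1:ℝ) + 1) * φ = φ + 2 * φ := by ring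
    have e8 : Real.cos φ = Real.cos (φ + 2 * φ) * Real.cos (2 * φ) +
        Real.sin (φ + 2 * φ) * Real.sin (2 * φ) := by
      rw [← Real.cos_sub]; ring_nf
    have e9 : Real.cos (φ - 2 * φ) = Real.cos φ := by
      rw [← Real.cos_neg]; ring_nf
    rw [Real.cos_sub] at e9
    rw [e5, e6, e7, Real.cos_sub ((2 * (p:ℝ) + 1) * φ), Real.cos_add ((2 * (p:ℝ) + 1) * φ),
      Real.cos_add φ]
    linear_combination (-C) * e9
  have peak : z' ((n:ℤ) - a - 1) + W (a - 1) - W (a + 1) = 0 := by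
    rw [hzpm1]
    simp only [hW]
    push_cast
    have e5 : (2 * ((a:ℝ) - 1) + 1) * φ = (2 * a + 1) * φ - 2 * φ := by ring
    have e6 : (2 * ((a:ℝ) + 1) + 1) * φ = (2 * a + 1) * φ + 2 * φ := by ring
    rw [e5, e6, Real.cos_sub, Real.cos_add, ← hS, hC]
    field_simp
    ring
  obtain ⟨zt, hzt⟩ : ∃ zt : ℤ → ℝ, ∀ i, zt i = if |i| ≤ (n:ℤ) - 1 then z i else 0 :=
    ⟨_, fun _ => rfl⟩
  have zodd : ∀ i : ℤ, |i| ≤ (n:ℤ) - 1 → z (-i) = - z i := by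
    intro i hi
    have hs : ((Int.sign (-i) : ℤ) : ℝ) = - (Int.sign i : ℝ) := by
      rw [Int.sign_neg]; push_cast; rfl
    by_cases h1 : |i| ≤ (n : ℤ) - 2 * a
    · rw [hz1 i h1, hz1 (-i) (by rwa [abs_neg]), hzpodd]
    · by_cases h2 : |i| ≤ (n : ℤ) - a
      · rw [hz2 i (by omega) h2, hz2 (-i) (by rw [abs_neg]; omega) (by rwa [abs_neg]), hzpodd,
          abs_neg, hs]; ring
      · rw [hz3 i (by omega) hi, hz3 (-i) (by rw [abs_neg]; omega) (by rwa [abs_neg]),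
          abs_neg, hs]; ring
  have ztodd : ∀ i : ℤ, zt (-i) = - zt i := by
    intro i
    rw [hzt, hzt, abs_neg]
    split_ifs with h
    · exact zodd i h
    · simp
  have F1 : ∀ j : ℤ, |j| ≤ (n:ℤ) - 2 * a → zt j = z' j := by
    intro j hj
    rw [hzt, if_pos (by omega), hz1 j hj]
  have F2 : ∀ j : ℤ, (n:ℤ) - 2 * a - 1 ≤ j → j ≤ (n:ℤ) - a → zt j = z' j + W (j - n + 2 * a) := by
    intro j h1 h2
    have hj : |j| = j := abs_of_nonneg (by omega)
    by_cases h3 : j ≤ (n:ℤ) - 2 * a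
    · rw [F1 j (by omega)]
      rcases (by omega : j - n + 2 * a = 0 ∨ j - n + 2 * a = -1) with h | h
      · rw [h, W0, add_zero]
      · rw [h, Wm1, add_zero]
    · rw [hzt, if_pos (by omega), hz2 j (by omega) (by omega), hj, Int.sign_eq_one_of_pos (by omega),
        hwW _ (by omega) (by omega)]
      simp
  have F3 : ∀ j : ℤ, (n:ℤ) - a ≤ j → j ≤ (n:ℤ) + 1 → zt j = W (n - j) := by
    intro j h1 h2
    have hj : |j| = j := abs_of_nonneg (by omega)
    rcases (by omega : j = (n:ℤ) - a ∨ j = n ∨ j = n + 1 ∨ ((n:ℤ) - a < j ∧ j ≤ (n:ℤ) - 1))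
      with h | h | h | h
    · rw [F2 j (by omega) (by omega), h, hzpm, zero_add]; congr 1; ring
    · rw [hzt, if_neg (by omega), h, sub_self, W0]
    · rw [hzt, if_neg (by omega), h, (by ring : (n:ℤ) - (n + 1) = -1), Wm1]
    · rw [hzt, if_pos (by omega), hz3 j (by omega) (by omega), hj,
        Int.sign_eq_one_of_pos (by omega), hwW _ (by omega) (by omega)]
      simp
  have hznW : z n = W 1 := by
    have h1 : |(n:ℤ) - 1| = (n:ℤ) - 1 := abs_of_nonneg (by omega)
    have h2 := F3 ((n:ℤ) - 1) (by omega) (by omega)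
    rw [hzt, if_pos (by omega)] at h2
    rw [hzn, h2]; congr 1; ring
  have hzmn' : z (-(n:ℤ)) = - z n := by
    have h1 : |(n:ℤ) - 1| = (n:ℤ) - 1 := abs_of_nonneg (by omega)
    rw [hzmn, zodd _ (by omega), hzn]
  have main : ∀ j : ℤ, 0 ≤ j → j ≤ n → zt (j - 1) + zt (j + 1) - (2 + lam) * zt j
      - (if (n:ℤ) - 2 * a ≤ j then z n else 0) = 0 := by
    intro j h0 hjn
    rcases (by omega : j ≤ (n:ℤ) - 2 * a - 1 ∨ ((n:ℤ) - 2 * a ≤ j ∧ j ≤ (n:ℤ) - a - 1) ∨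
      j = (n:ℤ) - a ∨ (n:ℤ) - a + 1 ≤ j) with h | h | h | h
    · rw [if_neg (by omega), F1 _ (by rw [abs_le]; omega), F1 _ (by rw [abs_le]; omega),
        F1 _ (by rw [abs_le]; omega), recz]; ring
    · rw [if_pos (by omega), F2 _ (by omega) (by omega), F2 _ (by omega) (by omega),
        F2 _ (by omega) (by omega), hznW]
      have := recW (j - n + 2 * a)
      rw [(by ring : j - 1 - n + 2 * a = j - n + 2 * a - 1),
        (by ring : j + 1 - n + 2 * a = j - n + 2 * a + 1)]
      linear_combination this + recz j
    · rw [if_pos (by omega), F2 (j - 1) (by omega) (by omega), F3 (j + 1) (by omega) (by omega),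
        F3 j (by omega) (by omega), hznW, h]
      have := recW a
      rw [(by ring : (n:ℤ) - a - 1 - n + 2 * a = a - 1), (by ring : (n:ℤ) - (n - a + 1) = a - 1),
        (by ring : (n:ℤ) - (n - a) = a)]
      linear_combination this + peak
    · rw [if_pos (by omega), F3 _ (by omega) (by omega), F3 _ (by omega) (by omega),
        F3 _ (by omega) (by omega), hznW]
      have := recW (n - j)
      rw [(by ring : n - (j - 1) = n - j + 1), (by ring : n - (j + 1) = n - j - 1)]
      linear_combination this
  intro j hj
  have hj' := abs_le.mp hj
  have key : ∑ i ∈ Finset.Icc (-(n : ℤ)) (n : ℤ), z i * (L i j - lam * B i j) =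
      zt (j - 1) + zt (j + 1) - (2 + lam) * zt j + z n * L n j + z (-(n:ℤ)) * L (-(n:ℤ)) j := by
    have hterm : ∀ i ∈ Finset.Icc (-(n : ℤ)) (n : ℤ), z i * (L i j - lam * B i j) =
        (if i = j - 1 then zt (j - 1) else 0) + (if i = j + 1 then zt (j + 1) else 0)
        + (if i = j then -(2 + lam) * zt j else 0) + (if i = (n:ℤ) then z n * L n j else 0)
        + (if i = -(n:ℤ) then z (-(n:ℤ)) * L (-(n:ℤ)) j else 0) := by
      intro i hi
      rw [Finset.mem_Icc] at hi
      have q1 : (if i = j - 1 then zt (j - 1) else 0) = if i = j - 1 then zt i else 0 := by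
        split_ifs with h
        · rw [h]
        · rfl
      have q2 : (if i = j + 1 then zt (j + 1) else 0) = if i = j + 1 then zt i else 0 := by
        split_ifs with h
        · rw [h]
        · rfl
      have q3 : (if i = j then -(2 + lam) * zt j else 0) =
          if i = j then -(2 + lam) * zt i else 0 := by
        split_ifs with h
        · rw [h]
        · rfl
      rw [q1, q2, q3, hzt i, hB]
      by_cases hin : |i| ≤ (n:ℤ) - 1
      · have := abs_le.mp hin
        rw [hLmid i j hin, if_neg (by omega : ¬ i = (n:ℤ)), if_neg (by omega : ¬ i = -(n:ℤ))]
        simp only [hin, and_true, if_true]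
        rcases (by omega : i = j ∨ i = j - 1 ∨ i = j + 1 ∨ (i ≠ j ∧ i ≠ j - 1 ∧ i ≠ j + 1))
          with h | h | h | h
        · rw [if_pos h.symm, if_pos h, if_neg (by omega), if_neg (by omega), if_pos h]; ring
        · rw [if_neg (by omega), if_pos (by omega), if_neg (by omega), if_pos h,
            if_neg (by omega), if_neg (by omega)]; ring
        · rw [if_neg (by omega), if_pos (by omega), if_neg (by omega), if_neg (by omega),
            if_pos h, if_neg (by omega)]; ring
        · rw [if_neg (by omega), if_neg (by omega), if_neg (by omega), if_neg (by omega),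
            if_neg (by omega), if_neg (by omega)]; ring
      · have hin' := hin
        rw [abs_le] at hin'
        simp only [hin, and_false, if_false]
        rcases (by omega : i = (n:ℤ) ∨ i = -(n:ℤ)) with h | h
        · rw [if_pos h, if_neg (by omega : ¬ i = -(n:ℤ)), h]; simp
        · rw [if_pos h, if_neg (by omega : ¬ i = (n:ℤ)), h]; simp
    rw [Finset.sum_congr rfl hterm]
    simp only [Finset.sum_add_distrib, Finset.sum_ite_eq', Finset.mem_Icc]
    rw [if_pos (by omega : -(n:ℤ) ≤ j ∧ j ≤ n), if_pos (by omega : -(n:ℤ) ≤ n ∧ (n:ℤ) ≤ n),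
      if_pos (by omega : -(n:ℤ) ≤ -n ∧ -(n:ℤ) ≤ n)]
    have r1 : (if -(n:ℤ) ≤ j - 1 ∧ j - 1 ≤ n then zt (j - 1) else 0) = zt (j - 1) := by
      split_ifs with h
      · rfl
      · rw [hzt, if_neg]; rw [abs_le]; omega
    have r2 : (if -(n:ℤ) ≤ j + 1 ∧ j + 1 ≤ n then zt (j + 1) else 0) = zt (j + 1) := by
      split_ifs with h
      · rfl
      · rw [hzt, if_neg]; rw [abs_le]; omega
    rw [r1, r2]; ring
  rw [key, hLtop, hLbot, hzmn']
  by_cases h0 : 0 ≤ j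
  · have h := main j h0 hj'.2
    by_cases hc1 : (n:ℤ) - 2 * a ≤ j
    · rw [if_pos hc1] at h
      rw [if_pos ⟨hc1, hj'.2⟩, if_neg (by omega : ¬ ((n:ℤ) - 2 * a ≤ -j ∧ -j ≤ n))]
      linear_combination h
    · rw [if_neg hc1] at h
      rw [if_neg (by omega), if_neg (by omega : ¬ ((n:ℤ) - 2 * a ≤ -j ∧ -j ≤ n))]
      linear_combination h
  · have h := main (-j) (by omega) (by omega)
    rw [(by ring : -j - 1 = -(j + 1)), (by ring : -j + 1 = -(j - 1)), ztodd, ztodd, ztodd] at h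
    by_cases hc1 : (n:ℤ) - 2 * a ≤ -j
    · rw [if_pos hc1] at h
      rw [if_neg (by omega : ¬ ((n:ℤ) - 2 * a ≤ j ∧ j ≤ n)), if_pos (by omega : ((n:ℤ) - 2 * a ≤ -j ∧ -j ≤ n))]
      linear_combination -h
    · rw [if_neg hc1] at h
      rw [if_neg (by omega : ¬ ((n:ℤ) - 2 * a ≤ j ∧ j ≤ n)), if_neg (by omega : ¬ ((n:ℤ) - 2 * a ≤ -j ∧ -j ≤ n))]
      linear_combination -h
end

section
/- Let k = m + 2(n−a−1) with m odd, 1 ≤ m ≤ 2a (so k is odd), and assume sin[(n−a)·l_k·π/(2a+1)] ≠ 0. For p = 0, …, a define w_p = (−1)^{⌈(m−2)/2⌉}·[cos(l_k·π/(2(2a+1))) − cos((2p+1)·l_k·π/(2(2a+1)))]·(2a+1)^{1/2}/sin[(n−a)·l_k·π/(2a+1)]. Define z ∈ ℝ^{2n+1} by: z_j = 0 for 0 ≤ |j| ≤ n−2a; z_j = sgn(j)·w_{|j|−n+2a} for n−2a < |j| ≤ n−a; z_j = sgn(j)·w_{n−|j|} for n−a < |j| ≤ n−1; and z_{n} = z_{n−1},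 z_{−n} = z_{−(n−1)}. Then z^T·(𝓛 − λ_k·B) = 0. -/
open Real

/-- left eigenvector for odd `k = m + 2(n−a−1)`, `m` odd, `1 ≤ m ≤ 2a`
(with nonzero denominator `sin[(n−a) l_k π/(2a+1)]`), supported on the action regions,
satisfies `z^T (𝓛 − λ_k B) = 0`. -/
theorem stmt_12 (n a : ℕ) (ha : 1 ≤ a) (han : a < n) (h3a : 3 * a ≤ n)
    (ℓ : ℝ) (hℓ0 : 0 < ℓ) (hℓπ : ℓ < π)
    (B L : ℤ → ℤ → ℝ)
    (hB : ∀ i j : ℤ, B i j = if i = j ∧ |i| ≤ (n : ℤ) - 1 then 1 else 0)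
    (hLmid : ∀ i j : ℤ, |i| ≤ (n : ℤ) - 1 →
      L i j = if j = i then -2 else if j = i - 1 ∨ j = i + 1 then 1 else 0)
    (hLtop : ∀ j : ℤ, L (n : ℤ) j =
      (if (n : ℤ) - 2 * a ≤ j ∧ j ≤ (n : ℤ) then (-1 : ℝ) else 0) +
      (if |j| ≤ (a : ℤ) then Real.cos ℓ else 0))
    (hLbot : ∀ j : ℤ, L (-(n : ℤ)) j =
      (if (n : ℤ) - 2 * a ≤ -j ∧ -j ≤ (n : ℤ) then (-1 : ℝ) else 0) +
      (if |j| ≤ (a : ℤ) then Real.cos ℓ else 0))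
    (m : ℕ) (hm1 : 1 ≤ m) (hm2 : m ≤ 2 * a) (hmo : Odd m)
    (k : ℕ) (hkm : k = m + 2 * (n - a - 1))
    (lk : ℝ) (hlk : lk = 2 * (⌈(m : ℝ) / 2⌉ : ℤ))
    (lam : ℝ) (hlam : lam = -2 * (1 - Real.cos (π * lk / (2 * (a : ℝ) + 1))))
    (hsin : Real.sin (((n : ℝ) - a) * lk * π / (2 * (a : ℝ) + 1)) ≠ 0)
    (w : ℤ → ℝ)
    (hw : ∀ p : ℤ, 0 ≤ p → p ≤ (a : ℤ) →
      w p = (-1 : ℝ) ^ (⌈((m : ℝ) - 2) / 2⌉ : ℤ) *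
        (Real.cos (lk * π / (2 * (2 * (a : ℝ) + 1))) -
          Real.cos ((2 * (p : ℝ) + 1) * lk * π / (2 * (2 * (a : ℝ) + 1)))) *
        Real.sqrt (2 * (a : ℝ) + 1) /
        Real.sin (((n : ℝ) - a) * lk * π / (2 * (a : ℝ) + 1)))
    (z : ℤ → ℝ)
    (hz1 : ∀ j : ℤ, |j| ≤ (n : ℤ) - 2 * a → z j = 0)
    (hz2 : ∀ j : ℤ, (n : ℤ) - 2 * a < |j| → |j| ≤ (n : ℤ) - a →
      z j = (j.sign : ℝ) * w (|j| - n + 2 * a))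
    (hz3 : ∀ j : ℤ, (n : ℤ) - a < |j| → |j| ≤ (n : ℤ) - 1 →
      z j = (j.sign : ℝ) * w ((n : ℤ) - |j|))
    (hzn : z (n : ℤ) = z ((n : ℤ) - 1))
    (hzmn : z (-(n : ℤ)) = z (-((n : ℤ) - 1))) :
    ∀ j : ℤ, |j| ≤ (n : ℤ) →
      ∑ i ∈ Finset.Icc (-(n : ℤ)) (n : ℤ), z i * (L i j - lam * B i j) = 0 := by
  have hnR : (0:ℝ) < 2 * (a:ℝ) + 1 := by positivity
  have hq : ∃ q : ℤ, lk = 2 * (q : ℝ) := ⟨_, hlk⟩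
  obtain ⟨q, hq⟩ := hq
  obtain ⟨θ, hθ⟩ : ∃ θ : ℝ, θ = lk * π / (2 * (a:ℝ) + 1) := ⟨_, rfl⟩
  have hθq : (2 * (a:ℝ) + 1) * θ = q * (2 * π) := by
    rw [hθ, hq]; field_simp
  have hlam2 : -2 - lam = -2 * Real.cos θ := by
    rw [hlam, hθ, mul_comm π lk]; ring
  obtain ⟨C, hC⟩ : ∃ C : ℝ, ∀ p : ℤ, 0 ≤ p → p ≤ (a:ℤ) →
      w p = C * (Real.cos (θ / 2) - Real.cos ((2 * (p:ℝ) + 1) * (θ / 2))) := by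
    refine ⟨(-1 : ℝ) ^ (⌈((m : ℝ) - 2) / 2⌉ : ℤ) * Real.sqrt (2 * (a : ℝ) + 1) /
        Real.sin (((n : ℝ) - a) * lk * π / (2 * (a : ℝ) + 1)), ?_⟩
    intro p h0 h1
    rw [hw p h0 h1]
    have e1 : lk * π / (2 * (2 * (a : ℝ) + 1)) = θ / 2 := by rw [hθ]; field_simp
    have e2 : (2 * (p : ℝ) + 1) * lk * π / (2 * (2 * (a : ℝ) + 1))
        = (2 * (p:ℝ) + 1) * (θ / 2) := by rw [hθ]; field_simp
    rw [e1, e2]; ring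
  clear hw hsin hlam hlk hθ hkm
  obtain ⟨f, hf⟩ : ∃ f : ℤ → ℝ, ∀ j : ℤ, f j = C * (Real.cos (θ / 2) -
      Real.cos ((2 * ((j:ℝ) - n + 2 * a) + 1) * (θ / 2))) := ⟨_, fun _ => rfl⟩
  have hfsym : ∀ j : ℤ, f j = C * (Real.cos (θ / 2) -
      Real.cos ((2 * ((n:ℝ) - j) + 1) * (θ / 2))) := by
    intro j
    rw [hf]
    have : (2 * ((j:ℝ) - n + 2 * a) + 1) * (θ / 2)
        = q * (2 * π) - (2 * ((n:ℝ) - j) + 1) * (θ / 2) := by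
      rw [← hθq]; ring
    rw [this, Real.cos_int_mul_two_pi_sub]
  have hfn : f n = 0 := by
    rw [hfsym]; simp
  have hf0 : f ((n:ℤ) - 2 * a) = 0 := by
    rw [hf]; push_cast
    have : (2 * ((n:ℝ) - 2 * a - n + 2 * a) + 1) * (θ / 2) = θ / 2 := by ring
    rw [this]; ring
  have hfm : f ((n:ℤ) - 2 * a - 1) = 0 := by
    rw [hf]; push_cast
    have : (2 * ((n:ℝ) - 2 * a - 1 - n + 2 * a) + 1) * (θ / 2) = -(θ / 2) := by ring
    rw [this, Real.cos_neg]; ring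
  have hrec : ∀ j : ℤ, f (j + 1) + f (j - 1) + (-2 * Real.cos θ) * f j = f ((n:ℤ) - 1) := by
    intro j
    rw [hfsym ((n:ℤ) - 1), hf, hf, hf]; push_cast
    obtain ⟨x, hx⟩ : ∃ x : ℝ, x = (2 * ((j:ℝ) - n + 2 * a) + 1) * (θ / 2) := ⟨_, rfl⟩
    have e1 : (2 * ((j:ℝ) + 1 - n + 2 * a) + 1) * (θ / 2) = x + θ := by rw [hx]; ring
    have e2 : (2 * ((j:ℝ) - 1 - n + 2 * a) + 1) * (θ / 2) = x - θ := by rw [hx]; ring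
    have e3 : (2 * ((n:ℝ) - ((n:ℝ) - 1)) + 1) * (θ / 2) = θ + θ / 2 := by ring
    have e4 : Real.cos (θ / 2) = Real.cos (θ - θ / 2) := by congr 1; ring
    have e5 : Real.cos (θ + θ / 2) = 2 * Real.cos θ * Real.cos (θ / 2) - Real.cos (θ / 2) := by
      have := Real.cos_sub θ (θ / 2)
      rw [← e4] at this
      rw [Real.cos_add]; linarith
    rw [e1, e2, e3, e5, ← hx, Real.cos_add, Real.cos_sub]; ring
  have hzf : ∀ j : ℤ, (n:ℤ) - 2 * a ≤ j → j ≤ (n:ℤ) - 1 → z j = f j := by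
    intro j h1 h2
    have hj : 0 < j := by omega
    have habs : |j| = j := abs_of_pos hj
    have hsg : ((j.sign : ℤ) : ℝ) = 1 := by rw [Int.sign_eq_one_of_pos hj]; simp
    rcases eq_or_lt_of_le h1 with h | h
    · rw [hz1 j (by omega), ← h, hf0]
    · rcases le_or_gt j ((n:ℤ) - a) with h' | h'
      · rw [hz2 j (by omega) (by omega), hsg, habs, hC _ (by omega) (by omega), hf]
        push_cast; ring
      · rw [hz3 j (by omega) (by omega), hsg, habs, hC _ (by omega) (by omega), hfsym]
        push_cast; ring
  have hzodd : ∀ j : ℤ, |j| ≤ (n:ℤ) - 1 → z (-j) = - z j := by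
    intro j h2
    have hsg : (((-j).sign : ℤ) : ℝ) = - ((j.sign : ℤ) : ℝ) := by
      rw [Int.sign_neg]; push_cast; ring
    rcases le_or_gt (|j|) ((n:ℤ) - 2 * a) with h | h
    · rw [hz1 j h, hz1 (-j) (by rw [abs_neg]; exact h)]; simp
    · rcases le_or_gt (|j|) ((n:ℤ) - a) with h' | h'
      · rw [hz2 j h h', hz2 (-j) (by rw [abs_neg]; exact h) (by rw [abs_neg]; exact h'), hsg,
          abs_neg]; ring
      · rw [hz3 j h' h2, hz3 (-j) (by rw [abs_neg]; exact h') (by rw [abs_neg]; exact h2), hsg,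
          abs_neg]; ring
  have hn1 : |(n:ℤ) - 1| ≤ (n:ℤ) - 1 := by rw [abs_of_nonneg (by omega)]
  have hzn' : z n = f ((n:ℤ) - 1) := by rw [hzn, hzf _ (by omega) le_rfl]
  have hzmn' : z (-(n:ℤ)) = - f ((n:ℤ) - 1) := by rw [hzmn, hzodd _ hn1, ← hzn, hzn']
  obtain ⟨g, hg⟩ : ∃ g : ℤ → ℝ, ∀ j, g j = if |j| ≤ (n:ℤ) - 1 then z j else 0 :=
    ⟨_, fun _ => rfl⟩
  have hgodd : ∀ j, g (-j) = - g j := by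
    intro j
    rw [hg, hg, abs_neg]
    split_ifs with h
    · exact hzodd j h
    · simp
  have hgout : ∀ j : ℤ, ¬ (-(n:ℤ) ≤ j ∧ j ≤ n) → g j = 0 := by
    intro j h
    rw [hg, if_neg]
    rw [abs_le]; omega
  have hgf : ∀ j : ℤ, (n:ℤ) - 2 * a - 1 ≤ j → j ≤ (n:ℤ) → g j = f j := by
    intro j h1 h2
    have habs : |j| = j := abs_of_nonneg (by omega)
    rw [hg, habs]
    split_ifs with h
    · rcases eq_or_lt_of_le h1 with h' | h'
      · rw [hz1 j (by omega), ← h', hfm]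
      · exact hzf j (by omega) h
    · have : j = n := by omega
      rw [this, hfn]
  have hg0 : ∀ j : ℤ, |j| ≤ (n:ℤ) - 2 * a → g j = 0 := by
    intro j h
    rw [hg, hz1 j h]; simp
  have hmain : ∀ j : ℤ, |j| ≤ (n:ℤ) →
      ∑ i ∈ Finset.Icc (-(n : ℤ)) (n : ℤ), z i * (L i j - lam * B i j)
      = g (j + 1) + g (j - 1) + (-2 * Real.cos θ) * g j
        + f ((n:ℤ) - 1) * (L n j - L (-(n:ℤ)) j) := by
    intro j hj
    rw [abs_le] at hj
    have hterm : ∀ i ∈ Finset.Icc (-(n : ℤ)) (n : ℤ), z i * (L i j - lam * B i j)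
        = (if i = j + 1 then g i else 0) + (if i = j - 1 then g i else 0)
          + (if i = j then (-2 * Real.cos θ) * g i else 0)
          + (if i = (n:ℤ) then f ((n:ℤ) - 1) * L n j else 0)
          + (if i = -(n:ℤ) then - f ((n:ℤ) - 1) * L (-(n:ℤ)) j else 0) := by
      intro i hi
      rw [Finset.mem_Icc] at hi
      by_cases h1 : i = n
      · have h2 : ¬ (|i| ≤ (n:ℤ) - 1) := by rw [abs_le]; omega
        rw [hg i, hB, if_neg h2, if_neg (fun h => h2 h.2), if_pos h1,
          if_neg (by omega : ¬ i = -(n:ℤ)), h1, hzn']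
        simp
      by_cases h1' : i = -(n:ℤ)
      · have h2 : ¬ (|i| ≤ (n:ℤ) - 1) := by rw [abs_le]; omega
        rw [hg i, hB, if_neg h2, if_neg (fun h => h2 h.2), if_neg h1, if_pos h1', h1', hzmn']
        simp
      have h2 : |i| ≤ (n:ℤ) - 1 := by rw [abs_le]; omega
      rw [hg i, hB, hLmid i j h2, if_neg h1, if_neg h1', if_pos h2, ← hlam2]
      by_cases c1 : i = j
      · subst c1
        have d1 : ¬ (i = i - 1) := by omega
        simp [h2, d1]; ring
      · by_cases c2 : i = j + 1
        · have d1 : ¬ (j + 1 = j - 1) := by omega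
          subst c2
          simp [d1]
        · by_cases c3 : i = j - 1
          · have d1 : ¬ (j - 1 = j + 1) := by omega
            have d2 : ¬ (j = j - 1) := by omega
            subst c3
            simp [d1, d2]
          · have c4 : ¬ (j = i - 1 ∨ j = i + 1) := by omega
            simp [c1, c2, c3, c4, Ne.symm c1]
    rw [Finset.sum_congr rfl hterm]
    simp only [Finset.sum_add_distrib, Finset.sum_ite_eq', Finset.mem_Icc]
    have k1 : (if -(n:ℤ) ≤ j + 1 ∧ j + 1 ≤ n then g (j + 1) else 0) = g (j + 1) := by
      split_ifs with h
      · rfl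
      · exact (hgout _ h).symm
    have k2 : (if -(n:ℤ) ≤ j - 1 ∧ j - 1 ≤ n then g (j - 1) else 0) = g (j - 1) := by
      split_ifs with h
      · rfl
      · exact (hgout _ h).symm
    rw [k1, k2, if_pos hj, if_pos (by omega), if_pos (by omega)]
    ring
  have hpos : ∀ j : ℤ, 0 ≤ j → j ≤ (n:ℤ) →
      g (j + 1) + g (j - 1) + (-2 * Real.cos θ) * g j
        + f ((n:ℤ) - 1) * (L n j - L (-(n:ℤ)) j) = 0 := by
    intro j h0 h1
    rw [hLtop, hLbot, if_neg (by omega : ¬ ((n : ℤ) - 2 * a ≤ -j ∧ -j ≤ (n : ℤ)))]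
    by_cases c : (n:ℤ) - 2 * a ≤ j
    · rw [if_pos ⟨c, h1⟩, hgf (j - 1) (by omega) (by omega), hgf j (by omega) h1]
      rcases eq_or_lt_of_le h1 with h | h
      · subst h
        rw [hgout _ (by omega), hfn]; ring
      · rw [hgf (j + 1) (by omega) (by omega), ← hrec j]; ring
    · rw [if_neg (by omega), hg0 (j + 1) (by rw [abs_le]; omega),
        hg0 (j - 1) (by rw [abs_le]; omega), hg0 j (by rw [abs_le]; omega)]
      ring
  intro j hj
  rw [hmain j hj]
  rw [abs_le] at hj
  rcases le_or_gt 0 j with h | h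
  · exact hpos j h hj.2
  · have := hpos (-j) (by omega) (by omega)
    have t1 : L n (-j) = L (-(n:ℤ)) j := by rw [hLtop, hLbot, abs_neg]
    have t2 : L (-(n:ℤ)) (-j) = L n j := by rw [hLtop, hLbot, abs_neg, neg_neg]
    have t3 : g (-j + 1) = - g (j - 1) := by rw [← hgodd]; congr 1; ring
    have t4 : g (-j - 1) = - g (j + 1) := by rw [← hgodd]; congr 1; ring
    rw [t1, t2, t3, t4, hgodd] at this
    linarith
end

section
/- Let k = m + 2(n−a−1) with m even, 1 ≤ m ≤ 2a (so k is even), and assume cos[(n−a)·l_k·π/(2a+1)] − cos ℓ ≠ 0. For p = 0, …, a define w_p = (−1)^{⌈(m−2)/2⌉}·[cos(l_k·π/(2(2a+1))) − cos((2p+1)·l_k·π/(2(2a+1)))]·(2a+1)^{1/2}/(cos[(n−a)·l_k·π/(2a+1)] − cos ℓ). Define z ∈ ℝ^{2n+1} by: z_j = −2·cos ℓ·w_{a−|j|} for 0 ≤ |j| ≤ a; z_j = 0 for a < |j| ≤ n−2a; z_j = w_{|j|−n+2a} for n−2a < |j| ≤ n−a; z_j = w_{n−|j|} for n−a < |j|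 ≤ n−1; and z_{n} = z_{n−1}, z_{−n} = z_{−(n−1)}. Then z^T·(𝓛 − λ_k·B) = 0. -/
open Real

/-- The profile, extended by zero outside `[0, 2a]`. -/
noncomputable def prof (a : ℕ) (C x : ℝ) (p : ℤ) : ℝ :=
  if 0 ≤ p ∧ p ≤ 2 * (a : ℤ) then C * (Real.cos x - Real.cos ((2 * (p : ℝ) + 1) * x)) else 0

theorem prof_out (a : ℕ) (C x : ℝ) (p : ℤ) (h : p ≤ 0 ∨ 2 * (a : ℤ) < p) : prof a C x p = 0 := by
  unfold prof
  split_ifs with h'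
  · have : p = 0 := by omega
    subst this
    simp
  · rfl

theorem cos_refl (a : ℕ) (x : ℝ) (r : ℤ) (hx : (2 * (a : ℝ) + 1) * x = r * π) (p : ℝ) :
    Real.cos ((2 * (2 * (a : ℝ) - p) + 1) * x) = Real.cos ((2 * p + 1) * x) := by
  have : (2 * (2 * (a : ℝ) - p) + 1) * x = r * (2 * π) - (2 * p + 1) * x := by
    linear_combination 2 * hx
  rw [this, Real.cos_int_mul_two_pi_sub]

theorem prof_symm (a : ℕ) (C x : ℝ) (r : ℤ) (hx : (2 * (a : ℝ) + 1) * x = r * π) (p q : ℤ)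
    (h : p + q = 2 * a) : prof a C x p = prof a C x q := by
  have hp : p = 2 * a - q := by omega
  subst hp
  unfold prof
  by_cases h : 0 ≤ q ∧ q ≤ 2 * (a : ℤ)
  · rw [if_pos h, if_pos (by omega)]
    push_cast
    rw [cos_refl a x r hx]
  · rw [if_neg h, if_neg (by omega)]

theorem prof_ext (a : ℕ) (C x : ℝ) (r : ℤ) (hx : (2 * (a : ℝ) + 1) * x = r * π) (p : ℤ)
    (h0 : -1 ≤ p) (h1 : p ≤ 2 * a + 1) :
    prof a C x p = C * (Real.cos x - Real.cos ((2 * (p : ℝ) + 1) * x)) := by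
  have key : ∀ q : ℤ, -1 ≤ q → q ≤ 0 →
      prof a C x q = C * (Real.cos x - Real.cos ((2 * (q : ℝ) + 1) * x)) := by
    intro q h2 h3
    rw [prof_out _ _ _ _ (Or.inl h3)]
    have : q = -1 ∨ q = 0 := by omega
    rcases this with rfl | rfl
    · have : (2 * ((-1 : ℤ) : ℝ) + 1) * x = -x := by push_cast; ring
      rw [this, Real.cos_neg]; ring
    · simp
  by_cases h : p ≤ 0
  · exact key p h0 h
  by_cases h' : p ≤ 2 * a
  · unfold prof
    rw [if_pos (by omega)]
  · rw [prof_symm a C x r hx p (2 * a - p) (by omega), key _ (by omega) (by omega)]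
    push_cast
    rw [cos_refl a x r hx]

theorem prof_diff (a : ℕ) (ha : 1 ≤ a) (C x : ℝ) (r : ℤ) (hx : (2 * (a : ℝ) + 1) * x = r * π)
    (p : ℤ) :
    prof a C x (p - 1) + prof a C x (p + 1) - 2 * Real.cos (2 * x) * prof a C x p =
      if 0 ≤ p ∧ p ≤ 2 * (a : ℤ) then prof a C x 1 else 0 := by
  split_ifs with h
  · rw [prof_ext a C x r hx (p - 1) (by omega) (by omega),
      prof_ext a C x r hx (p + 1) (by omega) (by omega),
      prof_ext a C x r hx p (by omega) (by omega),
      prof_ext a C x r hx 1 (by omega) (by omega)]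
    have e1 : (2 * ((p - 1 : ℤ) : ℝ) + 1) * x = (2 * (p : ℝ) + 1) * x - 2 * x := by
      push_cast; ring
    have e2 : (2 * ((p + 1 : ℤ) : ℝ) + 1) * x = (2 * (p : ℝ) + 1) * x + 2 * x := by
      push_cast; ring
    have e3 : (2 * ((1 : ℤ) : ℝ) + 1) * x = 3 * x := by push_cast; ring
    rw [e1, e2, e3, Real.cos_sub, Real.cos_add, Real.cos_three_mul, Real.cos_two_mul]
    ring
  · have : p < 0 ∨ 2 * (a : ℤ) < p := by omega
    rcases this with h | h
    · rw [prof_out _ _ _ _ (Or.inl (by omega)), prof_out _ _ _ _ (Or.inl (by omega)),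
        prof_out _ _ _ _ (Or.inl (by omega))]
      ring
    · rw [prof_symm a C x r hx (p - 1) (2 * a - (p - 1)) (by omega),
        prof_out _ _ _ _ (Or.inl (by omega)), prof_out _ _ _ _ (Or.inr (by omega)),
        prof_out _ _ _ _ (Or.inr (by omega))]
      ring

theorem tri_sum (n : ℕ) (f : ℤ → ℝ) (c : ℝ) (hf : ∀ i : ℤ, (n : ℤ) < |i| → f i = 0) (j : ℤ) :
    ∑ i ∈ Finset.Icc (-(n : ℤ)) (n : ℤ), f i *
      ((if i = j then c else 0) + (if i = j - 1 then 1 else 0) + (if i = j + 1 then 1 else 0)) =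
      f (j - 1) + f (j + 1) + c * f j := by
  have hout : ∀ i : ℤ, i ∉ Finset.Icc (-(n : ℤ)) (n : ℤ) → f i = 0 := by
    intro i hi
    apply hf
    rw [Finset.mem_Icc] at hi
    by_contra h
    exact hi (abs_le.mp (not_lt.mp h))
  have one : ∀ (t : ℤ) (d : ℝ), ∑ i ∈ Finset.Icc (-(n : ℤ)) (n : ℤ),
      f i * (if i = t then d else 0) = d * f t := by
    intro t d
    simp only [mul_ite, mul_zero, Finset.sum_ite_eq']
    split_ifs with h
    · ring
    · rw [hout t h]; ring
  simp only [mul_add, Finset.sum_add_distrib, one]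
  ring


/-- left eigenvector for even `k = m + 2(n−a−1)`, `m` even, `1 ≤ m ≤ 2a`
(with nonzero denominator `cos[(n−a) l_k π/(2a+1)] − cos ℓ`), supported on the action
regions and the core, satisfies `z^T (𝓛 − λ_k B) = 0`. -/
theorem stmt_13 (n a : ℕ) (ha : 1 ≤ a) (han : a < n) (h3a : 3 * a ≤ n)
    (ℓ : ℝ) (hℓ0 : 0 < ℓ) (hℓπ : ℓ < π)
    (B L : ℤ → ℤ → ℝ)
    (hB : ∀ i j : ℤ, B i j = if i = j ∧ |i| ≤ (n : ℤ) - 1 then 1 else 0)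
    (hLmid : ∀ i j : ℤ, |i| ≤ (n : ℤ) - 1 →
      L i j = if j = i then -2 else if j = i - 1 ∨ j = i + 1 then 1 else 0)
    (hLtop : ∀ j : ℤ, L (n : ℤ) j =
      (if (n : ℤ) - 2 * a ≤ j ∧ j ≤ (n : ℤ) then (-1 : ℝ) else 0) +
      (if |j| ≤ (a : ℤ) then Real.cos ℓ else 0))
    (hLbot : ∀ j : ℤ, L (-(n : ℤ)) j =
      (if (n : ℤ) - 2 * a ≤ -j ∧ -j ≤ (n : ℤ) then (-1 : ℝ) else 0) +
      (if |j| ≤ (a : ℤ) then Real.cos ℓ else 0))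
    (m : ℕ) (hm1 : 1 ≤ m) (hm2 : m ≤ 2 * a) (hme : Even m)
    (k : ℕ) (hkm : k = m + 2 * (n - a - 1))
    (lk : ℝ) (hlk : lk = 2 * (⌈(m : ℝ) / 2⌉ : ℤ))
    (lam : ℝ) (hlam : lam = -2 * (1 - Real.cos (π * lk / (2 * (a : ℝ) + 1))))
    (hcos : Real.cos (((n : ℝ) - a) * lk * π / (2 * (a : ℝ) + 1)) - Real.cos ℓ ≠ 0)
    (w : ℤ → ℝ)
    (hw : ∀ p : ℤ, 0 ≤ p → p ≤ (a : ℤ) →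
      w p = (-1 : ℝ) ^ (⌈((m : ℝ) - 2) / 2⌉ : ℤ) *
        (Real.cos (lk * π / (2 * (2 * (a : ℝ) + 1))) -
          Real.cos ((2 * (p : ℝ) + 1) * lk * π / (2 * (2 * (a : ℝ) + 1)))) *
        Real.sqrt (2 * (a : ℝ) + 1) /
        (Real.cos (((n : ℝ) - a) * lk * π / (2 * (a : ℝ) + 1)) - Real.cos ℓ))
    (z : ℤ → ℝ)
    (hz1 : ∀ j : ℤ, |j| ≤ (a : ℤ) → z j = -2 * Real.cos ℓ * w ((a : ℤ) - |j|))
    (hz2 : ∀ j : ℤ, (a : ℤ) < |j| → |j| ≤ (n : ℤ) - 2 * a → z j = 0)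
    (hz3 : ∀ j : ℤ, (n : ℤ) - 2 * a < |j| → |j| ≤ (n : ℤ) - a →
      z j = w (|j| - n + 2 * a))
    (hz4 : ∀ j : ℤ, (n : ℤ) - a < |j| → |j| ≤ (n : ℤ) - 1 → z j = w ((n : ℤ) - |j|))
    (hzn : z (n : ℤ) = z ((n : ℤ) - 1))
    (hzmn : z (-(n : ℤ)) = z (-((n : ℤ) - 1))) :
    ∀ j : ℤ, |j| ≤ (n : ℤ) →
      ∑ i ∈ Finset.Icc (-(n : ℤ)) (n : ℤ), z i * (L i j - lam * B i j) = 0 := by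
  intro j hj
  obtain ⟨r, hr⟩ := hme
  have hceil : (⌈(m : ℝ) / 2⌉ : ℤ) = r := by
    have : (m : ℝ) / 2 = ((r : ℤ) : ℝ) := by rw [hr]; push_cast; ring
    rw [this, Int.ceil_intCast]
  rw [hceil] at hlk
  have hapos : (0 : ℝ) < 2 * (a : ℝ) + 1 := by positivity
  obtain ⟨x, hxdef⟩ : ∃ x : ℝ, x = lk * π / (2 * (2 * (a : ℝ) + 1)) := ⟨_, rfl⟩
  have hx : (2 * (a : ℝ) + 1) * x = (r : ℤ) * π := by
    rw [hxdef, hlk]; field_simp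
  have hlam' : lam = 2 * Real.cos (2 * x) - 2 := by
    have : π * lk / (2 * (a : ℝ) + 1) = 2 * x := by rw [hxdef]; field_simp
    rw [hlam, this]; ring
  obtain ⟨C, hC⟩ : ∃ C : ℝ, C = (-1 : ℝ) ^ (⌈((m : ℝ) - 2) / 2⌉ : ℤ) *
      Real.sqrt (2 * (a : ℝ) + 1) /
        (Real.cos (((n : ℝ) - a) * lk * π / (2 * (a : ℝ) + 1)) - Real.cos ℓ) := ⟨_, rfl⟩
  have hwp : ∀ p : ℤ, 0 ≤ p → p ≤ (a : ℤ) → w p = prof a C x p := by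
    intro p h0 h1
    have : (2 * (p : ℝ) + 1) * lk * π / (2 * (2 * (a : ℝ) + 1)) = (2 * (p : ℝ) + 1) * x := by
      rw [hxdef]; ring
    rw [hw p h0 h1, prof, if_pos (by omega), this, ← hxdef, hC]
    ring
  obtain ⟨f, hfdef⟩ : ∃ f : ℤ → ℝ, ∀ i, f i = prof a C x (i - n + 2 * a) +
      prof a C x (-i - n + 2 * a) - 2 * Real.cos ℓ * prof a C x (i + a) := ⟨_, fun _ => rfl⟩
  have hf0 : ∀ i : ℤ, (n : ℤ) ≤ |i| → f i = 0 := by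
    intro i hi
    have ht : prof a C x (2 * a) = 0 := by
      rw [prof_symm a C x r hx (2 * a) 0 (by omega), prof_out _ _ _ _ (Or.inl le_rfl)]
    have hg : ∀ q : ℤ, q ≤ 0 ∨ 2 * (a : ℤ) ≤ q → prof a C x q = 0 := by
      intro q hq
      by_cases h : q = 2 * a
      · rw [h, ht]
      · exact prof_out _ _ _ _ (by omega)
    have hi' := le_abs'.mp hi
    rw [hfdef, hg _ (by omega), hg _ (by omega), hg _ (by omega)]
    ring
  have hzf : ∀ i : ℤ, |i| ≤ (n : ℤ) - 1 → z i = f i := by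
    intro i hi
    rw [hfdef]
    have hsym := fun p q h => prof_symm a C x r hx p q h
    have hle1 := le_abs_self i
    have hle2 := neg_le_abs i
    have habs : |i| = i ∨ |i| = -i := abs_choice i
    have ho := fun p h => prof_out a C x p h
    by_cases h1 : |i| ≤ (a : ℤ)
    · rw [hz1 i h1, hwp _ (by omega) (by have := abs_nonneg i; omega),
        ho (i - n + 2 * a) (by omega), ho (-i - n + 2 * a) (by omega)]
      rcases habs with h | h
      · rw [h, hsym (a - i) (i + a) (by omega)]; ring
      · rw [h, show (a : ℤ) - -i = i + a by ring]; ring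
    · have h3 : prof a C x (i + a) = 0 := by
        rcases habs with h | h
        · exact ho _ (by omega)
        · exact ho _ (by omega)
      rw [h3]
      by_cases h2 : |i| ≤ (n : ℤ) - 2 * a
      · rw [hz2 i (by omega) h2, ho (i - n + 2 * a) (by omega), ho (-i - n + 2 * a) (by omega)]
        ring
      · have h4 : z i = prof a C x (|i| - n + 2 * a) := by
          by_cases h5 : |i| ≤ (n : ℤ) - a
          · rw [hz3 i (by omega) h5, hwp _ (by omega) (by omega)]
          · rw [hz4 i (by omega) hi, hwp _ (by omega) (by omega)]
            exact hsym _ _ (by omega)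
        rw [h4]
        rcases habs with h | h
        · rw [h, ho (-i - n + 2 * a) (by omega)]; ring
        · rw [h, ho (i - n + 2 * a) (by omega)]; ring
  have hP1 : f ((n : ℤ) - 1) = prof a C x 1 := by
    rw [hfdef, prof_out a C x (-((n : ℤ) - 1) - n + 2 * a) (Or.inl (by omega)),
      prof_symm a C x r hx ((n : ℤ) - 1 - n + 2 * a) 1 (by omega)]
    have : prof a C x ((n : ℤ) - 1 + a) = 0 := by
      by_cases h : (n : ℤ) - 1 + a = 2 * a
      · rw [prof_symm a C x r hx _ 0 (by omega), prof_out _ _ _ _ (Or.inl le_rfl)]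
      · exact prof_out _ _ _ _ (Or.inr (by omega))
    rw [this]; ring
  have hP2 : f (-((n : ℤ) - 1)) = prof a C x 1 := by
    rw [hfdef, prof_out a C x (-((n : ℤ) - 1) - n + 2 * a) (Or.inl (by omega)),
      prof_symm a C x r hx (-(-((n : ℤ) - 1)) - n + 2 * a) 1 (by omega),
      prof_out a C x (-((n : ℤ) - 1) + a) (Or.inl (by omega))]
    ring
  rw [hzf ((n : ℤ) - 1) (by rw [abs_of_nonneg] <;> omega), hP1] at hzn
  rw [hzf (-((n : ℤ) - 1)) (by rw [abs_neg, abs_of_nonneg] <;> omega), hP2] at hzmn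
  have hterm : ∀ i ∈ Finset.Icc (-(n : ℤ)) (n : ℤ), z i * (L i j - lam * B i j) =
      f i * ((if i = j then -2 - lam else 0) + (if i = j - 1 then 1 else 0) +
        (if i = j + 1 then 1 else 0)) +
      ((if i = (n : ℤ) then prof a C x 1 * L n j else 0) +
       (if i = -(n : ℤ) then prof a C x 1 * L (-(n : ℤ)) j else 0)) := by
    intro i hi
    rw [Finset.mem_Icc] at hi
    by_cases h1 : i = n
    · have hne : ¬ ((n : ℤ) = -(n : ℤ)) := by omega
      subst h1
      rw [hf0 _ (le_abs_self _), hzn, hB, if_neg (by rw [abs_of_nonneg] <;> omega),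
        if_pos rfl, if_neg hne]
      ring
    by_cases h2 : i = -(n : ℤ)
    · subst h2
      rw [hf0 _ (by simp), hzmn, hB, if_neg (by rw [abs_neg, abs_of_nonneg] <;> omega),
        if_pos rfl, if_neg h1]
      ring
    have h3 : |i| ≤ (n : ℤ) - 1 := abs_le.mpr (by omega)
    rw [if_neg h1, if_neg h2, hzf i h3, hLmid i j h3, hB]
    by_cases h4 : i = j
    · rw [if_pos h4.symm, if_pos ⟨h4, h3⟩, if_pos h4, if_neg (by omega), if_neg (by omega)]
      ring
    have hnB : ¬ (i = j ∧ |i| ≤ (n : ℤ) - 1) := fun h => h4 h.1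
    rw [if_neg (Ne.symm h4), if_neg hnB, if_neg h4]
    by_cases h5 : i = j - 1
    · rw [if_pos (by omega), if_pos h5, if_neg (by omega)]; ring
    by_cases h6 : i = j + 1
    · rw [if_pos (by omega), if_neg h5, if_pos h6]; ring
    rw [if_neg (by omega), if_neg h5, if_neg h6]; ring
  rw [Finset.sum_congr rfl hterm, Finset.sum_add_distrib, Finset.sum_add_distrib,
    tri_sum n f _ (fun i hi => hf0 i hi.le), Finset.sum_ite_eq', Finset.sum_ite_eq',
    if_pos (Finset.mem_Icc.mpr (by omega)), if_pos (Finset.mem_Icc.mpr (by omega)),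
    hLtop, hLbot, hlam', hfdef, hfdef, hfdef]
  have d1 := prof_diff a ha C x r hx (j - n + 2 * a)
  have d2 := prof_diff a ha C x r hx (-j - n + 2 * a)
  have d3 := prof_diff a ha C x r hx (j + a)
  have hj' := abs_le.mp hj
  have c1 : (0 ≤ j - n + 2 * (a : ℤ) ∧ j - n + 2 * (a : ℤ) ≤ 2 * (a : ℤ)) ↔
      ((n : ℤ) - 2 * a ≤ j ∧ j ≤ (n : ℤ)) := by omega
  have c2 : (0 ≤ -j - n + 2 * (a : ℤ) ∧ -j - n + 2 * (a : ℤ) ≤ 2 * (a : ℤ)) ↔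
      ((n : ℤ) - 2 * a ≤ -j ∧ -j ≤ (n : ℤ)) := by omega
  have c3 : (0 ≤ j + (a : ℤ) ∧ j + (a : ℤ) ≤ 2 * (a : ℤ)) ↔ |j| ≤ (a : ℤ) := by
    rw [abs_le]; omega
  simp only [c1] at d1
  simp only [c2] at d2
  simp only [c3] at d3
  rw [show j - 1 - n + 2 * (a : ℤ) = j - n + 2 * a - 1 by ring,
    show j + 1 - n + 2 * (a : ℤ) = j - n + 2 * a + 1 by ring,
    show -(j - 1) - n + 2 * (a : ℤ) = -j - n + 2 * a + 1 by ring,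
    show -(j + 1) - n + 2 * (a : ℤ) = -j - n + 2 * a - 1 by ring,
    show j - 1 + (a : ℤ) = j + a - 1 by ring,
    show j + 1 + (a : ℤ) = j + a + 1 by ring]
  have e : ∀ (P : Prop) [Decidable P] (u v : ℝ), (if P then u else 0) = u * (if P then 1 else 0) := by
    intro P _ u v; split_ifs <;> ring
  have e1 : ∀ (P : Prop) [Decidable P] (u : ℝ), (if P then u else 0) = u * (if P then 1 else 0) :=
    fun P _ u => e P u 0
  rw [e1 _ (prof a C x 1)] at d1 d2 d3
  rw [e1 _ (-1 : ℝ), e1 _ (-1 : ℝ), e1 _ (Real.cos ℓ)]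
  linear_combination d1 + d2 - 2 * Real.cos ℓ * d3
end

section
/- Suppose vectors v_0, …, v_{2n−2}, z_0, …, z_{2n−2} ∈ ℝ^{2n+1} and real numbers λ_0, …, λ_{2n−2} satisfy (𝓛 − λ_k·B)·v_k = 0, z_k^T·(𝓛 − λ_k·B) = 0, and z_k^T·B·v_{k'} = δ_{k k'} for all k, k', and additionally Σ_{k=0}^{2n−2} v_k·z_k^T = B + A, where A is the (2n+1)×(2n+1) matrix with A_{j,n} = 𝓛_{j,n}, A_{j,−n} = 𝓛_{j,−n}, A_{n,j} = 𝓛_{n,j}, A_{−n,j} = 𝓛_{−n,j} for all |j| ≤ n, and all other entries zero. Let f : [0,∞) → ℝ^{2n+1} be continuous with f_j(t) = 0 for all |j| ≤ n−1 and all t ≥ 0, and let u_0 ∈ ℝ^{2n+1}. Define u(t) = Σ_{k=0}^{2n−2} e^{λ_k t}·v_k·z_k^T·B·u_0 + f(t) + Σ_{k=0}^{2n−2} v_k·z_k^T·∫_0^t e^{λ_k (t−t')}·f(t')·dt'. Then the map t ↦ B·u(t) is differentiable on [0,∞), with d/dt[B·u(t)] = 𝓛·u(t) + f(t) for every t ≥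 0, and B·u(0) = B·u_0. -/
open Real

theorem aux_int (c : ℝ) (f : ℝ → ℝ) (hf : ContinuousOn f (Set.Ici 0)) (t : ℝ) (ht : 0 ≤ t) :
    HasDerivWithinAt (fun s : ℝ => ∫ t' in (0:ℝ)..s, Real.exp (c * (s - t')) * f t')
      (c * (∫ t' in (0:ℝ)..t, Real.exp (c * (t - t')) * f t') + f t) (Set.Ici 0) t := by
  have hg : Continuous (fun x : ℝ => f (max x 0)) := by
    have hmax : Continuous (fun x : ℝ => max x 0) := continuous_id.max continuous_const
    exact hf.comp_continuous hmax (fun x => le_max_right x 0)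
  have hG : Continuous (fun x : ℝ => Real.exp (-(c * x)) * f (max x 0)) :=
    (by fun_prop : Continuous (fun x : ℝ => Real.exp (-(c * x)))).mul hg
  have key : ∀ s : ℝ, 0 ≤ s → ∫ t' in (0:ℝ)..s, Real.exp (c * (s - t')) * f t' =
      Real.exp (c * s) * ∫ t' in (0:ℝ)..s, Real.exp (-(c * t')) * f (max t' 0) := by
    intro s hs
    rw [← intervalIntegral.integral_const_mul]
    apply intervalIntegral.integral_congr
    intro x hx
    rw [Set.uIcc_of_le hs] at hx
    simp only
    rw [max_eq_left hx.1, ← mul_assoc, ← Real.exp_add]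
    congr 2
    ring
  have h1 : HasDerivAt (fun s : ℝ => ∫ t' in (0:ℝ)..s, Real.exp (-(c * t')) * f (max t' 0))
      (Real.exp (-(c * t)) * f (max t 0)) t :=
    intervalIntegral.integral_hasDerivAt_right (hG.intervalIntegrable _ _)
      (hG.stronglyMeasurableAtFilter _ _) hG.continuousAt
  have h2 : HasDerivAt (fun s : ℝ => Real.exp (c * s)) (Real.exp (c * t) * (c * 1)) t :=
    ((hasDerivAt_id t).const_mul c).exp
  have h3 := (h2.mul h1).hasDerivWithinAt (s := Set.Ici 0)
  refine (h3.congr_of_mem (fun s hs => key s hs) ht).congr_deriv ?_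
  rw [key t ht, max_eq_left ht, ← mul_assoc (Real.exp (c * t)) (Real.exp (-(c * t))),
    ← Real.exp_add]
  simp
  ring

/-- given the spectral data (eigenvectors, adjoint eigenvectors,
biorthonormality and completeness `Σ v_k z_k^T = B + A`) and a continuous forcing `f`
supported on the patch edges `±n`, the spectral formula `u(t)` solves
`d/dt [B u(t)] = 𝓛 u(t) + f(t)` on `[0,∞)` with `B u(0) = B u₀`. -/
theorem stmt_16 (n a : ℕ) (ha : 1 ≤ a) (han : a < n)
    (ℓ : ℝ) (hℓ0 : 0 < ℓ) (hℓπ : ℓ < π)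
    (B L A : ℤ → ℤ → ℝ)
    (hB : ∀ i j : ℤ, B i j = if i = j ∧ |i| ≤ (n : ℤ) - 1 then 1 else 0)
    (hLmid : ∀ i j : ℤ, |i| ≤ (n : ℤ) - 1 →
      L i j = if j = i then -2 else if j = i - 1 ∨ j = i + 1 then 1 else 0)
    (hLtop : ∀ j : ℤ, L (n : ℤ) j =
      (if (n : ℤ) - 2 * a ≤ j ∧ j ≤ (n : ℤ) then (-1 : ℝ) else 0) +
      (if |j| ≤ (a : ℤ) then Real.cos ℓ else 0))
    (hLbot : ∀ j : ℤ, L (-(n : ℤ)) j =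
      (if (n : ℤ) - 2 * a ≤ -j ∧ -j ≤ (n : ℤ) then (-1 : ℝ) else 0) +
      (if |j| ≤ (a : ℤ) then Real.cos ℓ else 0))
    (hA : ∀ i j : ℤ, A i j =
      if i = (n : ℤ) ∨ i = -(n : ℤ) ∨ j = (n : ℤ) ∨ j = -(n : ℤ) then L i j else 0)
    (v z : ℕ → ℤ → ℝ) (lam : ℕ → ℝ)
    (heig : ∀ k : ℕ, k ≤ 2 * n - 2 → ∀ i : ℤ, |i| ≤ (n : ℤ) →
      ∑ j ∈ Finset.Icc (-(n : ℤ)) (n : ℤ), (L i j - lam k * B i j) * v k j = 0)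
    (hadj : ∀ k : ℕ, k ≤ 2 * n - 2 → ∀ j : ℤ, |j| ≤ (n : ℤ) →
      ∑ i ∈ Finset.Icc (-(n : ℤ)) (n : ℤ), z k i * (L i j - lam k * B i j) = 0)
    (hbio : ∀ k k' : ℕ, k ≤ 2 * n - 2 → k' ≤ 2 * n - 2 →
      ∑ i ∈ Finset.Icc (-(n : ℤ)) (n : ℤ), ∑ j ∈ Finset.Icc (-(n : ℤ)) (n : ℤ),
        z k i * B i j * v k' j = if k = k' then 1 else 0)
    (hcomp : ∀ i j : ℤ, |i| ≤ (n : ℤ) → |j| ≤ (n : ℤ) →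
      ∑ k ∈ Finset.range (2 * n - 1), v k i * z k j = B i j + A i j)
    (f : ℝ → ℤ → ℝ)
    (hfc : ∀ j : ℤ, |j| ≤ (n : ℤ) → ContinuousOn (fun t => f t j) (Set.Ici 0))
    (hf0 : ∀ j : ℤ, |j| ≤ (n : ℤ) - 1 → ∀ t : ℝ, 0 ≤ t → f t j = 0)
    (u0 : ℤ → ℝ)
    (u : ℝ → ℤ → ℝ)
    (hu : ∀ t : ℝ, ∀ j : ℤ, u t j =
      (∑ k ∈ Finset.range (2 * n - 1), Real.exp (lam k * t) * v k j *
        (∑ i ∈ Finset.Icc (-(n : ℤ)) (n : ℤ), ∑ i' ∈ Finset.Icc (-(n : ℤ)) (n : ℤ),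
          z k i * B i i' * u0 i'))
      + f t j
      + ∑ k ∈ Finset.range (2 * n - 1), v k j *
          (∑ i ∈ Finset.Icc (-(n : ℤ)) (n : ℤ), z k i *
            ∫ t' in (0:ℝ)..t, Real.exp (lam k * (t - t')) * f t' i)) :
    (∀ j : ℤ, |j| ≤ (n : ℤ) → ∀ t ∈ Set.Ici (0 : ℝ),
      HasDerivWithinAt (fun s : ℝ => ∑ i ∈ Finset.Icc (-(n : ℤ)) (n : ℤ), B j i * u s i)
        ((∑ i ∈ Finset.Icc (-(n : ℤ)) (n : ℤ), L j i * u t i) + f t j)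
        (Set.Ici 0) t) ∧
    (∀ j : ℤ, |j| ≤ (n : ℤ) →
      ∑ i ∈ Finset.Icc (-(n : ℤ)) (n : ℤ), B j i * u 0 i =
      ∑ i ∈ Finset.Icc (-(n : ℤ)) (n : ℤ), B j i * u0 i) := by
  classical
  set S := Finset.Icc (-(n : ℤ)) (n : ℤ) with hS
  set R := Finset.range (2 * n - 1) with hR
  have memS : ∀ j : ℤ, j ∈ S ↔ |j| ≤ (n : ℤ) := by
    intro j
    rw [hS, Finset.mem_Icc, abs_le]
  -- action of B
  have hBmid : ∀ (j : ℤ) (w : ℤ → ℝ), |j| ≤ (n : ℤ) - 1 → ∑ i ∈ S, B j i * w i = w j := by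
    intro j w hj
    rw [Finset.sum_eq_single j]
    · simp [hB, hj]
    · intro i _ hij
      simp [hB, Ne.symm hij]
    · intro h
      exact absurd ((memS j).2 (by omega)) h
  have hBend : ∀ (j : ℤ) (w : ℤ → ℝ), ¬ |j| ≤ (n : ℤ) - 1 → ∑ i ∈ S, B j i * w i = 0 := by
    intro j w hj
    apply Finset.sum_eq_zero
    intro i _
    simp [hB, hj]
  have hends : ∀ j : ℤ, |j| ≤ (n : ℤ) → ¬ |j| ≤ (n : ℤ) - 1 → j = (n : ℤ) ∨ j = -(n : ℤ) := by
    intro j h1 h2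
    grind
  set c : ℕ → ℝ := fun k => ∑ i ∈ S, ∑ i' ∈ S, z k i * B i i' * u0 i' with hc
  set W : ℕ → ℝ → ℝ := fun k t => Real.exp (lam k * t) * c k +
    ∑ i ∈ S, z k i * ∫ t' in (0:ℝ)..t, Real.exp (lam k * (t - t')) * f t' i with hW
  have hu' : ∀ t j, u t j = ∑ k ∈ R, v k j * W k t + f t j := by
    intro t j
    rw [hu t j]
    have : ∑ k ∈ R, v k j * W k t = (∑ k ∈ R, Real.exp (lam k * t) * v k j * c k) +
      ∑ k ∈ R, v k j *
          (∑ i ∈ S, z k i * ∫ t' in (0:ℝ)..t, Real.exp (lam k * (t - t')) * f t' i) := by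
      rw [← Finset.sum_add_distrib]
      apply Finset.sum_congr rfl
      intro k _
      simp only [hW]
      ring
    rw [this]
    ring
  have hWd : ∀ k t, 0 ≤ t → HasDerivWithinAt (W k)
      (lam k * W k t + ∑ i ∈ S, z k i * f t i) (Set.Ici 0) t := by
    intro k t ht
    have h2 : HasDerivAt (fun s : ℝ => Real.exp (lam k * s))
        (Real.exp (lam k * t) * (lam k * 1)) t := ((hasDerivAt_id t).const_mul (lam k)).exp
    have h3 := (h2.mul_const (c k)).hasDerivWithinAt (s := Set.Ici 0)
    have h4 := HasDerivWithinAt.fun_sum (u := S) (fun i hi =>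
      (aux_int (lam k) (fun s => f s i) (hfc i ((memS i).1 hi)) t ht).const_mul (z k i))
    refine (h3.add h4).congr_deriv ?_
    simp only [hW, mul_add, Finset.sum_add_distrib, Finset.mul_sum]
    have : ∀ i ∈ S, z k i * (lam k * ∫ t' in (0:ℝ)..t, Real.exp (lam k * (t - t')) * f t' i) =
        lam k * (z k i * ∫ t' in (0:ℝ)..t, Real.exp (lam k * (t - t')) * f t' i) := by
      intro i _
      ring
    rw [Finset.sum_congr rfl this]
    ring
  have hLv : ∀ k ∈ R, ∀ j : ℤ, |j| ≤ (n : ℤ) →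
      ∑ i ∈ S, L j i * v k i = lam k * ∑ i ∈ S, B j i * v k i := by
    intro k hk j hj
    have hk' : k ≤ 2 * n - 2 := by
      have := Finset.mem_range.1 hk
      omega
    have h := heig k hk' j hj
    rw [Finset.mul_sum, ← sub_eq_zero, ← Finset.sum_sub_distrib, ← h]
    apply Finset.sum_congr rfl
    intro i _
    ring
  have hLu : ∀ t, ∀ j : ℤ, |j| ≤ (n : ℤ) → ∑ i ∈ S, L j i * u t i =
      ∑ k ∈ R, (lam k * ∑ i ∈ S, B j i * v k i) * W k t + ∑ i ∈ S, L j i * f t i := by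
    intro t j hj
    have : ∀ k ∈ R, (lam k * ∑ i ∈ S, B j i * v k i) * W k t =
        ∑ i ∈ S, L j i * (v k i * W k t) := by
      intro k hk
      rw [← hLv k hk j hj, Finset.sum_mul]
      exact Finset.sum_congr rfl (fun i _ => by ring)
    rw [Finset.sum_congr rfl this, Finset.sum_comm, ← Finset.sum_add_distrib]
    apply Finset.sum_congr rfl
    intro i _
    rw [hu' t i, mul_add, Finset.mul_sum]
  have hvz : ∀ (j : ℤ) (w : ℤ → ℝ), |j| ≤ (n : ℤ) →
      ∑ k ∈ R, v k j * ∑ i ∈ S, z k i * w i = ∑ i ∈ S, (B j i + A j i) * w i := by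
    intro j w hj
    simp only [Finset.mul_sum]
    rw [Finset.sum_comm]
    apply Finset.sum_congr rfl
    intro i hi
    rw [← hcomp j i hj ((memS i).1 hi), Finset.sum_mul]
    exact Finset.sum_congr rfl (fun k _ => by ring)
  refine ⟨?_, ?_⟩
  · intro j hj t ht
    have ht0 : (0:ℝ) ≤ t := ht
    rw [hLu t j hj]
    by_cases hm : |j| ≤ (n : ℤ) - 1
    · have hd := HasDerivWithinAt.fun_sum (u := R) (fun k _ =>
        (hWd k t ht0).const_mul (v k j))
      refine (hd.congr_of_mem (fun s hs => ?_) ht).congr_deriv ?_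
      · rw [hBmid j (u s) hm, hu' s j, hf0 j hm s hs, add_zero]
      · simp only [mul_add, Finset.sum_add_distrib]
        rw [hvz j (f t) hj, hf0 j hm t ht0, add_zero]
        congr 1
        · apply Finset.sum_congr rfl
          intro k _
          rw [hBmid j (v k) hm]
          ring
        · apply Finset.sum_congr rfl
          intro i hi
          by_cases hi' : |i| ≤ (n : ℤ) - 1
          · simp [hf0 i hi' t ht0]
          · have hne : ¬ (j = i) := by
              rintro rfl
              exact hi' hm
            have := hends i ((memS i).1 hi) hi'
            rw [hB, hA, if_neg (by tauto), if_pos (by tauto), zero_add]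
    · have hzero : (fun s : ℝ => ∑ i ∈ S, B j i * u s i) = fun _ => 0 := by
        funext s
        exact hBend j (u s) hm
      rw [hzero]
      refine (hasDerivWithinAt_const t (Set.Ici 0) (0:ℝ)).congr_deriv ?_
      have h1 : ∑ k ∈ R, (lam k * ∑ i ∈ S, B j i * v k i) * W k t = 0 := by
        apply Finset.sum_eq_zero
        intro k _
        rw [hBend j (v k) hm]
        ring
      have h2 : ∑ i ∈ S, L j i * f t i = - f t j := by
        have hend := hends j hj hm
        rw [Finset.sum_eq_single j]
        · have : L j j = -1 := by
            rcases hend with rfl | rfl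
            · rw [hLtop, if_pos (by omega), if_neg (by grind)]
              ring
            · rw [hLbot, if_pos (by omega), if_neg (by grind)]
              ring
          rw [this]
          ring
        · intro i hi hij
          by_cases hi' : |i| ≤ (n : ℤ) - 1
          · simp [hf0 i hi' t ht0]
          · have hiend := hends i ((memS i).1 hi) hi'
            have : L j i = 0 := by
              rcases hend with h | h
              · have hi2 : i = -(n : ℤ) := by omega
                rw [h, hi2, hLtop, if_neg (by omega), if_neg (by grind)]
                ring
              · have hi2 : i = (n : ℤ) := by omega
                rw [h, hi2, hLbot, if_neg (by omega), if_neg (by grind)]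
                ring
            rw [this, zero_mul]
        · intro h
          exact absurd ((memS j).2 hj) h
      rw [h1, h2]
      ring
  · intro j hj
    by_cases hm : |j| ≤ (n : ℤ) - 1
    · rw [hBmid j (u 0) hm, hu' 0 j, hf0 j hm 0 le_rfl, add_zero]
      have hW0 : ∀ k ∈ R, v k j * W k 0 =
          v k j * ∑ i ∈ S, z k i * ∑ i' ∈ S, B i i' * u0 i' := by
        intro k _
        simp only [hW, hc, intervalIntegral.integral_same, mul_zero, Real.exp_zero,
          Finset.sum_const_zero, add_zero, one_mul, Finset.mul_sum, mul_assoc]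
      rw [Finset.sum_congr rfl hW0, hvz j _ hj]
      apply Finset.sum_congr rfl
      intro i hi
      by_cases hi' : |i| ≤ (n : ℤ) - 1
      · rw [hBmid i u0 hi', hA, if_neg (by grind), add_zero]
      · have hne : ¬ (j = i) := by
          rintro rfl
          exact hi' hm
        rw [hBend i u0 hi', hB, if_neg (by tauto)]
        ring
    · rw [hBend j (u 0) hm, hBend j u0 hm]
end

section
/- Let Q ≥ 1 be an integer, λ a nonzero real number, δt > 0, and f : ℝ → ℝ a function that is Q times continuously differentiable on [0, δt]. Then ∫_0^{δt} f(t')·e^{λ(δt−t')} dt' = Σ_{q=1}^{Q} f^{(q−1)}(0)·λ^{−q}·( e^{λ·δt} − Σ_{p=0}^{q−1} (δt)^p·λ^p/p! ) + λ^{−Q}·∫_0^{δt} f^{(Q)}(t')·( e^{λ(δt−t')} − Σ_{p=0}^{Q−1} ((−1)^p/p!)·λ^p·(t'−δt)^p ) dt'. -/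
open Real

/-- The exponential remainder `e^{λ(δt−t)} − Σ_{p<n} (λ(δt−t))^p/p!`. -/
noncomputable def remG (lam d : ℝ) (n : ℕ) (t : ℝ) : ℝ :=
  Real.exp (lam * (d - t)) - ∑ p ∈ Finset.range n, (lam * (d - t)) ^ p / (Nat.factorial p)

lemma remG_hasDerivAt (lam d : ℝ) (n : ℕ) (t : ℝ) :
    HasDerivAt (remG lam d (n + 1)) (-lam * remG lam d n t) t := by
  have hl : HasDerivAt (fun t : ℝ => lam * (d - t)) (-lam) t := by
    simpa using ((hasDerivAt_id t).const_sub d).const_mul lam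
  have hs : ∀ n : ℕ, HasDerivAt
      (fun t : ℝ => ∑ p ∈ Finset.range (n + 1), (lam * (d - t)) ^ p / (Nat.factorial p : ℝ))
      (-lam * ∑ p ∈ Finset.range n, (lam * (d - t)) ^ p / (Nat.factorial p : ℝ)) t := by
    intro n
    induction n with
    | zero => simpa using hasDerivAt_const t (1 : ℝ)
    | succ k ih =>
      have h1 := ih.add ((hl.pow (k + 1)).div_const (Nat.factorial (k + 1) : ℝ))
      have he : (fun t : ℝ => ∑ p ∈ Finset.range (k + 1 + 1),
          (lam * (d - t)) ^ p / (Nat.factorial p : ℝ)) =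
          (fun t : ℝ => ∑ p ∈ Finset.range (k + 1),
          (lam * (d - t)) ^ p / (Nat.factorial p : ℝ)) +
          (fun t : ℝ => (lam * (d - t)) ^ (k + 1) / (Nat.factorial (k + 1) : ℝ)) := by
        funext x
        simp [Finset.sum_range_succ _ (k + 1)]
      rw [he]
      refine h1.congr_deriv ?_
      rw [Finset.sum_range_succ _ k, Nat.factorial_succ]
      have h2 : (Nat.factorial k : ℝ) ≠ 0 := by positivity
      have h3 : (k : ℝ) + 1 ≠ 0 := by positivity
      push_cast
      field_simp
      ring
  refine (hl.exp.sub (hs n)).congr_deriv ?_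
  unfold remG
  ring

lemma remG_end (lam d : ℝ) (n : ℕ) : remG lam d (n + 1) d = 0 := by
  simp [remG, Finset.sum_range_succ']

lemma remG_continuous (lam d : ℝ) (n : ℕ) : Continuous (remG lam d n) := by
  unfold remG
  fun_prop

lemma remG_step (lam : ℝ) (hlam : lam ≠ 0) (d : ℝ) (hd : 0 < d) (n : ℕ) (u v : ℝ → ℝ)
    (hu : ∀ t ∈ Set.Icc (0 : ℝ) d, HasDerivWithinAt u (v t) (Set.Icc (0 : ℝ) d) t)
    (hv : ContinuousOn v (Set.Icc (0 : ℝ) d)) :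
    ∫ t in (0:ℝ)..d, u t * remG lam d n t =
      u 0 * lam⁻¹ * remG lam d (n + 1) 0 +
        lam⁻¹ * ∫ t in (0:ℝ)..d, v t * remG lam d (n + 1) t := by
  have h := intervalIntegral.integral_mul_deriv_eq_deriv_mul_of_hasDerivWithinAt
    (a := 0) (b := d) (u := u) (u' := v) (v := remG lam d (n + 1))
    (v' := fun t => -lam * remG lam d n t)
    (by rw [Set.uIcc_of_le hd.le]; exact hu)
    (fun t _ => (remG_hasDerivAt lam d n t).hasDerivWithinAt)
    (by apply ContinuousOn.intervalIntegrable; rwa [Set.uIcc_of_le hd.le])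
    (((remG_continuous lam d n).const_mul (-lam)).intervalIntegrable _ _)
  rw [remG_end] at h
  have h2 : ∫ t in (0:ℝ)..d, u t * (-lam * remG lam d n t) =
      -lam * ∫ t in (0:ℝ)..d, u t * remG lam d n t := by
    rw [← intervalIntegral.integral_const_mul]
    congr 1
    funext t
    ring
  rw [h2] at h
  field_simp
  linarith

/-- the `Q`-fold integration-by-parts expansion of
`∫_0^{δt} f(t') e^{λ(δt−t')} dt'`, with constants of integration chosen so that only
`f` and its derivatives at `0` appear in the integrated terms.  The function `f` is
`Q` times continuously differentiable on `[0, δt]`, encoded by the family `F` with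
`F 0 = f` and `F (q+1)` the derivative of `F q` on `[0, δt]`. -/
theorem stmt_17 (Q : ℕ) (hQ : 1 ≤ Q) (lam : ℝ) (hlam : lam ≠ 0)
    (δt : ℝ) (hδt : 0 < δt)
    (F : ℕ → ℝ → ℝ)
    (hF : ∀ q : ℕ, q < Q → ∀ t ∈ Set.Icc (0 : ℝ) δt,
      HasDerivWithinAt (F q) (F (q + 1) t) (Set.Icc (0 : ℝ) δt) t)
    (hFc : ContinuousOn (F Q) (Set.Icc (0 : ℝ) δt)) :
    ∫ t' in (0:ℝ)..δt, F 0 t' * Real.exp (lam * (δt - t')) =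
      (∑ q ∈ Finset.Icc 1 Q, F (q - 1) 0 * lam ^ (-(q : ℤ)) *
        (Real.exp (lam * δt) - ∑ p ∈ Finset.range q,
          δt ^ p * lam ^ p / (Nat.factorial p))) +
      lam ^ (-(Q : ℤ)) *
        ∫ t' in (0:ℝ)..δt, F Q t' *
          (Real.exp (lam * (δt - t')) - ∑ p ∈ Finset.range Q,
            ((-1 : ℝ) ^ p / (Nat.factorial p)) * lam ^ p * (t' - δt) ^ p) := by
  have hc : ∀ q ≤ Q, ContinuousOn (F q) (Set.Icc (0 : ℝ) δt) := by
    intro q hq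
    rcases hq.lt_or_eq with h | h
    · exact fun t ht => (hF q h t ht).continuousWithinAt
    · rw [h]; exact hFc
  have key : ∀ n ≤ Q, ∫ t in (0:ℝ)..δt, F 0 t * remG lam δt 0 t =
      (∑ q ∈ Finset.range n, F q 0 * lam ^ (-((q + 1 : ℕ) : ℤ)) * remG lam δt (q + 1) 0) +
      lam ^ (-(n : ℤ)) * ∫ t in (0:ℝ)..δt, F n t * remG lam δt n t := by
    intro n
    induction n with
    | zero => intro _; simp
    | succ k ih =>
      intro hk
      rw [ih (by omega), remG_step lam hlam δt hδt k (F k) (F (k + 1)) (hF k (by omega))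
        (hc (k + 1) hk), Finset.sum_range_succ]
      have hp : lam ^ (-((k + 1 : ℕ) : ℤ)) = lam ^ (-(k : ℤ)) * lam⁻¹ := by
        rw [zpow_neg, zpow_neg, zpow_natCast, zpow_natCast, pow_succ, mul_inv]
      rw [hp]
      ring
  have hk := key Q le_rfl
  have e0 : ∀ t, remG lam δt 0 t = Real.exp (lam * (δt - t)) := by
    intro t; simp [remG]
  have e1 : ∀ q, remG lam δt q 0 = Real.exp (lam * δt) - ∑ p ∈ Finset.range q,
      δt ^ p * lam ^ p / (Nat.factorial p) := by
    intro q
    simp only [remG, sub_zero, mul_pow, mul_comm]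
  have e2 : ∀ t, remG lam δt Q t = Real.exp (lam * (δt - t)) - ∑ p ∈ Finset.range Q,
      ((-1 : ℝ) ^ p / (Nat.factorial p)) * lam ^ p * (t - δt) ^ p := by
    intro t
    unfold remG
    congr 1
    refine Finset.sum_congr rfl fun p _ => ?_
    have : lam * (δt - t) = (-1) * lam * (t - δt) := by ring
    rw [this, mul_pow, mul_pow]
    ring
  simp only [e0, e1, e2] at hk
  rw [hk]
  congr 1
  rw [Finset.range_eq_Ico, Finset.sum_Ico_eq_sum_range, ← Finset.Ico_add_one_right_eq_Icc,
    Finset.sum_Ico_eq_sum_range]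
  refine Finset.sum_congr (by simp) fun q _ => ?_
  simp [add_comm]
end

section
/- Let n and a be integers with 1 ≤ a < n and n−a ≥ 2, and let k₁ be an odd integer with 1 ≤ k₁ ≤ 2(n−a−1). If sin[(2a+1)·(k₁+1)·π/(4(n−a))] = 0, then there exists an integer s with 1 ≤ s ≤ a such that (2a+1)·(k₁+1) = 4·(n−a)·s, and consequently the eigenvalues coincide: −2·[1 − cos(π·(k₁+1)/(2(n−a)))] = −2·[1 − cos(2π·s/(2a+1))]; that is, λ_{k₁} = λ_{k₂} for the odd index k₂ = (2s−1) + 2(n−a−1) > 2(n−a−1). -/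
open Real

/-- if the left-eigenvector normalising factor
`sin[(2a+1)(k₁+1)π/(4(n−a))]` vanishes for an odd `k₁ ≤ 2(n−a−1)`, then
`(2a+1)(k₁+1) = 4(n−a)s` for some `1 ≤ s ≤ a`, and consequently the eigenvalue
`λ_{k₁}` coincides with the eigenvalue `λ_{k₂}` for `k₂ = (2s−1) + 2(n−a−1)`. -/
theorem stmt_19 (n a : ℕ) (ha : 1 ≤ a) (han : a < n) (hna : 2 ≤ n - a)
    (k₁ : ℕ) (hk₁o : Odd k₁) (hk₁1 : 1 ≤ k₁) (hk₁le : k₁ ≤ 2 * (n - a - 1))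
    (h : Real.sin ((2 * (a : ℝ) + 1) * ((k₁ : ℝ) + 1) * π / (4 * ((n : ℝ) - a))) = 0) :
    ∃ s : ℕ, 1 ≤ s ∧ s ≤ a ∧
      (2 * a + 1) * (k₁ + 1) = 4 * (n - a) * s ∧
      -2 * (1 - Real.cos (π * ((k₁ : ℝ) + 1) / (2 * ((n : ℝ) - a)))) =
      -2 * (1 - Real.cos (2 * π * (s : ℝ) / (2 * (a : ℝ) + 1))) := by
  obtain ⟨m, rfl⟩ : ∃ m, n = a + m := ⟨n - a, by omega⟩
  have hm : a + m - a = m := by omega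
  rw [hm] at hna hk₁le ⊢
  have hmr : (((a + m : ℕ) : ℝ) - a) = m := by push_cast; ring
  rw [hmr] at h ⊢
  have hm0 : (0 : ℝ) < m := by exact_mod_cast (by omega : 0 < m)
  have ha0 : (0 : ℝ) < 2 * (a : ℝ) + 1 := by positivity
  obtain ⟨z, hz⟩ := Real.sin_eq_zero_iff.mp h
  have hπ := Real.pi_pos
  have hzr : (2 * (a : ℝ) + 1) * ((k₁ : ℝ) + 1) = 4 * m * z := by
    field_simp at hz
    linarith
  have hzi : (2 * (a : ℤ) + 1) * ((k₁ : ℤ) + 1) = 4 * m * z := by exact_mod_cast hzr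
  have hmz : (0 : ℤ) < m := by omega
  have hzpos : 0 < z := by
    have h1 : (0 : ℤ) < 4 * m * z := by rw [← hzi]; positivity
    exact pos_of_mul_pos_right h1 (by positivity)
  obtain ⟨s, rfl⟩ := Int.eq_ofNat_of_zero_le hzpos.le
  have hs : (2 * a + 1) * (k₁ + 1) = 4 * m * s := by exact_mod_cast hzi
  have hsr : (2 * (a : ℝ) + 1) * ((k₁ : ℝ) + 1) = 4 * m * s := by exact_mod_cast hs
  refine ⟨s, by omega, ?_, hs, ?_⟩
  · by_contra hlt
    have h1 : k₁ + 1 < 2 * m := by omega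
    have h2 : (2 * a + 1) * (k₁ + 1) < (2 * a + 1) * (2 * m) :=
      Nat.mul_lt_mul_of_pos_left h1 (by omega)
    have h3 : 4 * m * (a + 1) ≤ 4 * m * s := Nat.mul_le_mul_left _ (by omega)
    nlinarith
  · have harg : π * ((k₁ : ℝ) + 1) / (2 * (m : ℝ)) = 2 * π * (s : ℝ) / (2 * (a : ℝ) + 1) := by
      rw [div_eq_div_iff (by positivity) (by positivity)]
      linear_combination π * hsr
    rw [harg]
end
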